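/- Under the Riemann Hypothesis: let m ≥ 0 be an integer, K a compact subset of the strip {1/2 < Re(s) < 1} with connected complement, and f continuous on K and holomorphic in its interior. Then for every ε > 0, liminf_{T→∞} (1/T) · meas{τ ∈ [T, 2T] : sup_{s ∈ K} |η̃_m(s + iτ) − f(s)| < ε} > 0. -/

import Mathlib

open Complex MeasureTheory Filter

/-- The iterated integrals of `log ζ`: `η̃₀(σ + it) = ∫_∞^σ (ζ'/ζ)(α + it) dα = log ζ(σ + it)`
and `η̃_{m+1}(σ + it) = ∫_σ^∞ η̃_m(α + it) dα`. -/
noncomputable def etaIter : ℕ → ℂ → ℂ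
  | 0 => fun s => -∫ α in Set.Ioi s.re,
      deriv riemannZeta ((α : ℂ) + s.im * I) / riemannZeta ((α : ℂ) + s.im * I)
  | (m + 1) => fun s => ∫ α in Set.Ioi s.re, etaIter m ((α : ℂ) + s.im * I)

namespace Univ

/-- `h` restricted to `K` lies in the uniform closure of the polynomials. -/
def Appr (K : Set ℂ) [CompactSpace K] (h : ℂ → ℂ) : Prop :=
  ∃ g ∈ (polynomialFunctions K).topologicalClosure, ∀ z : K, g z = h z

lemma Appr.add {K : Set ℂ} [CompactSpace K] {f g : ℂ → ℂ} (hf : Appr K f) (hg : Appr K g) :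
    Appr K (fun z => f z + g z) := by
  obtain ⟨a, ha, ha'⟩ := hf
  obtain ⟨b, hb, hb'⟩ := hg
  exact ⟨a + b, add_mem ha hb, fun z => by simp [ha', hb']⟩

lemma Appr.mul {K : Set ℂ} [CompactSpace K] {f g : ℂ → ℂ} (hf : Appr K f) (hg : Appr K g) :
    Appr K (fun z => f z * g z) := by
  obtain ⟨a, ha, ha'⟩ := hf
  obtain ⟨b, hb, hb'⟩ := hg
  exact ⟨a * b, mul_mem ha hb, fun z => by simp [ha', hb']⟩

lemma Appr.poly (K : Set ℂ) [CompactSpace K] (p : Polynomial ℂ) : Appr K (fun z => p.eval z) := by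
  refine ⟨p.toContinuousMapOn K, ?_, fun z => by simp⟩
  apply Subalgebra.le_topologicalClosure
  exact ⟨p, trivial, rfl⟩

lemma Appr.const (K : Set ℂ) [CompactSpace K] (c : ℂ) : Appr K (fun _ => c) := by
  simpa using Appr.poly K (Polynomial.C c)

lemma Appr.id (K : Set ℂ) [CompactSpace K] : Appr K (fun z => z) := by
  simpa using Appr.poly K (Polynomial.X)

lemma Appr.congr {K : Set ℂ} [CompactSpace K] {f g : ℂ → ℂ} (hf : Appr K f) (h : ∀ z ∈ K, f z = g z) :
    Appr K g := by
  obtain ⟨a, ha, ha'⟩ := hf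
  exact ⟨a, ha, fun z => by rw [ha', h z z.2]⟩

lemma Appr.sum {K : Set ℂ} [CompactSpace K] {ι : Type*} (s : Finset ι) {f : ι → ℂ → ℂ}
    (hf : ∀ i ∈ s, Appr K (f i)) : Appr K (fun z => ∑ i ∈ s, f i z) := by
  classical
  induction s using Finset.induction_on with
  | empty => simpa using Appr.const K 0
  | insert a s ha ih =>
    simp only [Finset.sum_insert ha]
    exact (hf a (by simp)).add (ih fun i hi => hf i (by simp [hi]))

lemma Appr.prod {K : Set ℂ} [CompactSpace K] {ι : Type*} (s : Finset ι) {f : ι → ℂ → ℂ}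
    (hf : ∀ i ∈ s, Appr K (f i)) : Appr K (fun z => ∏ i ∈ s, f i z) := by
  classical
  induction s using Finset.induction_on with
  | empty => simpa using Appr.const K 1
  | insert a s ha ih =>
    simp only [Finset.prod_insert ha]
    exact (hf a (by simp)).mul (ih fun i hi => hf i (by simp [hi]))

lemma Appr.exists_poly {K : Set ℂ} [CompactSpace K] {f : ℂ → ℂ} (hf : Appr K f)
    {ε : ℝ} (hε : 0 < ε) : ∃ p : Polynomial ℂ, ∀ z ∈ K, ‖p.eval z - f z‖ < ε := by
  obtain ⟨g, hg, hg'⟩ := hf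
  have hg2 : g ∈ closure ((polynomialFunctions K : Subalgebra ℂ C(K, ℂ)) : Set C(K, ℂ)) := hg
  rw [Metric.mem_closure_iff] at hg2
  obtain ⟨b, ⟨p, -, hp⟩, hb'⟩ := hg2 ε hε
  refine ⟨p, fun z hz => ?_⟩
  have h1 := ContinuousMap.dist_lt_iff hε |>.mp hb' ⟨z, hz⟩
  rw [hg', dist_comm, dist_eq_norm, ← hp] at h1
  simpa using h1

lemma Appr.of_limit {K : Set ℂ} [CompactSpace K] {f : ℂ → ℂ} (hfc : ContinuousOn f K)
    (h : ∀ ε > 0, ∃ g, Appr K g ∧ ∀ z ∈ K, ‖g z - f z‖ ≤ ε) : Appr K f := by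
  let F : C(K, ℂ) := ⟨fun z => f z, continuousOn_iff_continuous_domRestrict.mp hfc⟩
  refine ⟨F, ?_, fun z => rfl⟩
  have : F ∈ closure (((polynomialFunctions K).topologicalClosure : Subalgebra ℂ C(K, ℂ)) : Set C(K, ℂ)) := by
    rw [Metric.mem_closure_iff]
    intro ε hε
    obtain ⟨g, ⟨G, hG, hG'⟩, hg⟩ := h (ε/2) (by positivity)
    refine ⟨G, hG, lt_of_le_of_lt ((ContinuousMap.dist_le (by positivity : 0 ≤ ε/2)).mpr ?_) (by linarith)⟩
    intro z
    rw [dist_comm, dist_eq_norm, hG']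
    exact hg z z.2
  rwa [(Subalgebra.isClosed_topologicalClosure _).closure_eq] at this

lemma Appr.inv {K : Set ℂ} [CompactSpace K] (hKc : IsConnected Kᶜ) {w : ℂ} (hw : w ∉ K) :
    Appr K (fun z => (z - w)⁻¹) := by
  let X : C(K, ℂ) := ⟨fun z => (z : ℂ), continuous_subtype_val⟩
  obtain ⟨X', hX', hXX⟩ := Appr.id K
  have hXe : X' = X := by ext z; exact hXX z
  subst hXe
  let S : Subalgebra ℂ C(K, ℂ) := (polynomialFunctions K).topologicalClosure
  have : IsClosed (S : Set C(K, ℂ)) := Subalgebra.isClosed_topologicalClosure _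
  have hs : spectrum ℂ X = K := by
    rw [ContinuousMap.spectrum_eq_range]
    ext z; simp [X]
  have h1 : spectrum ℂ (⟨X, hX'⟩ : S) = spectrum ℂ X :=
    Subalgebra.spectrum_eq_of_isPreconnected_compl S ⟨X, hX'⟩ (by
      show IsPreconnected (spectrum ℂ X)ᶜ
      rw [hs]; exact hKc.isPreconnected)
  have h2 : w ∉ spectrum ℂ (⟨X, hX'⟩ : S) := by rw [h1, hs]; exact hw
  rw [spectrum.notMem_iff] at h2
  obtain ⟨u, hu⟩ := h2
  refine ⟨-((↑(u⁻¹) : S) : C(K, ℂ)), neg_mem (↑(u⁻¹) : S).2, fun z => ?_⟩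
  have h3 : ((u : S) : C(K, ℂ)) * ((↑(u⁻¹) : S) : C(K, ℂ)) = 1 := by
    have := u.mul_inv
    exact congrArg Subtype.val this
  have h4 := congrArg (fun f : C(K, ℂ) => f z) h3
  have h5 : ((u : S) : C(K, ℂ)) z = w - z := by
    rw [hu]; simp [X, Algebra.algebraMap_eq_smul_one]
  simp only [ContinuousMap.mul_apply, ContinuousMap.one_apply] at h4
  rw [h5] at h4
  have hne : (z : ℂ) - w ≠ 0 := fun h => hw (by rw [← sub_eq_zero.mp h]; exact z.2)
  simp only [ContinuousMap.neg_apply]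
  field_simp
  linear_combination h4

lemma Appr.comp {K : Set ℂ} [CompactSpace K] {φ : ℂ → ℂ}
    (hφ : DifferentiableOn ℂ φ (Metric.ball 0 1)) {h : ℂ → ℂ} (hh : Appr K h)
    (hb : ∀ z ∈ K, ‖h z‖ ≤ 1/2) : Appr K (fun z => φ (h z)) := by
  obtain ⟨g, hg, hg'⟩ := hh
  let c : ℕ → ℂ := fun n => ((n.factorial : ℂ))⁻¹ * iteratedDeriv n φ 0
  have hc : ∀ z : ℂ, ‖z‖ < 1 → HasSum (fun n => c n * z ^ n) (φ z) := by
    intro z hz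
    have := Complex.hasSum_taylorSeries_on_ball hφ (z := z) (by simpa using hz)
    have e : (fun n => c n * z ^ n) = fun n : ℕ => ((n.factorial : ℂ))⁻¹ • (z - 0) ^ n • iteratedDeriv n φ 0 := by
      funext n; simp only [c, smul_eq_mul, sub_zero]; ring
    rw [e]; exact this
  have hbd : ∃ M, ∀ n, ‖c n‖ ≤ M * (4/3) ^ n := by
    have h1 := (hc (3/4 : ℝ) (by rw [Complex.norm_real]; norm_num)).summable.tendsto_atTop_zero
    obtain ⟨M, hM⟩ := h1.norm.bddAbove_range
    refine ⟨M, fun n => ?_⟩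
    have := hM ⟨n, rfl⟩
    simp only [norm_mul, norm_pow, Complex.norm_real] at this
    have h3 : ‖(3/4:ℝ)‖ = 3/4 := by norm_num
    rw [h3] at this
    have h4 : ((3/4:ℝ))^n * (4/3)^n = 1 := by rw [← mul_pow]; norm_num
    calc ‖c n‖ = (‖c n‖ * (3/4)^n) * (4/3)^n := by rw [mul_assoc, h4, mul_one]
      _ ≤ M * (4/3)^n := by gcongr
  obtain ⟨M, hM⟩ := hbd
  have hgn : ‖g‖ ≤ 1/2 := (ContinuousMap.norm_le _ (by norm_num)).mpr fun z => by
    rw [hg']; exact hb z z.2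
  have hsum : Summable (fun n => c n • g ^ n) := by
    refine Summable.of_norm_bounded (g := fun n => M * (2/3:ℝ)^n)
      ((summable_geometric_of_lt_one (by norm_num) (by norm_num)).mul_left M) fun n => ?_
    have hM0 : 0 ≤ M := by have := hM 0; simp at this; exact (norm_nonneg _).trans this
    calc ‖c n • g ^ n‖ ≤ ‖c n‖ * ‖g‖ ^ n := by
          rw [norm_smul]; gcongr
          rcases isEmpty_or_nonempty K with hE | hE
          · have : g ^ n = 0 := by ext z; exact (hE.false z).elim
            rw [this]; simp
          · exact norm_pow_le g n
      _ ≤ (M * (4/3)^n) * (1/2)^n := by gcongr; exact hM n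
      _ = M * (2/3)^n := by rw [mul_assoc, ← mul_pow]; norm_num
  refine ⟨∑' n, c n • g ^ n, ?_, fun z => ?_⟩
  · refine (Subalgebra.isClosed_topologicalClosure _).mem_of_tendsto hsum.hasSum.tendsto_sum_nat ?_
    refine Eventually.of_forall fun N => ?_
    exact sum_mem fun n _ => Subalgebra.smul_mem _ (pow_mem hg n) _
  · have h1 : HasSum (fun n => (c n • g ^ n) z) ((∑' n, c n • g ^ n) z) :=
      ContinuousMap.hasSum_apply hsum.hasSum z
    have h2 := hc (h z) ((hb z z.2).trans_lt (by norm_num))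
    refine h1.unique ?_
    convert h2 using 2 with n
    simp [hg']

end Univ

namespace Univ

lemma exists_chain {K : Set ℂ} (hK : IsCompact K) (hKc : IsConnected Kᶜ) {c : ℂ} (hc : c ∉ K)
    {δ : ℝ} (hδ : 0 < δ) : ∃ (n : ℕ) (γ : ℕ → ℂ), γ 0 = c ∧ (∀ i ≤ n, γ i ∉ K) ∧
      (∀ i ≤ n, ‖γ i - c‖ ≤ δ) ∧ δ / 2 < ‖γ n - c‖ ∧
      ∀ i < n, ∀ z ∈ K, ‖γ (i+1) - γ i‖ ≤ 1/2 * ‖z - γ (i+1)‖ := by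
  have hpc : IsPathConnected Kᶜ := (hK.isClosed.isOpen_compl.isConnected_iff_isPathConnected).mp hKc
  obtain ⟨e, heK, he⟩ : ∃ e ∈ Kᶜ, δ / 2 < ‖e - c‖ := by
    obtain ⟨R, hR⟩ := hK.isBounded.exists_norm_le
    refine ⟨((|R| + ‖c‖ + δ + 1 : ℝ) : ℂ), fun h => ?_, ?_⟩
    · have := hR _ h
      rw [Complex.norm_real, Real.norm_eq_abs, abs_of_nonneg (by positivity)] at this
      have := le_abs_self R
      have := norm_nonneg c
      linarith
    · have h1 := norm_sub_norm_le ((|R| + ‖c‖ + δ + 1 : ℝ) : ℂ) c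
      rw [Complex.norm_real, Real.norm_eq_abs, abs_of_nonneg (by positivity)] at h1
      have := abs_nonneg R
      linarith
  obtain ⟨γ, hγ⟩ := hpc.joinedIn c hc e heK
  have hdisj : Disjoint (Set.range γ) K := by
    rw [Set.disjoint_left]
    rintro _ ⟨t, rfl⟩
    exact hγ t
  obtain ⟨r, hr, hr'⟩ := Metric.exists_pos_forall_lt_edist (isCompact_range γ.continuous) hK.isClosed hdisj
  have hr2 : ∀ t, ∀ z ∈ K, (r : ℝ) ≤ ‖z - γ t‖ := by
    intro t z hz
    have := (hr' _ ⟨t, rfl⟩ z hz).le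
    rw [edist_dist, ENNReal.le_ofReal_iff_toReal_le (by simp) dist_nonneg] at this
    rw [← dist_eq_norm, dist_comm]; simpa using this
  have huc := CompactSpace.uniformContinuous_of_continuous γ.continuous
  rw [Metric.uniformContinuous_iff] at huc
  obtain ⟨d, hd, hd'⟩ := huc (min (r/2) (δ/2)) (by positivity)
  obtain ⟨N, hN⟩ := exists_nat_gt (1 / d)
  have hN0 : 0 < (N : ℝ) := lt_trans (by positivity) hN
  let t : ℕ → unitInterval := fun i => Set.projIcc 0 1 zero_le_one ((i : ℝ) / N)
  have ht : ∀ i, ‖γ (t (i+1)) - γ (t i)‖ < min ((r:ℝ)/2) (δ/2) := by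
    intro i
    rw [← dist_eq_norm]
    apply hd'
    refine lt_of_le_of_lt ((LipschitzWith.projIcc zero_le_one).dist_le_mul _ _) ?_
    rw [NNReal.coe_one, one_mul, Real.dist_eq]
    push_cast
    rw [← sub_div, add_sub_cancel_left, abs_of_pos (by positivity), div_lt_iff₀ hN0]
    rw [div_lt_iff₀ hd] at hN; linarith
  have hex : ∃ i, δ / 2 < ‖γ (t i) - c‖ := by
    refine ⟨N, ?_⟩
    have : t N = 1 := by
      simp [t, div_self hN0.ne']
    rw [this]; simpa using he
  classical
  have ht0 : γ (t 0) = c := by simp [t]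
  have hsm : ∀ i < Nat.find hex, ‖γ (t i) - c‖ ≤ δ / 2 := fun i hi => not_lt.mp (Nat.find_min hex hi)
  refine ⟨Nat.find hex, fun i => γ (t i), ht0, fun i _ => hγ _, ?_, Nat.find_spec hex, ?_⟩
  · intro i hi
    rcases hi.lt_or_eq with hi | hi
    · exact (hsm i hi).trans (by linarith)
    · have hpos : i ≠ 0 := by
        rintro rfl
        have := Nat.find_spec hex
        rw [← hi, ht0] at this
        simp at this; linarith
      obtain ⟨j, rfl⟩ := Nat.exists_eq_succ_of_ne_zero hpos
      have h1 := hsm j (by omega)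
      have h2 := ht j
      have h3 := norm_add_le (γ (t (j+1)) - γ (t j)) (γ (t j) - c)
      rw [sub_add_sub_cancel] at h3
      have := min_le_right ((r:ℝ)/2) (δ/2)
      show ‖γ (t (j+1)) - c‖ ≤ δ
      linarith
  · intro i hi z hz
    have h1 := hr2 (t (i+1)) z hz
    have h2 := ht i
    have := min_le_left ((r:ℝ)/2) (δ/2)
    linarith

/-- principal square root of `1+u` -/
noncomputable def sq1 (u : ℂ) : ℂ := exp (1/2 * log (1 + u))

lemma sq1_diff : DifferentiableOn ℂ sq1 (Metric.ball 0 1) := by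
  intro u hu
  have h1 : (1 + u) ∈ slitPlane := mem_slitPlane_of_norm_lt_one (by simpa using hu)
  unfold sq1
  have : DifferentiableAt ℂ (fun u => log (1 + u)) u :=
    DifferentiableAt.clog (by fun_prop) h1
  exact ((this.const_mul _).cexp).differentiableWithinAt

lemma sq1_sq {u : ℂ} (hu : 1 + u ≠ 0) : sq1 u ^ 2 = 1 + u := by
  rw [sq1, ← Complex.exp_nat_mul]
  have : ((2:ℕ):ℂ) * (1/2 * log (1+u)) = log (1+u) := by push_cast; ring
  rw [this, exp_log hu]

lemma log_div_aux {x y : ℂ} (hx : 0 < x.re) (hy : 0 < y.re) : log (x / y) = log x - log y := by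
  have hx0 : x ≠ 0 := by rintro rfl; simp at hx
  have hy0 : y ≠ 0 := by rintro rfl; simp at hy
  have ha : |x.arg| < Real.pi / 2 := abs_arg_lt_pi_div_two_iff.mpr (Or.inl hx)
  have hb : |y.arg| < Real.pi / 2 := abs_arg_lt_pi_div_two_iff.mpr (Or.inl hy)
  rw [abs_lt] at ha hb
  have hpi := Real.pi_pos
  have hy1 : y.arg ≠ Real.pi := by linarith [hb.2]
  rw [div_eq_mul_inv, (log_mul_eq_add_log_iff hx0 (inv_ne_zero hy0)).mpr, log_inv _ hy1, sub_eq_add_neg]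
  rw [arg_inv, if_neg hy1]
  constructor <;> linarith [ha.1, ha.2, hb.1, hb.2]

/-- The key function: bounded by `C/δ` on `K`, close to `1/(z-p)` far away. -/
lemma exists_kernel {K : Set ℂ} [CompactSpace K] (hK : IsCompact K) (hKc : IsConnected Kᶜ) {c : ℂ}
    (hc : c ∉ K) {δ : ℝ} (hδ : 0 < δ) : ∃ (p : ℂ) (g : ℂ → ℂ), ‖p - c‖ ≤ δ ∧ Appr K g ∧
      (∀ z ∈ K, ‖g z‖ ≤ 232 / δ) ∧
      ∀ z ∈ K, 8 * δ ≤ ‖z - c‖ → ‖g z‖ ≤ 2 / ‖z - p‖ ∧ ‖g z - (z - p)⁻¹‖ ≤ δ^2 / ‖z - p‖^3 := by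
  obtain ⟨n, γ, h0, hγK, hγδ, hn, hstep⟩ := exists_chain hK hKc hc hδ
  set a := c with ha
  set b := γ n with hb
  have hba : ‖b - a‖ ≤ δ := hγδ n le_rfl
  have hba0 : b - a ≠ 0 := by
    intro h; rw [h] at hn; simp at hn; linarith
  let u : ℕ → ℂ → ℂ := fun i z => (γ (i+1) - γ i) * (z - γ (i+1))⁻¹
  have hzγ : ∀ z ∈ K, ∀ i ≤ n, z - γ i ≠ 0 := fun z hz i hi h => hγK i hi (by rwa [← sub_eq_zero.mp h])
  have hu : ∀ i < n, ∀ z ∈ K, ‖u i z‖ ≤ 1/2 := by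
    intro i hi z hz
    have h1 := hstep i hi z hz
    have h2 : 0 < ‖z - γ (i+1)‖ := norm_pos_iff.mpr (hzγ z hz _ hi)
    simp only [u, norm_mul, norm_inv]
    rw [← div_eq_mul_inv, div_le_iff₀ h2]; exact h1
  have h1u : ∀ i < n, ∀ z ∈ K, 1 + u i z = (z - γ i) / (z - γ (i+1)) := by
    intro i hi z hz
    have := hzγ z hz _ hi
    simp only [u]; field_simp; ring
  let q : ℂ → ℂ := fun z => ∏ i ∈ Finset.range n, sq1 (u i z)
  have hqA : Appr K q := by
    refine Appr.prod _ fun i hi => ?_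
    have hi' := Finset.mem_range.mp hi
    refine Appr.comp sq1_diff ?_ (hu i hi')
    exact (Appr.const K _).mul (Appr.inv hKc (hγK _ hi'))
  have hq2 : ∀ z ∈ K, q z ^ 2 = (z - a) / (z - b) := by
    intro z hz
    have : ∀ m ≤ n, ∏ i ∈ Finset.range m, (1 + u i z) = (z - a) / (z - γ m) := by
      intro m
      induction m with
      | zero => intro _; rw [h0]; simp [div_self (show z - a ≠ 0 from h0 ▸ hzγ z hz 0 (by omega))]
      | succ m ih =>
        intro hm
        rw [Finset.prod_range_succ, ih (by omega), h1u m (by omega) z hz, div_mul_div_cancel₀]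
        exact hzγ z hz m (by omega)
    rw [hb, ← this n le_rfl, ← Finset.prod_pow]
    refine Finset.prod_congr rfl fun i hi => sq1_sq ?_
    have hi' := Finset.mem_range.mp hi
    rw [h1u i hi' z hz]
    exact div_ne_zero (hzγ z hz i hi'.le) (hzγ z hz _ hi')
  have hfar : ∀ z ∈ K, 2 * δ ≤ ‖z - c‖ → 0 < (q z).re := by
    intro z hz hzc
    have hzc0 : 0 < ‖z - c‖ := by linarith
    have hzc1 : z - c ≠ 0 := norm_pos_iff.mp hzc0
    let x : ℕ → ℂ := fun i => (z - γ i) / (z - c)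
    have hx : ∀ i ≤ n, 0 < (x i).re := by
      intro i hi
      have : x i = 1 - (γ i - c) / (z - c) := by simp only [x]; field_simp; ring
      have h2 : ‖(γ i - c) / (z - c)‖ ≤ 1/2 := by
        rw [norm_div, div_le_iff₀ hzc0]
        linarith [hγδ i hi]
      have h3 := (abs_re_le_norm ((γ i - c) / (z - c))).trans h2
      rw [this, sub_re, one_re]
      linarith [(abs_le.mp h3).2]
    have hq : ∀ m ≤ n, ∏ i ∈ Finset.range m, sq1 (u i z) = exp (1/2 * (log (x 0) - log (x m))) := by
      intro m
      induction m with
      | zero => intro _; simp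
      | succ m ih =>
        intro hm
        rw [Finset.prod_range_succ, ih (by omega)]
        have : 1 + u m z = x m / x (m+1) := by
          rw [h1u m (by omega) z hz]
          have := hzγ z hz (m+1) hm
          simp only [x]; field_simp
        rw [sq1, this, log_div_aux (hx _ (by omega)) (hx _ hm), ← exp_add]
        congr 1; ring
    have hqn : q z = exp (1/2 * (log (x 0) - log (x n))) := hq n le_rfl
    rw [hqn, exp_re]
    apply mul_pos (Real.exp_pos _)
    apply Real.cos_pos_of_mem_Ioo
    have e : (1/2 * (log (x 0) - log (x n))).im = 1/2 * ((x 0).arg - (x n).arg) := by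
      have : (1/2 : ℂ) = ((1/2 : ℝ) : ℂ) := by push_cast; ring
      rw [this, im_ofReal_mul, sub_im, log_im, log_im]
    rw [e]
    have h1 : |(x 0).arg| < Real.pi / 2 := abs_arg_lt_pi_div_two_iff.mpr (Or.inl (hx 0 (by omega)))
    have h2 : |(x n).arg| < Real.pi / 2 := abs_arg_lt_pi_div_two_iff.mpr (Or.inl (hx n (by omega)))
    rw [abs_lt] at h1 h2
    constructor <;> linarith [h1.1, h1.2, h2.1, h2.2]
  -- lower bound on q+1
  have hq1 : ∀ z ∈ K, 1/14 ≤ ‖q z + 1‖ := by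
    intro z hz
    by_cases hzc : 2 * δ ≤ ‖z - c‖
    · have h1 := hfar z hz hzc
      have h2 := (le_abs_self _).trans (abs_re_le_norm (q z + 1))
      simp at h2; linarith
    · push Not at hzc
      by_contra hlt
      push Not at hlt
      have h1 : (q z - 1) * (q z + 1) = (b - a) / (z - b) := by
        have := hq2 z hz
        have h3 : z - b ≠ 0 := hzγ z hz n le_rfl
        have : (q z - 1) * (q z + 1) = (z - a) / (z - b) - 1 := by rw [← this]; ring
        rw [this]; field_simp; ring
      have h2 : ‖q z - 1‖ ≤ 2 + 1/14 := by
        have := norm_sub_le (q z + 1) 2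
        have e : q z + 1 - 2 = q z - 1 := by ring
        rw [e] at this
        norm_num at this
        linarith
      have h3 : ‖(q z - 1) * (q z + 1)‖ ≤ (2 + 1/14) * (1/14) := by
        rw [norm_mul]; gcongr
      rw [h1, norm_div, div_le_iff₀ (norm_pos_iff.mpr (hzγ z hz n le_rfl))] at h3
      have h4 : ‖z - b‖ ≤ ‖z - c‖ + ‖b - c‖ := by
        have := norm_sub_le (z - c) (b - c)
        rwa [sub_sub_sub_cancel_right] at this
      have : ‖b - c‖ = ‖b - a‖ := rfl
      nlinarith
  set d := (b - a) / 4 with hd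
  set p := (a + b) / 2 with hp
  have hd0 : d ≠ 0 := by rw [hd]; exact div_ne_zero hba0 (by norm_num)
  have hdn : δ / 8 ≤ ‖d‖ ∧ ‖d‖ ≤ δ / 4 := by
    rw [hd, norm_div]; norm_num
    constructor <;> linarith
  let g : ℂ → ℂ := fun z => (4 * (b - a)⁻¹ ^ 2) * ((q z - 1) ^ 2 * (z - b))
  have hq1' : ∀ z ∈ K, q z + 1 ≠ 0 := fun z hz h => by
    have := hq1 z hz; rw [h] at this; norm_num at this
  have hg : ∀ z ∈ K, g z = (q z - 1) / (q z + 1) / d := by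
    intro z hz
    have h1 := hq1' z hz
    have h2 := hq2 z hz
    have h3 : z - b ≠ 0 := hzγ z hz n le_rfl
    rw [eq_div_iff h3] at h2
    simp only [g, hd]
    field_simp
    have h4 : (q z - 1) * (q z + 1) * (z - b) = b - a := by linear_combination h2
    linear_combination (q z - 1) * h4
  have hid : ∀ z ∈ K, g z * (z - p) = 1 + d^2 * g z ^2 := by
    intro z hz
    have h1 := hq1' z hz
    have h2 := hq2 z hz
    have h3 : z - b ≠ 0 := hzγ z hz n le_rfl
    rw [eq_div_iff h3] at h2
    rw [hg z hz, hd, hp]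
    field_simp
    linear_combination 8 * h2
  have hpc : ‖p - c‖ ≤ δ / 2 := by
    have : p - c = (b - a) / 2 := by rw [hp, ← ha]; ring
    rw [this, norm_div]; norm_num; linarith
  refine ⟨p, g, by linarith, ?_, ?_, ?_⟩
  · have hz1 : Appr K (fun z => z - b) := by simpa [sub_eq_add_neg] using (Appr.id K).add (Appr.const K (-b))
    have hz2 : Appr K (fun z => q z - 1) := by simpa [sub_eq_add_neg] using hqA.add (Appr.const K (-1))
    have := (Appr.const K (4 * (b - a)⁻¹ ^ 2)).mul ((hz2.mul hz2).mul hz1)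
    exact this.congr fun z _ => by simp only [g]; ring
  · intro z hz
    rw [hg z hz, norm_div, norm_div]
    have h1 := hq1 z hz
    have h2 : ‖q z - 1‖ ≤ 29 * ‖q z + 1‖ := by
      have := norm_sub_le (q z + 1) 2
      have e : q z + 1 - 2 = q z - 1 := by ring
      rw [e] at this
      norm_num at this
      linarith
    have h3 : ‖q z - 1‖ / ‖q z + 1‖ ≤ 29 := by
      rw [div_le_iff₀ (by linarith)]; exact h2
    calc _ ≤ 29 / (δ/8) := by gcongr; exact hdn.1
      _ = 232 / δ := by field_simp; norm_num
  · intro z hz hzc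
    have hqr := hfar z hz (by linarith)
    have hzp : 7 * δ ≤ ‖z - p‖ := by
      have := norm_sub_norm_le (z - c) (p - c)
      rw [sub_sub_sub_cancel_right] at this
      linarith
    have hzp0 : 0 < ‖z - p‖ := by linarith
    have hu1 : ‖d * g z‖ ≤ 1 := by
      rw [hg z hz, mul_div_cancel₀ _ hd0, norm_div, div_le_one (norm_pos_iff.mpr (hq1' z hz))]
      rw [← sq_le_sq₀ (norm_nonneg _) (norm_nonneg _), ← normSq_eq_norm_sq, ← normSq_eq_norm_sq,
        normSq_apply, normSq_apply]
      simp
      nlinarith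
    have hg1 : ‖g z‖ ≤ 2 / ‖z - p‖ := by
      rw [le_div_iff₀ hzp0, ← norm_mul, hid z hz]
      calc _ ≤ ‖(1:ℂ)‖ + ‖d^2 * g z^2‖ := norm_add_le _ _
        _ ≤ 1 + 1 := by
          rw [← mul_pow, norm_pow, norm_one]
          gcongr
          exact pow_le_one₀ (norm_nonneg _) hu1
        _ = 2 := by norm_num
    refine ⟨hg1, ?_⟩
    have hzp1 : z - p ≠ 0 := norm_pos_iff.mp hzp0
    have e : g z - (z - p)⁻¹ = d^2 * g z^2 / (z - p) := by
      field_simp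
      linear_combination hid z hz
    rw [e, norm_div, norm_mul, norm_pow, norm_pow]
    calc _ ≤ (δ/4)^2 * (2 / ‖z - p‖)^2 / ‖z - p‖ := by gcongr; exact hdn.2
      _ = (1/4) * (δ^2 / ‖z - p‖^3) := by field_simp; norm_num
      _ ≤ _ := by
        have : 0 ≤ δ^2 / ‖z - p‖^3 := by positivity
        linarith

end Univ

namespace Univ

lemma polar_int {h : ℂ → ℂ} (hm : Measurable h) (hi : Integrable h) :
    ∫ w, h w = ∫ r in Set.Ioi (0:ℝ), (r:ℂ) * ∫ θ in Set.Ioo (-Real.pi) Real.pi, h (circleMap 0 r θ) := by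
  have hsymm : ∀ p : ℝ × ℝ, Complex.polarCoord.symm p = circleMap 0 p.1 p.2 := by
    intro p
    rw [Complex.polarCoord_symm_apply, circleMap_zero, Complex.exp_mul_I, Complex.ofReal_cos, Complex.ofReal_sin]
  have hcm : Measurable (fun p : ℝ × ℝ => circleMap 0 p.1 p.2) := by
    unfold circleMap; fun_prop
  have htar : _root_.polarCoord.target = Set.Ioi (0:ℝ) ×ˢ Set.Ioo (-Real.pi) Real.pi := rfl
  rw [← Complex.integral_comp_polarCoord_symm, htar, Measure.volume_eq_prod, setIntegral_prod]
  · refine setIntegral_congr_fun measurableSet_Ioi fun r _ => ?_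
    simp only [hsymm]
    rw [← integral_const_mul]
    simp
  · refine ⟨?_, ?_⟩
    · apply Measurable.aestronglyMeasurable
      simp only [hsymm]
      exact measurable_fst.smul (hm.comp hcm)
    · have h1 := Complex.lintegral_comp_polarCoord_symm (fun w => ‖h w‖ₑ)
      rw [htar] at h1
      rw [hasFiniteIntegral_iff_enorm, ← Measure.volume_eq_prod]
      have h2 := hi.2
      rw [hasFiniteIntegral_iff_enorm, ← h1] at h2
      refine lt_of_le_of_lt (setLIntegral_mono' (measurableSet_Ioi.prod measurableSet_Ioo) fun p hp => ?_) h2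
      rw [enorm_smul, smul_eq_mul]
      gcongr
      rw [Real.enorm_eq_ofReal (le_of_lt hp.1)]

lemma circle_int {r : ℝ} (hr : 0 < r) (g : ℂ → ℂ) :
    ∫ θ in Set.Ioo (-Real.pi) Real.pi, (circleMap 0 r θ / r) * g (circleMap 0 r θ)
      = (I * r)⁻¹ * ∮ w in C(0, r), g w := by
  have hper : Function.Periodic (fun θ => (circleMap 0 r θ / r) * g (circleMap 0 r θ)) (2 * Real.pi) := by
    intro θ
    simp only [periodic_circleMap 0 r θ]
  rw [← integral_Ioc_eq_integral_Ioo, ← intervalIntegral.integral_of_le (by linarith [Real.pi_pos])]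
  have := hper.intervalIntegral_add_eq (-Real.pi) 0
  have e : -Real.pi + 2 * Real.pi = Real.pi := by ring
  rw [e, zero_add] at this
  rw [this, circleIntegral, ← intervalIntegral.integral_const_mul]
  congr 1
  ext θ
  rw [deriv_circleMap]
  have : (r:ℂ) ≠ 0 := by exact_mod_cast hr.ne'
  simp only [smul_eq_mul]
  field_simp

noncomputable def cc (δ : ℝ) : ℝ := 3 / (Real.pi * δ ^ 3)

noncomputable def Bk (δ : ℝ) : ℂ → ℂ :=
  (Metric.ball 0 δ).indicator (fun w => -((cc δ / 2 : ℝ) : ℂ) * (w / (‖w‖ : ℂ)))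

lemma Bk_meas (δ : ℝ) : Measurable (Bk δ) := by
  unfold Bk
  exact Measurable.indicator (by fun_prop) measurableSet_ball

lemma cc_pos {δ : ℝ} (hδ : 0 < δ) : 0 < cc δ := by
  unfold cc; have := Real.pi_pos; positivity

lemma Bk_le {δ : ℝ} (hδ : 0 < δ) (w : ℂ) : ‖Bk δ w‖ ≤ cc δ / 2 := by
  have hc := cc_pos hδ
  unfold Bk
  by_cases h : w ∈ Metric.ball 0 δ
  · rw [Set.indicator_of_mem h, norm_mul, norm_neg, Complex.norm_real, Real.norm_of_nonneg (by positivity), norm_div,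
      Complex.norm_real, norm_norm]
    have : ‖w‖ / ‖w‖ ≤ 1 := div_self_le_one _
    nlinarith
  · rw [Set.indicator_of_notMem h]; simp; positivity

lemma Bk_zero {δ : ℝ} {w : ℂ} (h : δ ≤ ‖w‖) : Bk δ w = 0 := by
  unfold Bk
  rw [Set.indicator_of_notMem]; simpa using h

lemma Bk_circle {δ r : ℝ} (hr : 0 < r) (hrδ : r < δ) (θ : ℝ) :
    Bk δ (circleMap 0 r θ) = -((cc δ / 2 : ℝ) : ℂ) * (circleMap 0 r θ / r) := by
  unfold Bk
  rw [Set.indicator_of_mem]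
  · simp [abs_of_pos hr]
  · simp [abs_of_pos hr, hrδ]

lemma Bk_mul_integrable {δ : ℝ} (hδ : 0 < δ) {F : ℂ → ℂ} (hF : Continuous F) :
    Integrable (fun w => F w * Bk δ w) := by
  have h1 : (fun w => F w * Bk δ w) =
      (Metric.closedBall (0:ℂ) δ).indicator (fun w => F w * Bk δ w) := by
    ext w
    by_cases h : w ∈ Metric.closedBall (0:ℂ) δ
    · rw [Set.indicator_of_mem h]
    · rw [Set.indicator_of_notMem h, Bk_zero (by simp at h; exact h.le), mul_zero]
  rw [h1, integrable_indicator_iff measurableSet_closedBall]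
  refine Integrable.mul_bdd (c := cc δ / 2) ?_ (Bk_meas δ).aestronglyMeasurable (Eventually.of_forall fun w => Bk_le hδ w)
  exact hF.continuousOn.integrableOn_compact (isCompact_closedBall _ _)

lemma Bk_mean {δ : ℝ} (hδ : 0 < δ) {F : ℂ → ℂ} (hF : Continuous F)
    (hd : DifferentiableOn ℂ F (Metric.ball 0 δ)) : ∫ w, F w * Bk δ w = 0 := by
  rw [polar_int (h := fun w => F w * Bk δ w) (hF.measurable.mul (Bk_meas δ)) (Bk_mul_integrable hδ hF)]
  rw [setIntegral_congr_fun (g := fun _ => (0:ℂ)) measurableSet_Ioi, integral_zero]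
  intro r (hr : 0 < r)
  simp only
  by_cases hrδ : r < δ
  · have : ∀ θ, F (circleMap 0 r θ) * Bk δ (circleMap 0 r θ)
        = (circleMap 0 r θ / r) * (-((cc δ / 2 : ℝ) : ℂ) * F (circleMap 0 r θ)) := by
      intro θ; rw [Bk_circle hr hrδ]; ring
    simp only [this]
    rw [circle_int hr (fun w => -((cc δ / 2 : ℝ) : ℂ) * F w)]
    have h0 : ∮ w in C(0, r), (-((cc δ / 2 : ℝ) : ℂ) * F w) = 0 := by
      apply DiffContOnCl.circleIntegral_eq_zero hr.le
      apply DifferentiableOn.diffContOnCl_ball (U := Metric.ball 0 δ)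
      · exact hd.const_mul _
      · exact Metric.closedBall_subset_ball hrδ
    rw [h0]; simp
  · have : ∀ θ, Bk δ (circleMap 0 r θ) = 0 := fun θ => Bk_zero (by simp [abs_of_pos hr]; linarith)
    simp [this]

/-- an integrable kernel -/
noncomputable def kap (v : ℂ) : ℝ := ‖v‖⁻¹ * (1 + ‖v‖^2)⁻¹

lemma kap_nonneg (v : ℂ) : 0 ≤ kap v := by unfold kap; positivity

lemma kap_integrable : Integrable kap := by
  have := (integrable_fun_norm_addHaar (E := ℂ) volume (f := fun y : ℝ => y⁻¹ * (1 + y^2)⁻¹)).mpr ?_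
  · exact this
  · rw [Complex.finrank_real_complex]
    refine (integrable_inv_one_add_sq.integrableOn (s := Set.Ioi 0)).congr_fun (fun y (hy : 0 < y) => ?_) measurableSet_Ioi
    simp; field_simp

lemma inv_integrableOn_ball (z : ℂ) (R : ℝ) : IntegrableOn (fun ζ : ℂ => (z - ζ)⁻¹) (Metric.ball z R) := by
  have h1 : IntegrableOn (fun ζ => (1 + R^2) * kap (z - ζ)) (Metric.ball z R) :=
    ((kap_integrable.comp_sub_left z).const_mul _).integrableOn
  refine Integrable.mono' h1 (by apply Measurable.aestronglyMeasurable; fun_prop) ?_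
  refine (ae_restrict_iff' measurableSet_ball).mpr (Eventually.of_forall fun ζ hζ => ?_)
  rw [norm_inv, kap]
  rw [Metric.mem_ball, dist_eq_norm, norm_sub_rev] at hζ
  have h2 : 1 + ‖z - ζ‖^2 ≤ 1 + R^2 := by nlinarith [norm_nonneg (z - ζ)]
  have h3 : 1 ≤ (1 + R^2) * (1 + ‖z - ζ‖^2)⁻¹ := by
    rw [← div_eq_mul_inv, one_le_div (by positivity)]; exact h2
  calc ‖z - ζ‖⁻¹ = ‖z - ζ‖⁻¹ * 1 := by ring
    _ ≤ ‖z - ζ‖⁻¹ * ((1 + R^2) * (1 + ‖z - ζ‖^2)⁻¹) := by gcongr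
    _ = _ := by ring

lemma inv_integrableOn (z : ℂ) (R : ℝ) : IntegrableOn (fun ζ : ℂ => (z - ζ)⁻¹) (Metric.ball 0 R) :=
  (inv_integrableOn_ball z (R + ‖z‖)).mono_set (Metric.ball_subset_ball' (by simp))

lemma Bk_cauchy {δ : ℝ} (hδ : 0 < δ) (z : ℂ) :
    ∫ w, Bk δ w * (z - w)⁻¹ = ((Real.pi * (cc δ * max (δ - ‖z‖) 0) : ℝ) : ℂ) := by
  have hItg : Integrable (fun w => Bk δ w * (z - w)⁻¹) := by
    have h1 : (fun w => Bk δ w * (z - w)⁻¹) =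
      (Metric.ball (0:ℂ) δ).indicator (fun w => Bk δ w * (z - w)⁻¹) := by
      ext w
      by_cases h : w ∈ Metric.ball (0:ℂ) δ
      · rw [Set.indicator_of_mem h]
      · rw [Set.indicator_of_notMem h, Bk_zero (by simpa using h), zero_mul]
    rw [h1, integrable_indicator_iff measurableSet_ball]
    exact Integrable.bdd_mul (c := cc δ / 2) (inv_integrableOn z δ) (Bk_meas δ).aestronglyMeasurable
      (Eventually.of_forall fun w => Bk_le hδ w)
  rw [polar_int (h := fun w => Bk δ w * (z - w)⁻¹) ((Bk_meas δ).mul (by fun_prop)) hItg]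
  have key : ∀ r : ℝ, 0 < r → r ≠ ‖z‖ → (r:ℂ) * ∫ θ in Set.Ioo (-Real.pi) Real.pi,
      Bk δ (circleMap 0 r θ) * (z - circleMap 0 r θ)⁻¹ =
      (Set.Ioo ‖z‖ δ).indicator (fun _ => ((Real.pi * cc δ : ℝ) : ℂ)) r := by
    intro r hr hrz
    by_cases hrδ : r < δ
    · have : ∀ θ, Bk δ (circleMap 0 r θ) * (z - circleMap 0 r θ)⁻¹
        = (circleMap 0 r θ / r) * (((cc δ / 2 : ℝ) : ℂ) * (circleMap 0 r θ - z)⁻¹) := by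
        intro θ; rw [Bk_circle hr hrδ, ← neg_sub z, inv_neg]; ring
      simp only [this]
      rw [circle_int hr (fun w => ((cc δ / 2 : ℝ) : ℂ) * (w - z)⁻¹), circleIntegral.integral_const_mul]
      rcases lt_or_gt_of_ne hrz with h | h
      · rw [Set.indicator_of_notMem (by simp; intro h'; linarith)]
        have h0 : ∮ w in C(0, r), (w - z)⁻¹ = 0 := by
          apply DiffContOnCl.circleIntegral_eq_zero hr.le
          apply DifferentiableOn.diffContOnCl_ball (U := Metric.ball 0 ‖z‖)
          · intro w hw
            have : w - z ≠ 0 := by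
              intro h'; rw [sub_eq_zero.mp h'] at hw; simp at hw
            exact ((differentiableAt_id.sub_const z).fun_inv (𝕜 := ℂ) this).differentiableWithinAt
          · exact Metric.closedBall_subset_ball h
        rw [h0]; simp
      · rw [Set.indicator_of_mem (show r ∈ Set.Ioo ‖z‖ δ from ⟨h, hrδ⟩), circleIntegral.integral_sub_inv_of_mem_ball (by simpa using h)]
        have : (r:ℂ) ≠ 0 := by exact_mod_cast hr.ne'
        have := I_ne_zero
        push_cast
        field_simp
    · have : ∀ θ, Bk δ (circleMap 0 r θ) = 0 := fun θ => Bk_zero (by simp [abs_of_pos hr]; linarith)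
      rw [Set.indicator_of_notMem (by simp; intro h'; linarith)]
      simp [this]
  have hae : ∀ᵐ r : ℝ, r ≠ ‖z‖ := by
    rw [ae_iff]; simp
  rw [setIntegral_congr_ae (g := (Set.Ioo ‖z‖ δ).indicator (fun _ => ((Real.pi * cc δ : ℝ) : ℂ))) measurableSet_Ioi
    (by filter_upwards [hae] with r hr hr0 using key r hr0 hr)]
  rw [setIntegral_indicator measurableSet_Ioo, Set.inter_eq_right.mpr
    (show Set.Ioo ‖z‖ δ ⊆ Set.Ioi 0 from fun x hx => lt_of_le_of_lt (norm_nonneg z) hx.1), setIntegral_const]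
  rw [Measure.real, Real.volume_Ioo, ENNReal.toReal_ofReal']
  rw [Complex.real_smul]
  push_cast; ring

end Univ

namespace Univ

noncomputable def Ak (δ : ℝ) (v : ℂ) : ℝ := cc δ * max (δ - ‖v‖) 0

lemma Ak_cont (δ : ℝ) : Continuous (Ak δ) := by unfold Ak; fun_prop

lemma Ak_nonneg {δ : ℝ} (hδ : 0 < δ) (v : ℂ) : 0 ≤ Ak δ v :=
  mul_nonneg (cc_pos hδ).le (le_max_right _ _)

lemma Ak_zero {δ : ℝ} {v : ℂ} (h : δ ≤ ‖v‖) : Ak δ v = 0 := by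
  unfold Ak; rw [max_eq_right (by linarith), mul_zero]

lemma Ak_integrable (δ : ℝ) : Integrable (Ak δ) := by
  refine (Ak_cont δ).integrable_of_hasCompactSupport (HasCompactSupport.intro (isCompact_closedBall 0 δ) fun v hv => ?_)
  exact Ak_zero (by simp at hv; exact hv.le)

lemma Ak_integral {δ : ℝ} (hδ : 0 < δ) : ∫ v, Ak δ v = 1 := by
  have h1 := integral_fun_norm_addHaar (volume : Measure ℂ) (fun y : ℝ => cc δ * max (δ - y) 0)
  unfold Ak
  rw [h1, Complex.finrank_real_complex]
  have h2 : ∫ y in Set.Ioi (0:ℝ), y ^ (2 - 1) • (cc δ * max (δ - y) 0) = cc δ * δ^3 / 6 := by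
    have h3 : ∫ y in Set.Ioi (0:ℝ), y ^ (2 - 1) • (cc δ * max (δ - y) 0)
       = ∫ y in Set.Ioi (0:ℝ), (Set.Ioc 0 δ).indicator (fun y => cc δ * (δ * y - y^2)) y := by
      refine setIntegral_congr_fun measurableSet_Ioi fun y (hy : 0 < y) => ?_
      by_cases h : y ≤ δ
      · rw [Set.indicator_of_mem (show y ∈ Set.Ioc 0 δ from ⟨hy, h⟩), max_eq_left (by linarith)]
        simp; ring
      · rw [Set.indicator_of_notMem (by simp; intro _; linarith), max_eq_right (by linarith)]
        simp
    rw [h3, setIntegral_indicator measurableSet_Ioc, Set.inter_eq_right.mpr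
      (show Set.Ioc 0 δ ⊆ Set.Ioi 0 from fun x hx => hx.1), ← intervalIntegral.integral_of_le hδ.le,
      intervalIntegral.integral_const_mul, intervalIntegral.integral_sub, intervalIntegral.integral_const_mul]
    · simp; ring
    · apply Continuous.intervalIntegrable; fun_prop
    · apply Continuous.intervalIntegrable; fun_prop
  rw [h2]
  have h4 : (volume : Measure ℂ).real (Metric.ball 0 1) = Real.pi := by
    rw [Measure.real, Complex.volume_ball]; simp
  rw [h4]
  unfold cc
  have := Real.pi_pos
  simp
  field_simp
  norm_num

lemma smoothing {F : ℂ → ℂ} (hF : Continuous F) {R₀ : ℝ} (hsupp : ∀ z, R₀ ≤ ‖z‖ → F z = 0)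
    {δ ω : ℝ} (hδ : 0 < δ) (hω : ∀ x y, ‖x - y‖ ≤ δ → ‖F x - F y‖ ≤ ω) :
    ∃ ρ : ℂ → ℂ, Integrable ρ ∧ (∀ ζ, ‖ρ ζ‖ ≤ 3 * ω / (2 * δ)) ∧ (∃ R, ∀ ζ, R ≤ ‖ζ‖ → ρ ζ = 0) ∧
      (∀ ζ, DifferentiableOn ℂ F (Metric.ball ζ δ) → ρ ζ = 0) ∧
      ∀ z, Integrable (fun ζ => ρ ζ * (z - ζ)⁻¹) ∧
        ‖(Real.pi : ℂ)⁻¹ * (∫ ζ, ρ ζ * (z - ζ)⁻¹) - F z‖ ≤ ω := by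
  have hω0 : 0 ≤ ω := le_trans (norm_nonneg _) (hω 0 0 (by simp; exact hδ.le))
  have hcc := cc_pos hδ
  set ρ : ℂ → ℂ := fun ζ => ∫ w, F (ζ - w) * Bk δ w with hρ
  have hFc : ∀ ζ, Continuous (fun w => F (ζ - w)) := fun ζ => hF.comp (by fun_prop)
  have hmeas : StronglyMeasurable ρ := by
    apply StronglyMeasurable.integral_prod_right (f := fun ζ w : ℂ => F (ζ - w) * Bk δ w)
    apply Measurable.stronglyMeasurable
    exact (hF.measurable.comp (by fun_prop)).mul ((Bk_meas δ).comp measurable_snd)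
  have hzero : ∀ ζ, DifferentiableOn ℂ F (Metric.ball ζ δ) → ρ ζ = 0 := by
    intro ζ h
    apply Bk_mean hδ (hFc ζ)
    refine h.comp (by fun_prop) ?_
    intro w hw
    simpa using hw
  have hbd : ∀ ζ, ‖ρ ζ‖ ≤ 3 * ω / (2 * δ) := by
    intro ζ
    have h1 : ∫ w, (fun _ => F ζ) w * Bk δ w = 0 :=
      Bk_mean hδ continuous_const (differentiableOn_const _)
    have h2 : ρ ζ = ∫ w, (F (ζ - w) * Bk δ w - F ζ * Bk δ w) := by
      rw [integral_sub (Bk_mul_integrable hδ (hFc ζ)) (Bk_mul_integrable hδ (F := fun _ => F ζ) continuous_const), h1, sub_zero]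
    have h3 : ρ ζ = ∫ w in Metric.ball (0:ℂ) δ, (F (ζ - w) * Bk δ w - F ζ * Bk δ w) := by
      rw [h2, setIntegral_eq_integral_of_forall_compl_eq_zero]
      intro w hw
      rw [Bk_zero (by simpa using hw)]; simp
    rw [h3]
    refine (norm_setIntegral_le_of_norm_le_const (C := ω * (cc δ / 2)) measure_ball_lt_top ?_).trans ?_
    · intro w hw
      rw [← sub_mul, norm_mul]
      gcongr
      · apply hω; simp at hw ⊢; exact hw.le
      · exact Bk_le hδ w
    · rw [Measure.real, Complex.volume_ball]
      simp [hδ.le]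
      unfold cc
      have := Real.pi_pos
      apply le_of_eq
      field_simp
  have hcs : ∀ ζ, R₀ + δ ≤ ‖ζ‖ → ρ ζ = 0 := by
    intro ζ hζ
    simp only [hρ]
    apply integral_eq_zero_of_ae
    refine Eventually.of_forall fun w => ?_
    simp only [Pi.zero_apply]
    by_cases hw : δ ≤ ‖w‖
    · rw [Bk_zero hw, mul_zero]
    · rw [hsupp (ζ - w), zero_mul]
      have := norm_sub_norm_le ζ w
      linarith
  have hind : ∀ g : ℂ → ℂ, (fun ζ => ρ ζ * g ζ) = (Metric.ball (0:ℂ) (R₀ + δ)).indicator (fun ζ => ρ ζ * g ζ) := by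
    intro g
    ext ζ
    by_cases h : ζ ∈ Metric.ball (0:ℂ) (R₀ + δ)
    · rw [Set.indicator_of_mem h]
    · rw [Set.indicator_of_notMem h, hcs ζ (by simpa using h), zero_mul]
  have hItg : ∀ g : ℂ → ℂ, IntegrableOn g (Metric.ball (0:ℂ) (R₀ + δ)) → Integrable (fun ζ => ρ ζ * g ζ) := by
    intro g hg
    rw [hind, integrable_indicator_iff measurableSet_ball]
    exact Integrable.bdd_mul (c := 3 * ω / (2 * δ)) hg hmeas.aestronglyMeasurable (Eventually.of_forall hbd)
  refine ⟨ρ, ?_, hbd, ⟨R₀ + δ, hcs⟩, hzero, fun z => ⟨hItg _ (inv_integrableOn z _), ?_⟩⟩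
  · have := hItg (fun _ => 1) (integrableOn_const measure_ball_lt_top.ne)
    simpa using this
  have hρ2 : ∀ ζ, ρ ζ = ∫ x, F x * Bk δ (ζ - x) := by
    intro ζ
    rw [← integral_sub_left_eq_self _ _ ζ]
    simp [hρ]
  have e1 : ∫ ζ, ρ ζ * (z - ζ)⁻¹ = ∫ ζ, ∫ x, F x * Bk δ (ζ - x) * (z - ζ)⁻¹ := by
    congr 1; ext ζ
    rw [hρ2, integral_mul_const]
  have hfub : Integrable (Function.uncurry fun ζ x => F x * Bk δ (ζ - x) * (z - ζ)⁻¹) (volume.prod volume) := by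
    have hd : Integrable (fun p : ℂ × ℂ => (Metric.ball (0:ℂ) (R₀ + δ)).indicator (fun ζ => ‖(z - ζ)⁻¹‖) p.1 * (‖F p.2‖ * (cc δ / 2))) (volume.prod volume) := by
      apply Integrable.mul_prod (f := (Metric.ball (0:ℂ) (R₀ + δ)).indicator (fun ζ => ‖(z - ζ)⁻¹‖)) (g := fun x => ‖F x‖ * (cc δ / 2))
      · rw [integrable_indicator_iff measurableSet_ball]
        exact (inv_integrableOn z _).norm
      · apply Integrable.mul_const
        apply Integrable.norm
        refine hF.integrable_of_hasCompactSupport (HasCompactSupport.intro (isCompact_closedBall 0 R₀) fun v hv => ?_)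
        exact hsupp v (by simp at hv; exact hv.le)
    refine Integrable.mono' hd ?_ (Eventually.of_forall ?_)
    · apply Measurable.aestronglyMeasurable
      refine Measurable.mul (Measurable.mul (hF.measurable.comp measurable_snd) ((Bk_meas δ).comp (by fun_prop))) (by fun_prop)
    · rintro ⟨ζ, x⟩
      simp only [Function.uncurry]
      by_cases h1 : R₀ ≤ ‖x‖
      · rw [hsupp x h1]; simp
      by_cases h2 : δ ≤ ‖ζ - x‖
      · rw [Bk_zero h2]
        simp only [mul_zero, zero_mul, norm_zero]
        refine mul_nonneg (Set.indicator_nonneg (fun _ _ => norm_nonneg _) _) (by positivity)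
      · rw [Set.indicator_of_mem]
        · rw [norm_mul, norm_mul, mul_comm]
          gcongr
          exact Bk_le hδ _
        · simp
          have := norm_sub_norm_le ζ x
          linarith
  have e2 : ∫ ζ, ρ ζ * (z - ζ)⁻¹ = ∫ x, F x * ((Real.pi * Ak δ (z - x) : ℝ) : ℂ) := by
    rw [e1, integral_integral_swap hfub]
    congr 1; ext x
    simp only [mul_assoc]
    rw [integral_const_mul]
    congr 1
    rw [← integral_add_right_eq_self _ x]
    have := Bk_cauchy hδ (z - x)
    simp only [add_sub_cancel_right]
    rw [show (fun a => Bk δ a * (z - (a + x))⁻¹) = fun w => Bk δ w * (z - x - w)⁻¹ by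
      ext a; congr 2; ring]
    rw [this]
    rfl
  have e3 : (Real.pi : ℂ)⁻¹ * ∫ ζ, ρ ζ * (z - ζ)⁻¹ = ∫ v, F (z - v) * (Ak δ v : ℂ) := by
    rw [e2, ← integral_const_mul, ← integral_sub_left_eq_self _ _ z]
    congr 1; ext v
    have : (Real.pi : ℂ) ≠ 0 := by exact_mod_cast Real.pi_ne_zero
    simp only [sub_sub_cancel]
    push_cast
    field_simp
  have e4 : F z = ∫ v, F z * (Ak δ v : ℂ) := by
    rw [integral_const_mul, integral_complex_ofReal, Ak_integral hδ]; simp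
  have hAi : Integrable (fun v => (Ak δ v : ℂ)) := (Ak_integrable δ).ofReal
  have hFAi : Integrable (fun v => F (z - v) * (Ak δ v : ℂ)) := by
    refine Continuous.integrable_of_hasCompactSupport ((hFc z).mul (continuous_ofReal.comp (Ak_cont δ)))
      (HasCompactSupport.intro (isCompact_closedBall 0 δ) fun v hv => ?_)
    rw [Ak_zero (by simp at hv; exact hv.le)]; simp
  rw [e3, e4, ← integral_sub hFAi (hAi.const_mul _)]
  refine (norm_integral_le_of_norm_le ((Ak_integrable δ).const_mul ω) (Eventually.of_forall fun v => ?_)).trans ?_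
  · rw [← sub_mul, norm_mul, Complex.norm_real, Real.norm_of_nonneg (Ak_nonneg hδ v)]
    by_cases hv : δ ≤ ‖v‖
    · rw [Ak_zero hv]; simp
    · gcongr
      · exact Ak_nonneg hδ v
      · apply hω; simp; linarith
  · rw [integral_const_mul, Ak_integral hδ, mul_one]

end Univ

namespace Univ

lemma kernel_err {K : Set ℂ} {p c ζ z : ℂ} {g : ℂ → ℂ} {δ : ℝ} (hδ : 0 < δ)
    (hp : ‖p - c‖ ≤ δ) (hg1 : ∀ z ∈ K, ‖g z‖ ≤ 232 / δ)
    (hg2 : ∀ z ∈ K, 8 * δ ≤ ‖z - c‖ → ‖g z‖ ≤ 2 / ‖z - p‖ ∧ ‖g z - (z - p)⁻¹‖ ≤ δ^2 / ‖z - p‖^3)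
    (hζ : ‖ζ - c‖ ≤ 3 * δ) (hz : z ∈ K) (hne : z ≠ ζ) :
    ‖g z + (ζ - p) * g z ^ 2 - (z - ζ)⁻¹‖ ≤ 4 * 10^8 / δ * kap (δ⁻¹ • (z - ζ)) := by
  have hζp : ‖ζ - p‖ ≤ 4 * δ := by
    calc ‖ζ - p‖ = ‖(ζ - c) - (p - c)‖ := by ring_nf
      _ ≤ _ := norm_sub_le _ _
      _ ≤ _ := by linarith
  set D := ‖z - ζ‖ with hD
  have hD0 : 0 < D := norm_pos_iff.mpr (sub_ne_zero.mpr hne)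
  have hk : kap (δ⁻¹ • (z - ζ)) = δ^3 / (D * (δ^2 + D^2)) := by
    unfold kap
    rw [norm_smul, Real.norm_of_nonneg (by positivity), ← hD]
    field_simp
  rw [hk]
  by_cases hnear : D ≤ 12 * δ
  · have h1 := hg1 z hz
    have h2 : ‖g z + (ζ - p) * g z ^ 2 - (z - ζ)⁻¹‖ ≤ 232 / δ + 4 * δ * (232/δ)^2 + D⁻¹ := by
      refine (norm_sub_le _ _).trans ?_
      rw [norm_inv, ← hD]
      gcongr
      refine (norm_add_le _ _).trans ?_
      rw [norm_mul, norm_pow]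
      gcongr
    refine h2.trans ?_
    have e : 232 / δ + 4 * δ * (232/δ)^2 + D⁻¹ = (215528 * D + δ) / (δ * D) := by field_simp; ring
    have e' : 4 * 10^8 / δ * (δ^3 / (D * (δ^2 + D^2))) = (4 * 10^8 * δ^3/ (δ^2 + D^2)) / (δ * D) := by field_simp
    rw [e, e']
    gcongr
    rw [le_div_iff₀ (by positivity)]
    have h5 : D^2 ≤ 144 * δ^2 := by nlinarith
    calc (215528 * D + δ) * (δ^2 + D^2) ≤ (215528 * (12 * δ) + δ) * (δ^2 + 144 * δ^2) := by gcongr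
      _ ≤ 4 * 10^8 * δ^3 := by
        have : 0 < δ^3 := by positivity
        nlinarith
  · push Not at hnear
    have hzc : 8 * δ ≤ ‖z - c‖ := by
      have : ‖z - ζ‖ ≤ ‖z - c‖ + ‖ζ - c‖ := by
        calc ‖z - ζ‖ = ‖(z - c) - (ζ - c)‖ := by ring_nf
          _ ≤ _ := norm_sub_le _ _
      linarith
    obtain ⟨ha, hb⟩ := hg2 z hz hzc
    set E := ‖z - p‖ with hE
    have hED : D / 2 ≤ E := by
      have : ‖z - ζ‖ ≤ ‖z - p‖ + ‖ζ - p‖ := by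
        calc ‖z - ζ‖ = ‖(z - p) - (ζ - p)‖ := by ring_nf
          _ ≤ _ := norm_sub_le _ _
      linarith
    have hE0 : 0 < E := by linarith
    have hzp : z - p ≠ 0 := norm_pos_iff.mp hE0
    have hzζ : z - ζ ≠ 0 := sub_ne_zero.mpr hne
    have eq : g z + (ζ - p) * g z ^ 2 - (z - ζ)⁻¹ = (g z - (z - p)⁻¹)
        + (ζ - p) * ((g z - (z - p)⁻¹) * (g z + (z - p)⁻¹)) - (ζ - p)^2 * ((z - p)⁻¹)^2 * (z - ζ)⁻¹ := by
      have : (z - ζ)⁻¹ = (z - p)⁻¹ + (ζ - p) * ((z - p)⁻¹)^2 + (ζ - p)^2 * ((z - p)⁻¹)^2 * (z - ζ)⁻¹ := by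
        field_simp; ring
      linear_combination -this
    have hsum : ‖g z + (z - p)⁻¹‖ ≤ 3 / E := by
      refine (norm_add_le _ _).trans ?_
      rw [norm_inv, ← hE]
      calc _ ≤ 2 / E + E⁻¹ := by gcongr
        _ = 3 / E := by field_simp; norm_num
    rw [eq]
    have h2 : ‖(g z - (z - p)⁻¹)
        + (ζ - p) * ((g z - (z - p)⁻¹) * (g z + (z - p)⁻¹)) - (ζ - p)^2 * ((z - p)⁻¹)^2 * (z - ζ)⁻¹‖ ≤
        δ^2 / E^3 + (4 * δ) * (δ^2 / E^3 * (3 / E)) + (4 * δ)^2 * (E⁻¹)^2 * D⁻¹ := by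
      refine (norm_sub_le _ _).trans ?_
      simp only [norm_mul, norm_pow, norm_inv, ← hD, ← hE]
      gcongr
      refine (norm_add_le _ _).trans ?_
      simp only [norm_mul]
      gcongr
    refine h2.trans ?_
    have h3 : E⁻¹ ≤ 2 / D := by
      rw [inv_le_comm₀ hE0 (by positivity)]; simpa using hED
    have h4 : δ ≤ D / 12 := by linarith
    have e3 : δ^2 / E^3 + (4 * δ) * (δ^2 / E^3 * (3 / E)) + (4 * δ)^2 * (E⁻¹)^2 * D⁻¹
       = δ^2 * ((E⁻¹)^3 + 12 * δ * (E⁻¹)^4 + 16 * (E⁻¹)^2 * D⁻¹) := by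
      field_simp; ring
    rw [e3]
    have h5 : (E⁻¹)^3 + 12 * δ * (E⁻¹)^4 + 16 * (E⁻¹)^2 * D⁻¹ ≤ (2/D)^3 + D * (2/D)^4 + 16 * (2/D)^2 * D⁻¹ := by
      gcongr
    have h6 : (2/D)^3 + D * (2/D)^4 + 16 * (2/D)^2 * D⁻¹ = 88 / D^3 := by field_simp; norm_num
    calc _ ≤ δ^2 * (88 / D^3) := by rw [← h6]; gcongr
      _ = 88 * δ^2 / D^3 := by ring
      _ ≤ 4 * 10^8 * δ^2 / (D * (2 * D^2)) := by
        rw [div_le_div_iff₀ (by positivity) (by positivity)]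
        have : 0 < δ^2 * D^3 := by positivity
        nlinarith
      _ ≤ 4 * 10^8 * δ^2 / (D * (δ^2 + D^2)) := by
        gcongr
        nlinarith
      _ = _ := by field_simp

lemma exists_ext {K : Set ℂ} (hK : IsCompact K) {f : ℂ → ℂ} (hf : ContinuousOn f K) :
    ∃ (F : ℂ → ℂ) (R : ℝ), Continuous F ∧ (∀ z ∈ K, F z = f z) ∧ ∀ z, R ≤ ‖z‖ → F z = 0 := by
  obtain ⟨g, hg⟩ := ContinuousMap.exists_restrict_eq hK.isClosed
    (⟨fun z => f z, continuousOn_iff_continuous_domRestrict.mp hf⟩ : C(K, ℂ))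
  obtain ⟨R, hR⟩ := hK.isBounded.subset_closedBall 0
  refine ⟨fun z => g z * ((max 0 (min 1 (R + 1 - ‖z‖)) : ℝ) : ℂ), R + 1, by fun_prop, ?_, ?_⟩
  · intro z hz
    have h1 : g z = f z := by
      have := congrArg (fun h => h ⟨z, hz⟩) hg
      exact this
    have h2 := hR hz
    simp at h2
    show g z * ((max 0 (min 1 (R + 1 - ‖z‖)) : ℝ) : ℂ) = f z
    rw [h1, min_eq_left (by linarith), max_eq_right (by norm_num)]; simp
  · intro z hz
    simp only
    rw [max_eq_left (min_le_of_right_le (by linarith))]; simp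

lemma exists_modulus {F : ℂ → ℂ} (hF : Continuous F) {R : ℝ} (h0 : ∀ z, R ≤ ‖z‖ → F z = 0)
    {ω : ℝ} (hω : 0 < ω) : ∃ δ > 0, ∀ x y, ‖x - y‖ ≤ δ → ‖F x - F y‖ ≤ ω := by
  have hcs : HasCompactSupport F := HasCompactSupport.intro (isCompact_closedBall 0 R) fun v hv =>
    h0 v (by simp at hv; exact hv.le)
  have := hcs.uniformContinuous_of_continuous hF
  rw [Metric.uniformContinuous_iff] at this
  obtain ⟨δ, hδ, h⟩ := this ω hω
  refine ⟨δ / 2, by positivity, fun x y hxy => ?_⟩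
  have := h (a := x) (b := y) (by rw [dist_eq_norm]; linarith)
  rw [dist_eq_norm] at this
  exact this.le

lemma kap_scale {δ : ℝ} (hδ : 0 < δ) (z : ℂ) :
    Integrable (fun ζ => kap (δ⁻¹ • (z - ζ))) ∧ ∫ ζ, kap (δ⁻¹ • (z - ζ)) = δ^2 * ∫ ζ, kap ζ := by
  constructor
  · exact (kap_integrable.comp_smul (by positivity : δ⁻¹ ≠ 0)).comp_sub_left z
  · rw [integral_sub_left_eq_self (fun ζ => kap (δ⁻¹ • ζ)), Measure.integral_comp_inv_smul_of_nonneg _ _ hδ.le,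
      Complex.finrank_real_complex]; rfl

theorem mergelyan {K : Set ℂ} [CompactSpace K] (hK : IsCompact K) (hKc : IsConnected Kᶜ) {f : ℂ → ℂ}
    (hf : ContinuousOn f K) (hf' : DifferentiableOn ℂ f (interior K)) : Appr K f := by
  classical
  apply Appr.of_limit hf
  obtain ⟨F, R₀, hFc, hFf, hF0⟩ := exists_ext hK hf
  set I₀ := ∫ ζ, kap ζ with hI₀
  have hI₀n : 0 ≤ I₀ := integral_nonneg kap_nonneg
  intro ε hε
  set C : ℝ := Real.pi⁻¹ * (3/2 * (4 * 10^8) * I₀) + 1 with hC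
  have hCpos : 0 < C := by have := Real.pi_pos; positivity
  set ω := ε / C with hω
  have hωpos : 0 < ω := by positivity
  obtain ⟨δ, hδ, hmod⟩ := exists_modulus hFc hF0 hωpos
  obtain ⟨ρ, hρi, hρb, ⟨R, hρR⟩, hρz, hρint⟩ := smoothing hFc hF0 hδ hmod
  -- finite cover
  obtain ⟨t, -, htf, htc⟩ := (isCompact_closedBall (0:ℂ) R).elim_finite_subcover_image (b := Set.univ)
    (c := fun x : ℂ => Metric.ball x δ) (fun _ _ => Metric.isOpen_ball)
    (fun x _ => Set.mem_biUnion (Set.mem_univ x) (Metric.mem_ball_self hδ))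
  lift t to Finset ℂ using htf
  -- kernels
  have hker : ∀ x : ℂ, ∃ (p : ℂ) (g : ℂ → ℂ), Appr K g ∧ ((∃ c, c ∉ K ∧ ‖x - c‖ ≤ 2 * δ) →
      ∀ z ∈ K, ∀ ζ ∈ Metric.ball x δ, z ≠ ζ →
        ‖g z + (ζ - p) * g z ^ 2 - (z - ζ)⁻¹‖ ≤ 4 * 10^8 / δ * kap (δ⁻¹ • (z - ζ))) := by
    intro x
    by_cases hx : ∃ c, c ∉ K ∧ ‖x - c‖ ≤ 2 * δ
    · obtain ⟨c, hc, hxc⟩ := hx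
      obtain ⟨p, g, h1, h2, h3, h4⟩ := exists_kernel hK hKc hc hδ
      refine ⟨p, g, h2, fun _ z hz ζ hζ hne => kernel_err hδ h1 h3 h4 ?_ hz hne⟩
      rw [Metric.mem_ball, dist_eq_norm] at hζ
      calc ‖ζ - c‖ = ‖(ζ - x) + (x - c)‖ := by ring_nf
        _ ≤ _ := norm_add_le _ _
        _ ≤ 3 * δ := by linarith
    · exact ⟨0, fun _ => 0, Appr.const K 0, fun h => absurd h hx⟩
  choose p g hgA hgerr using hker
  have hρx : ∀ x : ℂ, (¬ ∃ c, c ∉ K ∧ ‖x - c‖ ≤ 2 * δ) → ∀ ζ ∈ Metric.ball x δ, ρ ζ = 0 := by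
    intro x hx ζ hζ
    apply hρz
    push Not at hx
    have hsub : Metric.ball ζ δ ⊆ K := by
      intro y hy
      by_contra hyK
      have := hx y hyK
      rw [Metric.mem_ball, dist_eq_norm] at hζ hy
      have : ‖x - y‖ ≤ ‖ζ - x‖ + ‖y - ζ‖ := by
        calc ‖x - y‖ = ‖-((ζ - x) + (y - ζ))‖ := by ring_nf
          _ ≤ _ := by rw [norm_neg]; exact norm_add_le _ _
      linarith
    have hsub' : Metric.ball ζ δ ⊆ interior K := interior_maximal hsub Metric.isOpen_ball
    exact (hf'.mono hsub').congr fun y hy => hFf y (hsub hy)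
  -- partition of unity
  set ind : ℂ → ℂ → ℝ := fun x => (Metric.ball x δ).indicator (fun _ => (1:ℝ)) with hind
  set N : ℂ → ℝ := fun ζ => ∑ x ∈ t, ind x ζ with hN
  set χ : ℂ → ℂ → ℝ := fun x ζ => ind x ζ / N ζ with hχ
  have hind0 : ∀ x ζ, 0 ≤ ind x ζ := fun x ζ => Set.indicator_nonneg (fun _ _ => zero_le_one) _
  have hindm : ∀ x, Measurable (ind x) := fun x => measurable_const.indicator measurableSet_ball
  have hN0 : ∀ ζ, 0 ≤ N ζ := fun ζ => Finset.sum_nonneg fun x _ => hind0 x ζ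
  have hNm : Measurable N := Finset.measurable_sum _ fun x _ => hindm x
  have hχ0 : ∀ x ζ, 0 ≤ χ x ζ := fun x ζ => div_nonneg (hind0 x ζ) (hN0 ζ)
  have hχm : ∀ x, Measurable (χ x) := fun x => (hindm x).div hNm
  have hχ1 : ∀ x ∈ t, ∀ ζ, χ x ζ ≤ 1 := fun x hx ζ =>
    div_le_one_of_le₀ (Finset.single_le_sum (f := fun x => ind x ζ) (fun y _ => hind0 y ζ) hx) (hN0 ζ)
  have hχz : ∀ x ζ, ζ ∉ Metric.ball x δ → χ x ζ = 0 := by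
    intro x ζ h
    simp only [hχ, hind]
    rw [Set.indicator_of_notMem h, zero_div]
  have hχsum : ∀ ζ, ‖ζ‖ ≤ R → ∑ x ∈ t, χ x ζ = 1 := by
    intro ζ hζ
    simp only [hχ]
    rw [← Finset.sum_div]
    have : 0 < N ζ := by
      have h1 := htc (show ζ ∈ Metric.closedBall 0 R by simpa using hζ)
      simp only [Set.mem_iUnion] at h1
      obtain ⟨x, hx, hxζ⟩ := h1
      refine Finset.sum_pos' (fun y _ => hind0 y ζ) ⟨x, hx, ?_⟩
      simp only [hind]
      rw [Set.indicator_of_mem hxζ]; norm_num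
    exact div_self this.ne'
  have hI1 : ∀ x ∈ t, Integrable (fun ζ => ρ ζ * (χ x ζ : ℂ)) := by
    intro x hx
    refine hρi.mul_bdd (c := 1) ?_ (Eventually.of_forall fun ζ => ?_)
    · exact (Complex.measurable_ofReal.comp (hχm x)).aestronglyMeasurable
    · rw [Complex.norm_real, Real.norm_of_nonneg (hχ0 x ζ)]; exact hχ1 x hx ζ
  have hI2 : ∀ x ∈ t, Integrable (fun ζ => ρ ζ * (χ x ζ : ℂ) * (ζ - p x)) := by
    intro x hx
    refine Integrable.mono' ((hI1 x hx).norm.mul_const (|R| + ‖p x‖))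
      ((hI1 x hx).1.mul (by apply Continuous.aestronglyMeasurable; fun_prop)) (Eventually.of_forall fun ζ => ?_)
    by_cases h : R ≤ ‖ζ‖
    · rw [hρR ζ h]; simp
    · rw [norm_mul]
      gcongr
      refine (norm_sub_le _ _).trans ?_
      have := le_abs_self R
      linarith
  set α : ℂ → ℂ := fun x => ∫ ζ, ρ ζ * (χ x ζ : ℂ)
  set β : ℂ → ℂ := fun x => ∫ ζ, ρ ζ * (χ x ζ : ℂ) * (ζ - p x)
  refine ⟨fun z => ((Real.pi : ℂ)⁻¹) * ∑ x ∈ t, (α x * g x z + β x * (g x z * g x z)), ?_, ?_⟩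
  · exact (Appr.const K _).mul (Appr.sum t fun x _ => ((Appr.const K _).mul (hgA x)).add
      ((Appr.const K _).mul ((hgA x).mul (hgA x))))
  intro z hz
  have e1 : ∑ x ∈ t, (α x * g x z + β x * (g x z * g x z)) =
      ∫ ζ, ∑ x ∈ t, (ρ ζ * (χ x ζ : ℂ) * g x z + ρ ζ * (χ x ζ : ℂ) * (ζ - p x) * (g x z * g x z)) := by
    rw [integral_finsetSum]
    · refine Finset.sum_congr rfl fun x hx => ?_
      rw [integral_add ((hI1 x hx).mul_const _) ((hI2 x hx).mul_const _), integral_mul_const, integral_mul_const]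
    · intro x hx
      exact ((hI1 x hx).mul_const _).add ((hI2 x hx).mul_const _)
  have hI3 : Integrable (fun ζ => ∑ x ∈ t, (ρ ζ * (χ x ζ : ℂ) * g x z + ρ ζ * (χ x ζ : ℂ) * (ζ - p x) * (g x z * g x z))) :=
    integrable_finsetSum _ fun x hx => ((hI1 x hx).mul_const _).add ((hI2 x hx).mul_const _)
  obtain ⟨hzi, hzb⟩ := hρint z
  obtain ⟨hks, hkv⟩ := kap_scale hδ z
  have hmain : ‖∑ x ∈ t, (α x * g x z + β x * (g x z * g x z)) - ∫ ζ, ρ ζ * (z - ζ)⁻¹‖ ≤ 3/2 * (4 * 10^8) * I₀ * ω := by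
    rw [e1, ← integral_sub hI3 hzi]
    have hae : ∀ᵐ ζ : ℂ, z ≠ ζ := by
      rw [ae_iff]; simp
    refine (norm_integral_le_of_norm_le (hks.const_mul ((3 * ω / (2 * δ)) * (4 * 10^8 / δ))) ?_).trans ?_
    · filter_upwards [hae] with ζ hne
      by_cases hR : R ≤ ‖ζ‖
      · simp only [hρR ζ hR]
        simp
        have := kap_nonneg (((δ:ℂ)⁻¹ * (z - ζ)))
        positivity
      · have e2 : ∑ x ∈ t, (ρ ζ * (χ x ζ : ℂ) * g x z + ρ ζ * (χ x ζ : ℂ) * (ζ - p x) * (g x z * g x z)) - ρ ζ * (z - ζ)⁻¹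
            = ∑ x ∈ t, ρ ζ * ((χ x ζ : ℂ) * (g x z + (ζ - p x) * g x z ^ 2 - (z - ζ)⁻¹)) := by
          have : ρ ζ * (z - ζ)⁻¹ = ∑ x ∈ t, ρ ζ * ((χ x ζ : ℂ) * (z - ζ)⁻¹) := by
            rw [← Finset.mul_sum, ← Finset.sum_mul, ← Complex.ofReal_sum, hχsum ζ (by linarith)]; simp
          rw [this, ← Finset.sum_sub_distrib]
          refine Finset.sum_congr rfl fun x _ => ?_
          ring
        rw [e2]
        refine (norm_sum_le _ _).trans ?_
        have h7 : ∀ x ∈ t, ‖ρ ζ * ((χ x ζ : ℂ) * (g x z + (ζ - p x) * g x z ^ 2 - (z - ζ)⁻¹))‖ ≤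
            (3 * ω / (2 * δ)) * (χ x ζ * (4 * 10^8 / δ * kap (δ⁻¹ • (z - ζ)))) := by
          intro x hx
          have hkn := kap_nonneg (δ⁻¹ • (z - ζ))
          have hrhs : 0 ≤ (3 * ω / (2 * δ)) * (χ x ζ * (4 * 10^8 / δ * kap (δ⁻¹ • (z - ζ)))) := by
            have := hχ0 x ζ; positivity
          by_cases hζx : ζ ∈ Metric.ball x δ
          · by_cases hex : ∃ c, c ∉ K ∧ ‖x - c‖ ≤ 2 * δ
            · rw [norm_mul, norm_mul, Complex.norm_real, Real.norm_of_nonneg (hχ0 x ζ)]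
              have := hχ0 x ζ
              gcongr
              · exact hρb ζ
              · exact hgerr x hex z hz ζ hζx hne
            · rw [hρx x hex ζ hζx, zero_mul, norm_zero]; exact hrhs
          · rw [hχz x ζ hζx]; simp
        refine (Finset.sum_le_sum h7).trans ?_
        rw [← Finset.mul_sum, ← Finset.sum_mul, hχsum ζ (by linarith)]
        apply le_of_eq; ring
    · rw [integral_const_mul, hkv, ← hI₀]
      apply le_of_eq
      field_simp
  have hπ := Real.pi_pos
  have e5 : (Real.pi : ℂ)⁻¹ * ∑ x ∈ t, (α x * g x z + β x * (g x z * g x z)) - f z =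
      (Real.pi : ℂ)⁻¹ * (∑ x ∈ t, (α x * g x z + β x * (g x z * g x z)) - ∫ ζ, ρ ζ * (z - ζ)⁻¹)
      + ((Real.pi : ℂ)⁻¹ * (∫ ζ, ρ ζ * (z - ζ)⁻¹) - F z) := by
    rw [hFf z hz]; ring
  simp only
  rw [e5]
  refine (norm_add_le _ _).trans ?_
  rw [norm_mul, norm_inv, Complex.norm_real, Real.norm_of_nonneg hπ.le]
  calc _ ≤ Real.pi⁻¹ * (3/2 * (4 * 10^8) * I₀ * ω) + ω := by gcongr
    _ = C * ω := by rw [hC]; ring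
    _ = ε := by rw [hω]; field_simp

end Univ

namespace Univ

lemma cm_holo {X : Type*} [TopologicalSpace X] [CompactSpace X] {U : Set ℂ} (hU : IsOpen U)
    {Φ : ℂ → C(X, ℂ)} (hc : ContinuousOn Φ U) (hd : ∀ x, DifferentiableOn ℂ (fun w => Φ w x) U) :
    DifferentiableOn ℂ Φ U := by
  intro w hw
  obtain ⟨r, hr, hrU⟩ := Metric.nhds_basis_closedBall.mem_iff.mp (hU.mem_nhds hw)
  lift r to NNReal using hr.le
  have hci : CircleIntegrable Φ w r := ContinuousOn.circleIntegrable r.2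
    (hc.mono (Metric.sphere_subset_closedBall.trans hrU))
  have h1 := hasFPowerSeriesOn_cauchy_integral hci (by exact_mod_cast hr)
  have h2 : AnalyticAt ℂ (fun v => (2 * Real.pi * I : ℂ)⁻¹ • ∮ z in C(w, r), (z - v)⁻¹ • Φ z) w :=
    h1.analyticAt
  refine (h2.differentiableAt.congr_of_eventuallyEq ?_).differentiableWithinAt
  filter_upwards [Metric.ball_mem_nhds w hr] with v hv
  ext x
  have hev : (ContinuousMap.evalCLM ℂ x : C(X,ℂ) →L[ℂ] ℂ) (∮ z in C(w, r), (z - v)⁻¹ • Φ z)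
      = ∮ z in C(w, r), (z - v)⁻¹ • Φ z x := by
    simp only [circleIntegral]
    rw [← ContinuousLinearMap.intervalIntegral_comp_comm]
    · simp
    · have : CircleIntegrable (fun z => (z - v)⁻¹ • Φ z) w r := by
        apply ContinuousOn.circleIntegrable r.2
        refine ContinuousOn.smul (ContinuousOn.inv₀ (f := fun z => z - v) (by fun_prop) ?_) (hc.mono (Metric.sphere_subset_closedBall.trans hrU))
        intro z hz h0
        rw [sub_eq_zero] at h0
        rw [h0] at hz
        rw [Metric.mem_sphere] at hz
        rw [Metric.mem_ball] at hv
        exact absurd hz hv.ne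
      exact this.out
  simp only [ContinuousMap.evalCLM_apply] at hev
  rw [ContinuousMap.smul_apply, hev]
  have := DiffContOnCl.two_pi_i_inv_smul_circleIntegral_sub_inv_smul (f := fun w => Φ w x) (R := r) (c := w) (w := v)
    ((hd x).diffContOnCl_ball hrU) hv
  exact this.symm

open Classical in
noncomputable def Lf {K : Set ℂ} [CompactSpace K] (L : C(K, ℂ) →L[ℂ] ℂ) (h : ℂ → ℂ) : ℂ :=
  if hc : ContinuousOn h K then L ⟨fun z => h z, continuousOn_iff_continuous_domRestrict.mp hc⟩ else 0

section
variable {K : Set ℂ} [CompactSpace K] (L : C(K, ℂ) →L[ℂ] ℂ)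

lemma Lf_eq {h : ℂ → ℂ} (H : C(K, ℂ)) (hH : ∀ z : K, H z = h z) : Lf L h = L H := by
  have hc : ContinuousOn h K := by
    rw [continuousOn_iff_continuous_domRestrict]
    convert H.continuous using 1
    ext z; exact (hH z).symm
  unfold Lf
  rw [dif_pos hc]
  congr 1; ext z; exact (hH z).symm

lemma exists_cm {h : ℂ → ℂ} (hc : ContinuousOn h K) : ∃ H : C(K, ℂ), ∀ z : K, H z = h z :=
  ⟨⟨fun z => h z, continuousOn_iff_continuous_domRestrict.mp hc⟩, fun _ => rfl⟩

lemma Lf_congr {h g : ℂ → ℂ} (hc : ContinuousOn h K) (e : ∀ z ∈ K, h z = g z) : Lf L h = Lf L g := by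
  obtain ⟨H, hH⟩ := exists_cm hc
  rw [Lf_eq L H hH, Lf_eq L H fun z => by rw [hH, e z z.2]]

lemma Lf_add {h g : ℂ → ℂ} (hc : ContinuousOn h K) (gc : ContinuousOn g K) :
    Lf L (fun z => h z + g z) = Lf L h + Lf L g := by
  obtain ⟨H, hH⟩ := exists_cm hc
  obtain ⟨G, hG⟩ := exists_cm gc
  rw [Lf_eq L H hH, Lf_eq L G hG, Lf_eq L (H + G) (fun z => by simp [hH, hG]), map_add]

lemma Lf_const_mul {h : ℂ → ℂ} (hc : ContinuousOn h K) (c : ℂ) :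
    Lf L (fun z => c * h z) = c * Lf L h := by
  obtain ⟨H, hH⟩ := exists_cm hc
  rw [Lf_eq L H hH, Lf_eq L (c • H) (fun z => by simp [hH]), map_smul, smul_eq_mul]

lemma Lf_norm_le {h : ℂ → ℂ} (hc : ContinuousOn h K) {M : ℝ} (hM0 : 0 ≤ M) (hM : ∀ z ∈ K, ‖h z‖ ≤ M) :
    ‖Lf L h‖ ≤ ‖L‖ * M := by
  obtain ⟨H, hH⟩ := exists_cm hc
  rw [Lf_eq L H hH]
  refine (L.le_opNorm H).trans ?_
  gcongr
  rw [ContinuousMap.norm_le _ hM0]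
  intro z; rw [hH]; exact hM z z.2

lemma Lf_sum {ι : Type*} (s : Finset ι) {h : ι → ℂ → ℂ} (hc : ∀ i ∈ s, ContinuousOn (h i) K) :
    Lf L (fun z => ∑ i ∈ s, h i z) = ∑ i ∈ s, Lf L (h i) := by
  classical
  induction s using Finset.induction_on with
  | empty => simp; rw [Lf_eq L 0 (fun z => by simp)]; simp
  | insert a t ha ih =>
    simp only [Finset.sum_insert ha]
    rw [Lf_add, ih fun i hi => hc i (Finset.mem_insert_of_mem hi)]
    · exact hc a (Finset.mem_insert_self _ _)
    · exact continuousOn_finsetSum _ fun i hi => hc i (Finset.mem_insert_of_mem hi)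

lemma Lf_hasSum {ι : Type*} {h : ι → ℂ → ℂ} (hc : ∀ i, ContinuousOn (h i) K) {u : ι → ℝ} (hu : Summable u)
    (hb : ∀ i, ∀ z ∈ K, ‖h i z‖ ≤ u i) :
    HasSum (fun i => Lf L (h i)) (Lf L (fun z => ∑' i, h i z)) := by
  choose H hH using fun i => exists_cm (hc i)
  have hs : Summable H := by
    by_cases hne : Nonempty K
    · refine Summable.of_norm_bounded hu fun i => ?_
      rw [ContinuousMap.norm_le _ ?_]
      · intro z; rw [hH]; exact hb i z z.2
      · obtain ⟨z⟩ := hne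
        exact (norm_nonneg _).trans (hb i z z.2)
    · have : ∀ i, H i = 0 := fun i => by ext z; exact absurd ⟨z⟩ hne
      rw [show H = fun _ => 0 from funext this]; exact summable_zero
  have h1 := L.hasSum hs.hasSum
  simp only [fun i => Lf_eq L (H i) (hH i)]
  rw [Lf_eq L (∑' i, H i)]
  · exact h1
  · intro z
    rw [← ContinuousMap.tsum_apply hs]
    simp only [hH]

lemma Lf_holo {U : Set ℂ} (hU : IsOpen U) {G : ℂ → ℂ → ℂ}
    (hc : ContinuousOn (Function.uncurry G) (U ×ˢ K)) (hd : ∀ s ∈ K, DifferentiableOn ℂ (fun w => G w s) U) :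
    DifferentiableOn ℂ (fun w => Lf L (G w)) U := by
  classical
  have hGc : ∀ w ∈ U, ContinuousOn (G w) K := by
    intro w hw
    exact hc.comp (f := fun s => (w, s)) (by fun_prop) (fun s hs => ⟨hw, hs⟩)
  let Φ : ℂ → C(K, ℂ) := fun w => if hw : w ∈ U then
    ⟨fun z => G w z, continuousOn_iff_continuous_domRestrict.mp (hGc w hw)⟩ else 0
  have hΦ : ∀ w ∈ U, ∀ z : K, Φ w z = G w z := by
    intro w hw z; simp only [Φ, dif_pos hw]; rfl
  have hΦc : ContinuousOn Φ U := by
    rw [continuousOn_iff_continuous_domRestrict]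
    have : Continuous (fun p : U × K => G p.1 p.2) := by
      have := continuousOn_iff_continuous_domRestrict.mp hc
      exact this.comp (f := fun p : U × K => (⟨(p.1, p.2), p.1.2, p.2.2⟩ : (U ×ˢ K : Set (ℂ × ℂ)))) (by fun_prop)
    have h2 := (ContinuousMap.curry ⟨_, this⟩).continuous
    convert h2 using 1
    ext w z
    exact hΦ w w.2 z
  have := cm_holo hU hΦc fun z => (hd z z.2).congr fun w hw => hΦ w hw z
  have h3 := L.differentiable.comp_differentiableOn this
  refine h3.congr fun w hw => ?_
  exact Lf_eq L (Φ w) (hΦ w hw)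

lemma Lf_appr_zero (hpoly : ∀ n : ℕ, Lf L (fun z => z ^ n) = 0) {f : ℂ → ℂ} (hf : Appr K f) : Lf L f = 0 := by
  obtain ⟨g, hg, hg'⟩ := hf
  rw [Lf_eq L g hg']
  have hp : ∀ p : Polynomial ℂ, Lf L (fun z => p.eval z) = 0 := by
    intro p
    simp only [Polynomial.eval_eq_sum_range]
    rw [Lf_sum]
    · refine Finset.sum_eq_zero fun i _ => ?_
      rw [Lf_const_mul L (by fun_prop), hpoly, mul_zero]
    · intro i _; fun_prop
  have hcl : IsClosed {g : C(K, ℂ) | L g = 0} := isClosed_eq L.continuous continuous_const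
  have : closure ((polynomialFunctions K : Subalgebra ℂ C(K, ℂ)) : Set C(K, ℂ)) ⊆ {g : C(K, ℂ) | L g = 0} := by
    apply hcl.closure_subset_iff.mpr
    rintro h ⟨p, -, rfl⟩
    have := hp p
    rw [Lf_eq L (p.toContinuousMapOn K) (fun z => by simp)] at this
    exact this
  exact this hg
end

/-- vanishing of the Cauchy transform near infinity kills monomials -/
lemma Lf_pow_zero {K : Set ℂ} [CompactSpace K] (L : C(K, ℂ) →L[ℂ] ℂ) (hK : IsCompact K) {B : ℝ}
    (h : ∀ v : ℂ, B < ‖v‖ → Lf L (fun s => (s - v)⁻¹) = 0) (n : ℕ) : Lf L (fun z => z ^ n) = 0 := by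
  obtain ⟨R, hR⟩ := hK.isBounded.subset_closedBall 0
  have hR' : ∀ z ∈ K, ‖z‖ ≤ R := fun z hz => by simpa using hR hz
  induction n using Nat.strong_induction_on with
  | _ n ih =>
  have hbound : ∀ v : ℝ, |B| + |R| + 1 < v → ‖Lf L (fun z => z ^ n)‖ ≤ ‖L‖ * (|R| ^ (n+1) / (v - |R|)) := by
    intro v hv
    have hvn : ‖(v:ℂ)‖ = v := by
      rw [Complex.norm_real, Real.norm_of_nonneg]; linarith [abs_nonneg B, abs_nonneg R]
    have hvB : B < ‖(v:ℂ)‖ := by rw [hvn]; linarith [le_abs_self B, abs_nonneg R]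
    have h0 := h v hvB
    have hne : ∀ z ∈ K, z - v ≠ 0 := by
      intro z hz h0
      have := hR' z hz
      rw [sub_eq_zero.mp h0, hvn] at this
      linarith [le_abs_self R, abs_nonneg B]
    have hci : ContinuousOn (fun z : ℂ => (z - v)⁻¹) K := ContinuousOn.inv₀ (by fun_prop) hne
    have hid : ∀ z ∈ K, z ^ n = (-(v:ℂ)^(n+1)) * (z - v)⁻¹ + ((∑ k ∈ Finset.range n, (-(v:ℂ)^(n-k)) * z ^ k) + z^(n+1) * (z - v)⁻¹) := by
      intro z hz
      have hg : ∑ k ∈ Finset.range (n+1), z ^ k * (v:ℂ)^(n-k) = (z^(n+1) - (v:ℂ)^(n+1)) / (z - v) := by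
        rw [eq_div_iff (hne z hz)]
        have := (Commute.all z (v:ℂ)).geom_sum₂_mul (n+1)
        simpa using this
      rw [Finset.sum_range_succ] at hg
      have e : ∑ k ∈ Finset.range n, (-(v:ℂ)^(n-k)) * z ^ k = -∑ k ∈ Finset.range n, z ^ k * (v:ℂ)^(n-k) := by
        rw [← Finset.sum_neg_distrib]
        refine Finset.sum_congr rfl fun k _ => by ring
      rw [e]
      rw [div_eq_mul_inv] at hg
      simp at hg
      linear_combination hg
    have hc1 : ContinuousOn (fun z : ℂ => (-(v:ℂ)^(n+1)) * (z - v)⁻¹) K := by fun_prop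
    have hc2 : ContinuousOn (fun z : ℂ => ∑ k ∈ Finset.range n, (-(v:ℂ)^(n-k)) * z ^ k) K := by fun_prop
    have hc3 : ContinuousOn (fun z : ℂ => z^(n+1) * (z - v)⁻¹) K := by fun_prop
    rw [Lf_congr L (by fun_prop) hid, Lf_add L hc1 (ContinuousOn.fun_add hc2 hc3), Lf_const_mul L hci, h0, mul_zero, zero_add,
      Lf_add L hc2 hc3, Lf_sum L _ (fun k _ => by fun_prop), Finset.sum_eq_zero, zero_add]
    · refine Lf_norm_le L hc3 ?_ ?_
      · have : 0 < v - |R| := by linarith [abs_nonneg B]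
        positivity
      · intro z hz
        have hzR := (hR' z hz).trans (le_abs_self R)
        have hp : 0 < v - |R| := by linarith [abs_nonneg B]
        rw [norm_mul, norm_pow, norm_inv, ← div_eq_mul_inv]
        have : v - |R| ≤ ‖z - v‖ := by
          have := norm_sub_norm_le (v:ℂ) z
          rw [hvn, norm_sub_rev] at this
          linarith
        gcongr
    · intro k hk
      rw [Lf_const_mul L (by fun_prop), ih k (Finset.mem_range.mp hk), mul_zero]
  have hlim : Tendsto (fun v : ℝ => ‖L‖ * (|R| ^ (n+1) / (v - |R|))) atTop (nhds (‖L‖ * 0)) := by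
    apply Tendsto.const_mul
    apply Tendsto.const_div_atTop
    exact tendsto_atTop_add_const_right _ _ tendsto_id
  rw [mul_zero] at hlim
  have := ge_of_tendsto hlim ((eventually_gt_atTop (|B| + |R| + 1)).mono hbound)
  exact norm_le_zero_iff.mp this

end Univ

namespace Univ

open ArithmeticFunction in
/-- von Mangoldt off the primes -/
noncomputable def Lnp (n : ℕ) : ℝ := if n.Prime then 0 else vonMangoldt n

/-- von Mangoldt on the primes -/
noncomputable def Lpr (n : ℕ) : ℝ := if n.Prime then Real.log n else 0

lemma Lpr_add_Lnp (n : ℕ) : Lpr n + Lnp n = ArithmeticFunction.vonMangoldt n := by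
  unfold Lpr Lnp
  split_ifs with h
  · rw [ArithmeticFunction.vonMangoldt_apply_prime h, add_zero]
  · rw [zero_add]

lemma Lnp_nonneg (n : ℕ) : 0 ≤ Lnp n := by
  unfold Lnp; split_ifs; exacts [le_rfl, ArithmeticFunction.vonMangoldt_nonneg]

lemma Lpr_nonneg (n : ℕ) : 0 ≤ Lpr n := by
  unfold Lpr; split_ifs; exacts [Real.log_natCast_nonneg n, le_rfl]

lemma Lpr_le (n : ℕ) : Lpr n ≤ Real.log n := by
  unfold Lpr; split_ifs; exacts [le_rfl, Real.log_natCast_nonneg n]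

lemma summable_log {σ : ℝ} (hσ : 1 < σ) : Summable fun n : ℕ => Real.log n * (n:ℝ) ^ (-σ) := by
  set ε := (σ - 1) / 2 with hε
  have hε0 : 0 < ε := by linarith
  have h1 : Summable fun n : ℕ => ε⁻¹ * (n:ℝ) ^ (-(σ - ε)) :=
    (Real.summable_nat_rpow.mpr (by linarith)).mul_left _
  refine Summable.of_nonneg_of_le (fun n => mul_nonneg (Real.log_natCast_nonneg n) (by positivity)) (fun n => ?_) h1
  rcases Nat.eq_zero_or_pos n with rfl | hn
  · simp; positivity
  · have hn' : (0:ℝ) < n := by exact_mod_cast hn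
    calc Real.log n * (n:ℝ)^(-σ) ≤ ((n:ℝ)^ε / ε) * (n:ℝ)^(-σ) := by
          gcongr; exact Real.log_le_rpow_div hn'.le hε0
      _ = ε⁻¹ * ((n:ℝ)^ε * (n:ℝ)^(-σ)) := by ring
      _ = _ := by rw [← Real.rpow_add hn']; congr 2; ring

lemma summable_nonprime {σ : ℝ} (hσ : 1/2 < σ) : Summable fun n : ℕ => Lnp n * (n:ℝ) ^ (-σ) := by
  -- reduce to prime powers
  have hinj : Function.Injective (fun pk : Nat.Primes × ℕ => ((pk.1 : ℕ)) ^ (pk.2 + 1)) := by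
    have := Subtype.val_injective.comp Nat.Primes.prodNatEquiv.injective
    exact this
  rw [← hinj.summable_iff]
  · have hf : Summable (fun p : Nat.Primes => Real.log p * (p:ℝ) ^ (-(2*σ))) :=
      (summable_log (by linarith : 1 < 2 * σ)).comp_injective (i := fun p : Nat.Primes => (p:ℕ)) Subtype.val_injective
    have hr : (2:ℝ)^(-σ) < 1 := Real.rpow_lt_one_of_one_lt_of_neg (by norm_num) (by linarith)
    have hr0 : (0:ℝ) < (2:ℝ)^(-σ) := by positivity
    have hg : Summable (fun k : ℕ => ((2:ℝ)^(-σ))⁻¹ * ((2:ℝ)^(-σ))^k) := (summable_geometric_of_lt_one hr0.le hr).mul_left _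
    refine Summable.of_nonneg_of_le (fun pk => mul_nonneg (Lnp_nonneg _) (by positivity)) ?_
      (hf.mul_of_nonneg hg (fun p => mul_nonneg (Real.log_natCast_nonneg _) (by positivity)) (fun k => by positivity))
    rintro ⟨p, k⟩
    have hp : Nat.Prime (p:ℕ) := p.2
    have hp0 : (0:ℝ) < (p:ℕ) := by exact_mod_cast hp.pos
    have hp2 : (2:ℝ) ≤ (p:ℕ) := by exact_mod_cast hp.two_le
    simp only [Function.comp]
    rcases Nat.eq_zero_or_pos k with rfl | hk
    · have : Lnp ((p:ℕ)^(0+1)) = 0 := by unfold Lnp; rw [if_pos (by simpa using hp)]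
      rw [this, zero_mul]
      exact mul_nonneg (mul_nonneg (Real.log_natCast_nonneg _) (by positivity)) (by positivity)
    · obtain ⟨j, rfl⟩ := Nat.exists_eq_add_of_le' hk
      have h1 : Lnp ((p:ℕ)^(j+1+1)) ≤ Real.log (p:ℕ) := by
        unfold Lnp
        split_ifs with h
        · exact Real.log_natCast_nonneg _
        · rw [ArithmeticFunction.vonMangoldt_apply_pow (by omega), ArithmeticFunction.vonMangoldt_apply_prime hp]
      have h2 : (((p:ℕ)^(j+1+1) : ℕ):ℝ)^(-σ) = ((p:ℕ):ℝ)^(-(2*σ)) * (((p:ℕ):ℝ)^(-σ))^j := by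
        push_cast
        rw [← Real.rpow_natCast, ← Real.rpow_natCast, ← Real.rpow_mul hp0.le, ← Real.rpow_mul hp0.le, ← Real.rpow_add hp0]
        congr 1; push_cast; ring
      have h3 : ((2:ℝ)^(-σ))⁻¹ * ((2:ℝ)^(-σ))^(j+1) = ((2:ℝ)^(-σ))^j := by
        rw [pow_succ]; field_simp
      rw [h2, h3]
      have h4 : ((p:ℕ):ℝ)^(-σ) ≤ (2:ℝ)^(-σ) := Real.rpow_le_rpow_of_nonpos (by norm_num) hp2 (by linarith)
      rw [← mul_assoc]
      have := Real.log_natCast_nonneg p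
      gcongr
  · intro n hn
    have : Lnp n = 0 := by
      unfold Lnp
      split_ifs with h
      · rfl
      · rw [ArithmeticFunction.vonMangoldt_eq_zero_iff]
        intro hpp
        apply hn
        refine ⟨Nat.Primes.prodNatEquiv.symm ⟨n, hpp⟩, ?_⟩
        have := Nat.Primes.coe_prodNatEquiv_apply (Nat.Primes.prodNatEquiv.symm ⟨n, hpp⟩).1 (Nat.Primes.prodNatEquiv.symm ⟨n, hpp⟩).2
        simp only [Prod.mk.eta, Equiv.apply_symm_apply] at this
        exact this.symm
    rw [this, zero_mul]

lemma norm_coef_cpow {n : ℕ} {a σ : ℝ} (ha : 0 ≤ a) (ha0 : n = 0 → a = 0) {z : ℂ} (hz : σ ≤ z.re) :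
    ‖(a:ℂ) * (n:ℂ)^(-z)‖ ≤ a * (n:ℝ)^(-σ) := by
  rcases Nat.eq_zero_or_pos n with rfl | hn
  · simp [ha0 rfl]
  · rw [norm_mul, Complex.norm_real, Real.norm_of_nonneg ha, Complex.norm_natCast_cpow_of_pos hn, neg_re]
    have : (1:ℝ) ≤ n := by exact_mod_cast hn
    gcongr

lemma Lnp_zero : Lnp 0 = 0 := by unfold Lnp; simp
lemma Lpr_zero : Lpr 0 = 0 := by unfold Lpr; simp

noncomputable def Jf (z : ℂ) : ℂ := ∑' n : ℕ, (Lnp n : ℂ) * (n:ℂ)^(-z)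

lemma Jf_diff : DifferentiableOn ℂ Jf {z | 1/2 < z.re} := by
  intro z (hz : 1/2 < z.re)
  obtain ⟨σ, h1, h2⟩ := exists_between hz
  have : DifferentiableOn ℂ Jf {w | σ < w.re} := by
    unfold Jf
    refine Complex.differentiableOn_tsum_of_summable_norm (summable_nonprime h1) ?_ ?_ ?_
    · intro n
      rcases Nat.eq_zero_or_pos n with rfl | hn
      · simp only [Lnp_zero]; simp
      · have : (n:ℂ) ≠ 0 := by exact_mod_cast hn.ne'
        intro w _
        refine DifferentiableAt.differentiableWithinAt ?_
        exact (DifferentiableAt.const_cpow differentiableAt_id.neg (Or.inl this)).const_mul _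
    · exact isOpen_lt continuous_const Complex.continuous_re
    · intro n w (hw : σ < w.re)
      exact norm_coef_cpow (Lnp_nonneg n) (by rintro rfl; exact Lnp_zero) hw.le
  exact (this.differentiableAt ((isOpen_lt continuous_const Complex.continuous_re).mem_nhds h2)).differentiableWithinAt

noncomputable def zeta1 : ℂ → ℂ := Function.update (fun s => (s - 1) * riemannZeta s) 1 1

lemma zeta1_of_ne {s : ℂ} (h : s ≠ 1) : zeta1 s = (s - 1) * riemannZeta s := by
  unfold zeta1; rw [Function.update_of_ne h]

lemma zeta1_diff : Differentiable ℂ zeta1 := by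
  rw [← differentiableOn_univ, ← Complex.differentiableOn_compl_singleton_and_continuousAt_iff (c := 1) univ_mem]
  constructor
  · intro s hs
    have hs1 : s ≠ 1 := by simpa using hs
    refine DifferentiableAt.differentiableWithinAt ?_
    have : DifferentiableAt ℂ (fun s => (s - 1) * riemannZeta s) s :=
      (differentiableAt_id.sub_const _).mul (differentiableAt_riemannZeta hs1)
    refine this.congr_of_eventuallyEq ?_
    filter_upwards [isOpen_ne.mem_nhds hs1] with w hw using zeta1_of_ne hw
  · unfold zeta1
    rw [continuousAt_update_same]
    exact riemannZeta_residue_one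

lemma zeta_ne_zero (hRH : RiemannHypothesis) {s : ℂ} (hs : 1/2 < s.re) : riemannZeta s ≠ 0 := by
  intro h
  by_cases h1 : s = 1
  · exact riemannZeta_ne_zero_of_one_le_re (by rw [h1]; simp) h
  · have := hRH s h (by
      rintro ⟨n, rfl⟩
      have hn : (0:ℝ) ≤ n := by positivity
      simp at hs
      linarith) h1
    linarith

lemma zeta1_ne_zero (hRH : RiemannHypothesis) {s : ℂ} (hs : 1/2 < s.re) : zeta1 s ≠ 0 := by
  by_cases h1 : s = 1
  · rw [h1]; simp [zeta1]
  · rw [zeta1_of_ne h1]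
    exact mul_ne_zero (sub_ne_zero.mpr h1) (zeta_ne_zero hRH hs)

lemma zeta1_logDeriv (hRH : RiemannHypothesis) {s : ℂ} (hs : 1/2 < s.re) (h1 : s ≠ 1) :
    deriv zeta1 s / zeta1 s = (s - 1)⁻¹ + deriv riemannZeta s / riemannZeta s := by
  have hd : deriv zeta1 s = riemannZeta s + (s - 1) * deriv riemannZeta s := by
    have e : zeta1 =ᶠ[nhds s] (fun s => (s - 1) * riemannZeta s) := by
      filter_upwards [isOpen_ne.mem_nhds h1] with w hw using zeta1_of_ne hw
    rw [e.deriv_eq]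
    have := ((hasDerivAt_id s).sub_const 1).mul (differentiableAt_riemannZeta h1).hasDerivAt
    have h2 := this.deriv
    simp only [id, one_mul] at h2
    exact h2
  rw [hd, zeta1_of_ne h1]
  have := sub_ne_zero.mpr h1
  have := zeta_ne_zero hRH hs
  field_simp

noncomputable def H1 (z : ℂ) : ℂ := -(deriv zeta1 z / zeta1 z) - Jf z

lemma H1_diff (hRH : RiemannHypothesis) : DifferentiableOn ℂ H1 {z | 1/2 < z.re} := by
  refine DifferentiableOn.sub (DifferentiableOn.neg (DifferentiableOn.div ?_ ?_ ?_)) Jf_diff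
  · exact (zeta1_diff.differentiableOn (s := Set.univ)).deriv isOpen_univ |>.mono (Set.subset_univ _)
  · exact zeta1_diff.differentiableOn
  · exact fun z hz => zeta1_ne_zero hRH hz

lemma vM_hasSum {z : ℂ} (hz : 1 < z.re) :
    HasSum (fun n : ℕ => (ArithmeticFunction.vonMangoldt n : ℂ) * (n:ℂ)^(-z)) (-(deriv riemannZeta z / riemannZeta z)) := by
  have h1 := (ArithmeticFunction.LSeriesSummable_vonMangoldt hz).LSeriesHasSum
  rw [ArithmeticFunction.LSeries_vonMangoldt_eq_deriv_riemannZeta_div hz, neg_div] at h1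
  unfold LSeriesHasSum at h1
  convert h1 using 1
  ext n
  rcases Nat.eq_zero_or_pos n with rfl | hn
  · simp
  · rw [LSeries.term_of_ne_zero hn.ne', Complex.cpow_neg, div_eq_mul_inv]

lemma prime_hasSum (hRH : RiemannHypothesis) {z : ℂ} (hz : 1 < z.re) :
    HasSum (fun n : ℕ => (Lpr n : ℂ) * (n:ℂ)^(-z)) ((z - 1)⁻¹ + H1 z) := by
  have hJ : HasSum (fun n : ℕ => (Lnp n : ℂ) * (n:ℂ)^(-z)) (Jf z) := by
    apply Summable.hasSum
    exact Summable.of_norm_bounded (summable_nonprime (by linarith : 1/2 < z.re))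
      fun n => norm_coef_cpow (Lnp_nonneg n) (by rintro rfl; exact Lnp_zero) le_rfl
  have h := (vM_hasSum hz).sub hJ
  have hne : z ≠ 1 := by rintro rfl; simp at hz
  have e1 : (fun n : ℕ => (Lpr n : ℂ) * (n:ℂ)^(-z)) =
      fun n : ℕ => (ArithmeticFunction.vonMangoldt n : ℂ) * (n:ℂ)^(-z) - (Lnp n : ℂ) * (n:ℂ)^(-z) := by
    ext n
    rw [← Lpr_add_Lnp]; push_cast; ring
  have e2 : (z - 1)⁻¹ + H1 z = -(deriv riemannZeta z / riemannZeta z) - Jf z := by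
    unfold H1
    rw [zeta1_logDeriv hRH (by linarith) hne]; ring
  rw [e1, e2]
  exact h

end Univ

namespace Univ

lemma box {K : Set ℂ} (hK : IsCompact K) (hKsub : K ⊆ {s | 1/2 < s.re ∧ s.re < 1}) :
    ∃ σ₀ σ₁ B : ℝ, 1/2 < σ₀ ∧ σ₀ ≤ 1 ∧ σ₁ < 1 ∧ 0 ≤ B ∧ ∀ s ∈ K, σ₀ ≤ s.re ∧ s.re ≤ σ₁ ∧ |s.im| ≤ B := by
  rcases K.eq_empty_or_nonempty with rfl | hne
  · exact ⟨1, 0, 0, by norm_num, le_rfl, by norm_num, le_rfl, by simp⟩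
  obtain ⟨a, ha, ha'⟩ := hK.exists_isMinOn hne Complex.continuous_re.continuousOn
  obtain ⟨b, hb, hb'⟩ := hK.exists_isMaxOn hne Complex.continuous_re.continuousOn
  obtain ⟨R, hR⟩ := hK.isBounded.subset_closedBall 0
  refine ⟨a.re, b.re, |R|, (hKsub ha).1, (hKsub ha).2.le, (hKsub hb).2, abs_nonneg _, fun s hs => ⟨ha' hs, hb' hs, ?_⟩⟩
  have := hR hs
  simp at this
  exact (Complex.abs_im_le_norm s).trans (this.trans (le_abs_self R))

lemma log_pow_le {η : ℝ} (hη : 0 < η) (k : ℕ) : ∃ C > 0, ∀ n : ℕ, 0 < n → (Real.log n)^k ≤ C * (n:ℝ)^η := by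
  set ε := η / (k + 1) with hε
  have hε0 : 0 < ε := by positivity
  refine ⟨(ε⁻¹)^k + 1, by positivity, fun n hn => ?_⟩
  have hn1 : (1:ℝ) ≤ n := by exact_mod_cast hn
  have h1 := Real.log_le_rpow_div (x := n) (by positivity) hε0
  calc (Real.log n)^k ≤ ((n:ℝ)^ε / ε)^k := by
        have := Real.log_natCast_nonneg n
        gcongr
    _ = (ε⁻¹)^k * (n:ℝ)^(ε * k) := by
        rw [div_eq_mul_inv, mul_pow, Real.rpow_mul (by positivity), Real.rpow_natCast]; ring
    _ ≤ ((ε⁻¹)^k + 1) * (n:ℝ)^η := by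
        gcongr
        · linarith
        · rw [hε, div_mul_eq_mul_div, div_le_iff₀ (by positivity)]
          nlinarith

lemma eqOn_ext {f g : ℂ → ℂ} {U : Set ℂ} (hU : IsOpen U) (hconv : Convex ℝ U) (hf : DifferentiableOn ℂ f U)
    (hg : DifferentiableOn ℂ g U) {V : Set ℂ} (hV : IsOpen V) {z : ℂ} (hzU : z ∈ U) (hzV : z ∈ V)
    (h : ∀ w ∈ V, f w = g w) : ∀ w ∈ U, f w = g w := by
  refine AnalyticOnNhd.eqOn_of_preconnected_of_eventuallyEq (hf.analyticOnNhd hU) (hg.analyticOnNhd hU)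
    hconv.isPreconnected hzU ?_
  filter_upwards [hV.mem_nhds hzV] with w hw using h w hw

lemma cauchy_zero (hRH : RiemannHypothesis) {K : Set ℂ} [CompactSpace K] (hK : IsCompact K)
    (hKsub : K ⊆ {s | 1/2 < s.re ∧ s.re < 1}) (L : C(K, ℂ) →L[ℂ] ℂ) (m : ℕ)
    (hS : Summable fun n : ℕ => Lpr n * ‖Lf L (fun s => (n:ℂ)^(-s))‖ / (Real.log n)^(m+1)) :
    ∃ B : ℝ, ∀ v : ℂ, B < ‖v‖ → Lf L (fun s => (s - v)⁻¹) = 0 := by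
  obtain ⟨σ₀, σ₁, B, hσ₀, -, hσ₁, hB, hbox⟩ := box hK hKsub
  set φ : ℕ → ℂ := fun n => Lf L (fun s => (n:ℂ)^(-s)) with hφ
  have hcpow : ∀ n : ℕ, 0 < n → Continuous (fun s : ℂ => (n:ℂ)^(-s)) := by
    intro n hn
    have : (n:ℂ) ≠ 0 := by exact_mod_cast hn.ne'
    exact continuous_neg.const_cpow (Or.inl this)
  set Ψ : ℂ → ℂ := fun w => ∑' n : ℕ, (Lpr n : ℂ) * φ n * (n:ℂ)^w with hΨ
  have hneg : IsOpen {w : ℂ | w.re < 0} := isOpen_lt Complex.continuous_re continuous_const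
  have hΨd : DifferentiableOn ℂ Ψ {w | w.re < 0} := by
    intro w (hw : w.re < 0)
    obtain ⟨a, h1, h2⟩ := exists_between hw
    have hη : 0 < -a := by linarith
    obtain ⟨C, hC, hCb⟩ := log_pow_le hη (m+1)
    have hd : DifferentiableOn ℂ Ψ {w | w.re < a} := by
      refine Complex.differentiableOn_tsum_of_summable_norm (hS.mul_left C) ?_ (isOpen_lt Complex.continuous_re continuous_const) ?_
      · intro n
        rcases Nat.eq_zero_or_pos n with rfl | hn
        · simp only [Lpr_zero]; simp
        · have : (n:ℂ) ≠ 0 := by exact_mod_cast hn.ne'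
          intro w _
          refine DifferentiableAt.differentiableWithinAt ?_
          exact (DifferentiableAt.const_cpow differentiableAt_id (Or.inl this)).const_mul _
      · intro n v (hv : v.re < a)
        by_cases hp : n.Prime
        · have hn := hp.pos
          have hn1 : (1:ℝ) ≤ n := by exact_mod_cast hn
          have hl : 0 < Real.log n := Real.log_pos (by exact_mod_cast hp.one_lt)
          rw [norm_mul, norm_mul, Complex.norm_real, Real.norm_of_nonneg (Lpr_nonneg n), Complex.norm_natCast_cpow_of_pos hn]
          have h3 : (n:ℝ)^v.re ≤ C / (Real.log n)^(m+1) := by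
            rw [le_div_iff₀ (by positivity)]
            calc (n:ℝ)^v.re * (Real.log n)^(m+1) ≤ (n:ℝ)^a * (C * (n:ℝ)^(-a)) := by
                  gcongr
                  exact hCb n hn
              _ = C * ((n:ℝ)^a * (n:ℝ)^(-a)) := by ring
              _ = C := by rw [← Real.rpow_add (by linarith)]; simp
          have := Lpr_nonneg n
          calc Lpr n * ‖φ n‖ * (n:ℝ)^v.re ≤ Lpr n * ‖φ n‖ * (C / (Real.log n)^(m+1)) := by gcongr
            _ = _ := by ring
        · have : Lpr n = 0 := by unfold Lpr; rw [if_neg hp]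
          rw [this]; simp
    exact (hd.differentiableAt ((isOpen_lt Complex.continuous_re continuous_const).mem_nhds h1)).differentiableWithinAt
  -- the Cauchy transform
  set Cf : ℂ → ℂ := fun w => Lf L (fun s => (s - w - 1)⁻¹) with hCf
  set Hf : ℂ → ℂ := fun w => Lf L (fun s => H1 (s - w)) with hHf
  have hHd : DifferentiableOn ℂ Hf {w | w.re < 0} := by
    refine Lf_holo L hneg ?_ ?_
    · refine (H1_diff hRH).continuousOn.comp (f := fun p : ℂ × ℂ => p.2 - p.1) (by fun_prop) ?_
      rintro ⟨w, s⟩ ⟨hw : w.re < 0, hs⟩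
      have := (hbox s hs).1
      simp only [Set.mem_setOf_eq, Complex.sub_re]
      linarith
    · intro s hs
      refine (H1_diff hRH).comp (by fun_prop) ?_
      intro w (hw : w.re < 0)
      have := (hbox s hs).1
      simp only [Set.mem_setOf_eq, Complex.sub_re]
      linarith
  set U : Set ℂ := {w | w + 1 ∉ K} with hU
  have hUo : IsOpen U := hK.isClosed.isOpen_compl.preimage (f := fun w : ℂ => w + 1) (by fun_prop)
  have hUne : ∀ w ∈ U, ∀ s ∈ K, s - w - 1 ≠ 0 := by
    intro w hw s hs h0
    apply hw
    have : w + 1 = s := by linear_combination -h0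
    rwa [this]
  have hCd : DifferentiableOn ℂ Cf U := by
    refine Lf_holo L hUo ?_ ?_
    · refine ContinuousOn.inv₀ (f := fun p : ℂ × ℂ => p.2 - p.1 - 1) (by fun_prop) ?_
      rintro ⟨w, s⟩ ⟨hw, hs⟩
      exact hUne w hw s hs
    · intro s hs
      refine DifferentiableOn.fun_inv (by fun_prop) ?_
      intro w hw
      exact hUne w hw s hs
  set Ct : ℂ → ℂ := fun w => Ψ w - Hf w with hCt
  have hCtd : DifferentiableOn ℂ Ct {w | w.re < 0} := hΨd.sub hHd
  -- agreement on the far left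
  have hA1 : ∀ w ∈ {w : ℂ | w.re < -(1/2)}, Ct w = Cf w := by
    intro w (hw : w.re < -(1/2))
    have hsre : ∀ s ∈ K, σ₀ - w.re ≤ (s - w).re := fun s hs => by
      have := (hbox s hs).1
      simp only [Complex.sub_re]; linarith
    have hgt : 1 < σ₀ - w.re := by linarith
    have h1 := Lf_hasSum L (h := fun (n : ℕ) s => (Lpr n : ℂ) * (n:ℂ)^(-(s - w))) (u := fun n : ℕ => Real.log n * (n:ℝ)^(-(σ₀ - w.re)))
      (by
        intro n
        rcases Nat.eq_zero_or_pos n with rfl | hn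
        · simp only [Lpr_zero]; simp; exact continuousOn_const
        · exact (continuous_const.mul ((hcpow n hn).comp (continuous_id.sub continuous_const))).continuousOn)
      (summable_log hgt)
      (by
        intro n s hs
        refine (norm_coef_cpow (Lpr_nonneg n) (by rintro rfl; exact Lpr_zero) (hsre s hs)).trans ?_
        gcongr
        exact Lpr_le n)
    have e1 : (fun n : ℕ => Lf L (fun s => (Lpr n : ℂ) * (n:ℂ)^(-(s - w)))) = fun n : ℕ => (Lpr n : ℂ) * φ n * (n:ℂ)^w := by
      ext n
      rcases Nat.eq_zero_or_pos n with rfl | hn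
      · simp only [Lpr_zero]
        rw [Lf_eq L 0 (fun z => by simp)]; simp
      · have hn0 : (n:ℂ) ≠ 0 := by exact_mod_cast hn.ne'
        have : (fun s : ℂ => (Lpr n : ℂ) * (n:ℂ)^(-(s - w))) = fun s => ((Lpr n : ℂ) * (n:ℂ)^w) * (n:ℂ)^(-s) := by
          ext s
          rw [show -(s - w) = w + -s by ring, Complex.cpow_add _ _ hn0]; ring
        rw [this, Lf_const_mul L (hcpow n hn).continuousOn]
        ring
    rw [e1] at h1
    have h2 : Ψ w = Lf L (fun s => ∑' n : ℕ, (Lpr n : ℂ) * (n:ℂ)^(-(s - w))) := h1.tsum_eq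
    have hwU : w ∈ U := by
      intro h
      have := (hbox _ h).1
      simp at this; linarith
    have hc1 : ContinuousOn (fun s => (s - w - 1)⁻¹) K :=
      ContinuousOn.inv₀ (f := fun s => s - w - 1) (by fun_prop) (hUne w hwU)
    have hc2 : ContinuousOn (fun s => H1 (s - w)) K := by
      refine (H1_diff hRH).continuousOn.comp (f := fun s => s - w) (by fun_prop) ?_
      intro s hs
      have := hsre s hs
      simp only [Set.mem_setOf_eq]; linarith
    have h3 : Lf L (fun s => ∑' n : ℕ, (Lpr n : ℂ) * (n:ℂ)^(-(s - w))) = Lf L (fun s => (s - w - 1)⁻¹ + H1 (s - w)) := by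
      symm
      refine Lf_congr L (hc1.add hc2) fun s hs => ?_
      exact (prime_hasSum hRH (by have := hsre s hs; linarith)).tsum_eq.symm
    simp only [hCt, hCf, hHf]
    rw [h2, h3, Lf_add L hc1 hc2]; ring
  have hre : ∀ a : ℝ, Convex ℝ {w : ℂ | w.re < a} := fun a => convex_halfSpace_re_lt a
  -- upper quarter plane
  have hA2o : IsOpen ({w : ℂ | w.re < 0} ∩ {w | B < w.im}) := hneg.inter (isOpen_lt continuous_const Complex.continuous_im)
  have hA2 : ∀ w ∈ {w : ℂ | w.re < 0} ∩ {w | B < w.im}, Ct w = Cf w := by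
    refine eqOn_ext hA2o ((hre 0).inter (convex_halfSpace_im_gt B)) (hCtd.mono Set.inter_subset_left) (hCd.mono ?_)
      (isOpen_lt Complex.continuous_re continuous_const) (z := ⟨-1, B + 1⟩) ?_ ?_ hA1
    · rintro w ⟨_, hw : B < w.im⟩ h
      have := (hbox _ h).2.2
      simp at this
      linarith [le_abs_self w.im]
    · simp
    · simp; norm_num
  have hA4 : ∀ w ∈ {w : ℂ | w.re < 0} ∩ {w | w.im < -B}, Ct w = Cf w := by
    refine eqOn_ext (hneg.inter (isOpen_lt Complex.continuous_im continuous_const)) ((hre 0).inter (convex_halfSpace_im_lt (-B))) (hCtd.mono Set.inter_subset_left) (hCd.mono ?_)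
      (isOpen_lt Complex.continuous_re continuous_const) (z := ⟨-1, -B - 1⟩) ?_ ?_ hA1
    · rintro w ⟨_, hw : w.im < -B⟩ h
      have := (hbox _ h).2.2
      simp at this
      linarith [neg_abs_le w.im]
    · simp
    · simp; norm_num
  have hrU : ∀ w : ℂ, σ₁ - 1 < w.re → w ∈ U := by
    intro w hw h
    have := (hbox _ h).2.1
    simp at this
    linarith
  have hA3 : ∀ w ∈ {w : ℂ | w.re < 0} ∩ {w | σ₁ - 1 < w.re}, Ct w = Cf w := by
    refine eqOn_ext (hneg.inter (isOpen_lt continuous_const Complex.continuous_re)) ((hre 0).inter (convex_halfSpace_re_gt _)) (hCtd.mono Set.inter_subset_left) (hCd.mono ?_)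
      hA2o (z := ⟨(σ₁ - 1)/2, B + 1⟩) ?_ ?_ hA2
    · rintro w ⟨_, hw : σ₁ - 1 < w.re⟩
      exact hrU w hw
    · constructor <;> simp <;> linarith
    · constructor <;> simp <;> linarith
  classical
  set E : ℂ → ℂ := fun w => if w.re < 0 then Ct w else Cf w with hE
  have hEd : Differentiable ℂ E := by
    intro w
    by_cases hw : w.re < 0
    · refine (hCtd.differentiableAt (hneg.mem_nhds hw)).congr_of_eventuallyEq ?_
      filter_upwards [hneg.mem_nhds hw] with v hv
      simp only [hE]; rw [if_pos hv]
    · have hw' : σ₁ - 1 < w.re := by push Not at hw; linarith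
      refine (hCd.differentiableAt (hUo.mem_nhds (hrU w hw'))).congr_of_eventuallyEq ?_
      filter_upwards [(isOpen_lt continuous_const Complex.continuous_re).mem_nhds hw'] with v hv
      simp only [hE]
      split_ifs with h
      · exact hA3 v ⟨h, hv⟩
      · rfl
  have hEC : ∀ w : ℂ, B + 1 < ‖w‖ → E w = Cf w := by
    intro w hw
    simp only [hE]
    split_ifs with h
    · by_cases h1 : w.re < -(1/2)
      · exact hA1 w h1
      by_cases h2 : B < w.im
      · exact hA2 w ⟨h, h2⟩
      by_cases h3 : w.im < -B
      · exact hA4 w ⟨h, h3⟩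
      exfalso
      push Not at h1 h2 h3
      have h4 := Complex.norm_le_abs_re_add_abs_im w
      have h5 : |w.re| ≤ 1/2 := abs_le.mpr ⟨h1, by linarith⟩
      have h6 : |w.im| ≤ B := abs_le.mpr ⟨h3, h2⟩
      linarith
    · rfl
  have hEb : ∀ w : ℂ, B + 1 < ‖w‖ → ‖E w‖ ≤ ‖L‖ * (‖w‖ - (B + 1))⁻¹ := by
    intro w hw
    rw [hEC w hw]
    have hge : ∀ s ∈ K, ‖w‖ - (B + 1) ≤ ‖s - w - 1‖ := by
      intro s hs
      obtain ⟨h1, h2, h3⟩ := hbox s hs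
      have h4 := Complex.norm_le_abs_re_add_abs_im (s - 1)
      have h5 : |(s - 1).re| ≤ 1 := by rw [abs_le]; simp; constructor <;> linarith
      have h6 : |(s - 1).im| ≤ B := by simpa using h3
      have h7 : ‖w‖ ≤ ‖s - 1‖ + ‖s - w - 1‖ := by
        calc ‖w‖ = ‖(s - 1) - (s - w - 1)‖ := by congr 1; ring
          _ ≤ _ := norm_sub_le _ _
      linarith
    have hp : 0 < ‖w‖ - (B + 1) := by linarith
    refine Lf_norm_le L (ContinuousOn.inv₀ (f := fun s => s - w - 1) (by fun_prop) ?_) (by positivity) ?_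
    · intro s hs h0
      have := hge s hs
      rw [h0, norm_zero] at this; linarith
    · intro s hs
      show ‖(s - w - 1)⁻¹‖ ≤ _
      rw [norm_inv]
      exact inv_anti₀ hp (hge s hs)
  have hE0 : ∀ w, E w = 0 := by
    intro w
    apply hEd.apply_eq_of_tendsto_cocompact
    have hn : Tendsto (fun w : ℂ => ‖w‖) (cocompact ℂ) atTop := tendsto_norm_cocompact_atTop
    have ht : Tendsto (fun w : ℂ => ‖L‖ * (‖w‖ - (B + 1))⁻¹) (cocompact ℂ) (nhds (‖L‖ * 0)) :=
      Tendsto.const_mul _ (tendsto_inv_atTop_zero.comp (tendsto_atTop_add_const_right _ _ hn))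
    rw [mul_zero] at ht
    exact squeeze_zero_norm' ((hn.eventually_gt_atTop (B + 1)).mono hEb) ht
  refine ⟨B + 2, fun v hv => ?_⟩
  have h1 : B + 1 < ‖v - 1‖ := by
    have := norm_sub_norm_le v 1
    simp at this; linarith
  have h2 := hEC (v - 1) h1
  rw [hE0] at h2
  rw [h2]
  simp only [hCf]
  congr 1; ext s; congr 1; ring

theorem density (hRH : RiemannHypothesis) {K : Set ℂ} [CompactSpace K] (hK : IsCompact K)
    (hKsub : K ⊆ {s | 1/2 < s.re ∧ s.re < 1}) {f : ℂ → ℂ} (hf : Appr K f) (m y : ℕ) {ε : ℝ} (hε : 0 < ε) :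
    ∃ (P : Finset ℕ) (c : ℕ → ℂ), (∀ p ∈ P, p.Prime ∧ y < p) ∧ (∀ p, ‖c p‖ ≤ 1/2) ∧
      ∀ s ∈ K, ‖∑ p ∈ P, c p * ((Real.log p : ℂ)^m)⁻¹ * (p:ℂ)^(-s) - f s‖ < ε := by
  classical
  -- basis functions
  let e : ℕ → C(K, ℂ) := fun n => if h : n.Prime ∧ y < n then
    ⟨fun z => ((Real.log n : ℂ)^m)⁻¹ * (n:ℂ)^(-(z:ℂ)), by
      have : (n:ℂ) ≠ 0 := by exact_mod_cast h.1.ne_zero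
      exact continuous_const.mul ((continuous_neg.comp continuous_subtype_val).const_cpow (Or.inl this))⟩ else 0
  have he : ∀ n, n.Prime ∧ y < n → ∀ z : K, e n z = ((Real.log n : ℂ)^m)⁻¹ * (n:ℂ)^(-(z:ℂ)) := by
    intro n h z
    simp only [e, dif_pos h]; rfl
  have he0 : ∀ n, ¬ (n.Prime ∧ y < n) → e n = 0 := by
    intro n h
    simp only [e, dif_neg h]
  let A : Set (ℕ →₀ ℂ) := {c | ∀ p, ‖c p‖ ≤ 1/2}
  have hA : Convex ℝ A := by
    intro c hc d hd a b ha hb hab p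
    simp only [Finsupp.coe_add, Finsupp.coe_smul, Pi.add_apply, Pi.smul_apply]
    refine (norm_add_le _ _).trans ?_
    rw [norm_smul, norm_smul, Real.norm_of_nonneg ha, Real.norm_of_nonneg hb]
    have h1 := hc p
    have h2 := hd p
    nlinarith
  let T : (ℕ →₀ ℂ) →ₗ[ℂ] C(K, ℂ) := Finsupp.linearCombination ℂ e
  let S : Set C(K, ℂ) := T '' A
  have hSc : Convex ℝ S := hA.linear_image (T.restrictScalars ℝ)
  obtain ⟨g, hg⟩ := id hf
  by_cases hmem : g ∈ closure S
  · rw [Metric.mem_closure_iff] at hmem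
    obtain ⟨_, ⟨c, hc, rfl⟩, hdist⟩ := hmem ε hε
    refine ⟨c.support.filter (fun n => n.Prime ∧ y < n), c, fun p hp => (Finset.mem_filter.mp hp).2, hc, fun s hs => ?_⟩
    have h1 : ‖(T c) ⟨s, hs⟩ - g ⟨s, hs⟩‖ < ε := by
      rw [← dist_eq_norm, dist_comm]
      exact lt_of_le_of_lt (ContinuousMap.dist_apply_le_dist _) hdist
    rw [hg.2] at h1
    convert h1 using 3
    simp only [T, Finsupp.linearCombination_apply, Finsupp.sum]
    rw [ContinuousMap.sum_apply, Finset.sum_filter]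
    refine Finset.sum_congr rfl fun n _ => ?_
    split_ifs with h
    · rw [ContinuousMap.smul_apply, he n h]; simp; ring
    · rw [he0 n h]; simp
  · exfalso
    obtain ⟨L, u, hL1, hL2⟩ := RCLike.geometric_hahn_banach_closed_point (𝕜 := ℂ) hSc.closure isClosed_closure hmem
    have hL3 : ∀ c ∈ A, (L (T c)).re < u := fun c hc => hL1 _ (subset_closure ⟨c, hc, rfl⟩)
    have hu : 0 < u := by
      have := hL3 0 (by intro p; simp)
      simpa using this
    have hsum : Summable fun n => ‖L (e n)‖ := by
      refine summable_of_sum_le (c := 2 * u) (fun n => norm_nonneg _) fun P => ?_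
      let c : ℕ →₀ ℂ := Finsupp.onFinset P (fun n => if n ∈ P then (1/2 : ℂ) * (starRingEnd ℂ (L (e n)) / ‖L (e n)‖) else 0)
        (by intro n hn; by_contra h; simp [h] at hn)
      have hcA : c ∈ A := by
        intro p
        simp only [c, Finsupp.onFinset_apply]
        split_ifs
        · rw [norm_mul, norm_div (starRingEnd ℂ _), RCLike.norm_conj, Complex.norm_real, norm_norm]
          have : ‖L (e p)‖ / ‖L (e p)‖ ≤ 1 := div_self_le_one _
          norm_num
          linarith
        · simp
      have h1 := hL3 c hcA
      have h2 : L (T c) = ((∑ n ∈ P, ‖L (e n)‖ / 2 : ℝ) : ℂ) := by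
        have : T c = ∑ n ∈ P, c n • e n := by
          simp only [T, Finsupp.linearCombination_apply]
          exact Finsupp.sum_of_support_subset _ Finsupp.support_onFinset_subset _ (by simp)
        rw [this, map_sum]
        push_cast
        refine Finset.sum_congr rfl fun n hn => ?_
        rw [map_smul, smul_eq_mul]
        simp only [c, Finsupp.onFinset_apply, if_pos hn]
        by_cases h0 : L (e n) = 0
        · simp [h0]
        · have h3 : (‖L (e n)‖ : ℂ) ≠ 0 := by exact_mod_cast norm_ne_zero_iff.mpr h0
          have h4 := Complex.conj_mul' (L (e n))
          field_simp
          rw [h4]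
      rw [h2, Complex.ofReal_re, ← Finset.sum_div] at h1
      linarith
    have hS : Summable fun n : ℕ => Lpr n * ‖Lf L (fun s => (n:ℂ)^(-s))‖ / (Real.log n)^(m+1) := by
      have hev : ∀ n ∈ Set.Ioi y, Lpr n * ‖Lf L (fun s => (n:ℂ)^(-s))‖ / (Real.log n)^(m+1) = ‖L (e n)‖ := by
        intro n (hn : y < n)
        by_cases hp : n.Prime
        · have hl : 0 < Real.log n := Real.log_pos (by exact_mod_cast hp.one_lt)
          have hn0 : (n:ℂ) ≠ 0 := by exact_mod_cast hp.ne_zero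
          have : L (e n) = ((Real.log n : ℂ)^m)⁻¹ * Lf L (fun s => (n:ℂ)^(-s)) := by
            rw [← Lf_const_mul L (continuous_neg.const_cpow (Or.inl hn0)).continuousOn]
            exact (Lf_eq L (e n) (he n ⟨hp, hn⟩)).symm
          rw [this, norm_mul, norm_inv, norm_pow, Complex.norm_real, Real.norm_of_nonneg hl.le]
          unfold Lpr
          rw [if_pos hp]
          field_simp
          ring
        · rw [he0 n (fun h => hp h.1)]
          unfold Lpr
          rw [if_neg hp]; simp
      refine (summable_congr_cofinite ?_).mpr hsum
      rw [Nat.cofinite_eq_atTop]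
      filter_upwards [eventually_gt_atTop y] with n hn using hev n hn
    obtain ⟨B, hB⟩ := cauchy_zero hRH hK hKsub L m hS
    have hz := Lf_appr_zero L (Lf_pow_zero L hK hB) hf
    rw [Lf_eq L g hg.2] at hz
    rw [hz] at hL2
    simp at hL2
    linarith

end Univ

namespace Univ

/-- terms of the Euler-Maclaurin series -/
noncomputable def emT (n : ℕ) (s : ℂ) : ℂ :=
  (s - 1) * ((n:ℂ)+1)^(-s) + (((n:ℂ)+2)^(1-s) - ((n:ℂ)+1)^(1-s))

lemma hasDerivAt_cpow_pos {y : ℝ} (hy : 0 < y) (r : ℂ) :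
    HasDerivAt (fun y : ℝ => (y : ℂ) ^ r) (r * y ^ (r - 1)) y := by
  by_cases hr : r = 0
  · subst hr; simpa using hasDerivAt_const y (1:ℂ)
  · exact hasDerivAt_ofReal_cpow_const hy.ne' hr

lemma emT_norm_le {n : ℕ} {s : ℂ} (hs : 0 ≤ s.re) :
    ‖emT n s‖ ≤ ‖s‖ * ‖s-1‖ * ((n:ℝ)+1)^(-s.re-1) := by
  set N : ℝ := (n:ℝ)+1 with hN
  have hNp : 0 < N := by positivity
  have h1 : ∀ x ∈ Set.Icc N (N+1), ‖(x:ℂ)^(-s) - (N:ℂ)^(-s)‖ ≤ ‖s‖ * N^(-s.re-1) * ‖x - N‖ := by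
    intro x hx
    refine (convex_Icc N (N+1)).norm_image_sub_le_of_norm_hasDerivWithin_le (f := fun x : ℝ => (x:ℂ)^(-s))
      (f' := fun x : ℝ => -s * (x:ℂ)^(-s-1)) (fun y hy => ?_) (fun y hy => ?_) ⟨le_rfl, by linarith⟩ hx
    · exact (hasDerivAt_cpow_pos (by linarith [hy.1]) _).hasDerivWithinAt
    · have hy0 : 0 < y := by linarith [hy.1]
      rw [norm_mul, norm_neg, Complex.norm_cpow_eq_rpow_re_of_pos hy0]
      simp only [sub_re, neg_re, one_re]
      exact mul_le_mul_of_nonneg_left (Real.rpow_le_rpow_of_nonpos hNp hy.1 (by linarith)) (norm_nonneg _)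
  have h2 := (convex_Icc N (N+1)).norm_image_sub_le_of_norm_hasDerivWithin_le
      (f := fun x : ℝ => (x:ℂ) * ((s-1) * (N:ℂ)^(-s)) + (x:ℂ)^(1-s))
      (f' := fun x : ℝ => 1 * ((s-1) * (N:ℂ)^(-s)) + (1-s) * (x:ℂ)^(1-s-1)) (C := ‖s‖ * ‖s-1‖ * N^(-s.re-1)) (x := N) (y := N+1)
      (fun y hy => ?_) (fun y hy => ?_) ⟨le_rfl, by linarith⟩ ⟨by linarith, le_rfl⟩
  · have e : emT n s = (((N+1:ℝ):ℂ) * ((s-1) * (N:ℂ)^(-s)) + ((N+1:ℝ):ℂ)^(1-s)) - ((N:ℂ) * ((s-1) * (N:ℂ)^(-s)) + (N:ℂ)^(1-s)) := by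
      unfold emT
      rw [hN]; push_cast
      rw [show (n:ℂ)+1+1 = n+2 by ring]
      ring
    rw [e]
    simpa using h2
  · have hy0 : 0 < y := by linarith [hy.1]
    have h3 : HasDerivAt (fun x : ℝ => (x:ℂ)) 1 y := Complex.ofRealCLM.hasDerivAt
    exact ((h3.mul_const ((s-1) * (N:ℂ)^(-s))).fun_add (hasDerivAt_cpow_pos hy0 (1-s))).hasDerivWithinAt
  · have e : 1 * ((s-1) * (N:ℂ)^(-s)) + (1-s) * (y:ℂ)^(1-s-1) = -((s-1) * ((y:ℂ)^(-s) - (N:ℂ)^(-s))) := by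
      rw [show 1 - s - 1 = -s by ring]; ring
    rw [e, norm_neg, norm_mul]
    have h4 : ‖y - N‖ ≤ 1 := by rw [Real.norm_eq_abs, abs_le]; constructor <;> linarith [hy.1, hy.2]
    have h5 := h1 y hy
    have h6 : 0 ≤ ‖s‖ * N^(-s.re-1) := by positivity
    nlinarith [norm_nonneg (s-1), mul_le_mul_of_nonneg_left h4 h6]

lemma emT_diff (n : ℕ) : Differentiable ℂ (emT n) := by
  have h1 : ((n:ℂ)+1) ≠ 0 := by exact_mod_cast Nat.succ_ne_zero n
  have h2 : ((n:ℂ)+2) ≠ 0 := by exact_mod_cast Nat.succ_ne_zero (n+1)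
  unfold emT
  intro s
  refine DifferentiableAt.fun_add (DifferentiableAt.fun_mul (by fun_prop) ?_) (DifferentiableAt.fun_sub ?_ ?_)
  · exact DifferentiableAt.const_cpow (by fun_prop) (Or.inl h1)
  · exact DifferentiableAt.const_cpow (by fun_prop) (Or.inl h2)
  · exact DifferentiableAt.const_cpow (by fun_prop) (Or.inl h1)

lemma summable_shift {σ : ℝ} (hσ : 0 < σ) : Summable fun n : ℕ => ((n:ℝ)+1)^(-σ-1) := by
  have := (summable_nat_add_iff (f := fun n : ℕ => (n:ℝ)^(-σ-1)) 1).mpr (Real.summable_nat_rpow.mpr (by linarith))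
  simpa using this

lemma emT_sum_diff : DifferentiableOn ℂ (fun s => ∑' n, emT n s) {s | 0 < s.re} := by
  intro z (hz : 0 < z.re)
  obtain ⟨σ, h1, h2⟩ := exists_between hz
  set U : Set ℂ := {s | σ < s.re} ∩ Metric.ball 0 (‖z‖+1)
  have hU : IsOpen U := (isOpen_lt continuous_const continuous_re).inter Metric.isOpen_ball
  have : DifferentiableOn ℂ (fun s => ∑' n, emT n s) U := by
    refine differentiableOn_tsum_of_summable_norm (u := fun n : ℕ => (‖z‖+1)*(‖z‖+2) * ((n:ℝ)+1)^(-σ-1))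
      ((summable_shift h1).mul_left _) (fun n => (emT_diff n).differentiableOn) hU ?_
    intro n s hs
    have hs1 : σ < s.re := hs.1
    have hs2 : ‖s‖ ≤ ‖z‖+1 := (mem_ball_zero_iff.mp hs.2).le
    have hs3 : ‖s-1‖ ≤ ‖z‖+2 := (norm_sub_le _ _).trans (by rw [norm_one]; linarith)
    refine (emT_norm_le (by linarith)).trans ?_
    have : ((n:ℝ)+1)^(-s.re-1) ≤ ((n:ℝ)+1)^(-σ-1) := Real.rpow_le_rpow_of_exponent_le (by linarith [Nat.cast_nonneg (α := ℝ) n]) (by linarith)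
    gcongr
  exact (this.differentiableAt (hU.mem_nhds ⟨h2, by simp⟩)).differentiableWithinAt

lemma emT_sum_of_gt {s : ℂ} (hs : 1 < s.re) : HasSum (fun n => emT n s) (zeta1 s - 1) := by
  have hs1 : s ≠ 1 := by rintro rfl; simp at hs
  have h1 : HasSum (fun n : ℕ => (s-1) * ((n:ℂ)+1)^(-s)) ((s-1) * riemannZeta s) := by
    refine HasSum.mul_left _ ?_
    rw [zeta_eq_tsum_one_div_nat_add_one_cpow hs]
    have := (summable_nat_add_iff (f := fun n : ℕ => 1/(n:ℂ)^s) 1).mpr (Complex.summable_one_div_nat_cpow.mpr hs)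
    have h2 := this.hasSum
    push_cast at h2
    simpa [cpow_neg] using h2
  have hS : Summable (fun n => emT n s) := by
    refine Summable.of_norm_bounded ((summable_shift (by linarith : 0 < s.re)).mul_left (‖s‖*‖s-1‖)) (fun n => emT_norm_le (by linarith))
  have h2 : Summable (fun n : ℕ => (((n:ℂ)+2)^(1-s) - ((n:ℂ)+1)^(1-s))) := by
    have := hS.sub h1.summable
    refine this.congr (fun n => ?_)
    unfold emT; ring
  have h3 : HasSum (fun n : ℕ => (((n:ℂ)+2)^(1-s) - ((n:ℂ)+1)^(1-s))) (-1) := by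
    rw [h2.hasSum_iff_tendsto_nat]
    have e : ∀ n : ℕ, ∑ i ∈ Finset.range n, (((i:ℂ)+2)^(1-s) - ((i:ℂ)+1)^(1-s)) = ((n:ℂ)+1)^(1-s) - 1 := by
      intro n
      induction n with
      | zero => simp
      | succ k ih => rw [Finset.sum_range_succ, ih]; push_cast; rw [show (k:ℂ)+1+1 = k+2 by ring]; ring
    simp_rw [e]
    rw [show (-1:ℂ) = 0 - 1 by ring]
    refine Tendsto.sub_const ?_ _
    rw [tendsto_zero_iff_norm_tendsto_zero]
    have : ∀ n : ℕ, ‖((n:ℂ)+1)^(1-s)‖ = ((n:ℝ)+1)^(-(s.re-1)) := by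
      intro n
      have := Complex.norm_cpow_eq_rpow_re_of_pos (x := (n:ℝ)+1) (by positivity) (1-s)
      push_cast at this
      rw [this]; simp
    simp_rw [this]
    have h4 := (tendsto_rpow_neg_atTop (show 0 < s.re - 1 by linarith)).comp
      (tendsto_atTop_add_const_right atTop (1:ℝ) tendsto_natCast_atTop_atTop)
    exact h4
  have := h1.add h3
  rw [zeta1_of_ne hs1]
  exact this

lemma zeta1_eq {s : ℂ} (hs : 0 < s.re) : zeta1 s = 1 + ∑' n, emT n s := by
  have hopen : IsOpen {s : ℂ | 0 < s.re} := isOpen_lt continuous_const continuous_re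
  have hc : IsPreconnected {s : ℂ | 0 < s.re} := (convex_halfSpace_re_gt 0).isPreconnected
  have h1 : AnalyticOnNhd ℂ zeta1 {s : ℂ | 0 < s.re} := zeta1_diff.differentiableOn.analyticOnNhd hopen
  have h2 : AnalyticOnNhd ℂ (fun s => 1 + ∑' n, emT n s) {s : ℂ | 0 < s.re} :=
    ((differentiableOn_const _).fun_add emT_sum_diff).analyticOnNhd hopen
  refine h1.eqOn_of_preconnected_of_eventuallyEq h2 hc (z₀ := 2) (by simp) ?_ hs
  have : {s : ℂ | 1 < s.re} ∈ nhds (2:ℂ) := (isOpen_lt continuous_const continuous_re).mem_nhds (by simp)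
  filter_upwards [this] with z hz
  rw [(emT_sum_of_gt hz).tsum_eq]; ring

lemma zeta_growth : ∃ C : ℝ, 0 < C ∧ ∀ s : ℂ, 1/2 < s.re → s.re ≤ 4 → 1 ≤ s.im → ‖riemannZeta s‖ ≤ C * s.im^2 := by
  set S := ∑' n : ℕ, ((n:ℝ)+1)^(-(1/2:ℝ)-1)
  have hS0 : 0 ≤ S := tsum_nonneg fun n => by positivity
  refine ⟨1 + 30 * S, by positivity, fun s h1 h2 h3 => ?_⟩
  have hs1 : s ≠ 1 := by rintro rfl; norm_num at h3
  have hz := zeta1_eq (s := s) (by linarith)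
  have hn : ‖s‖ ≤ 5 * s.im := by
    refine (Complex.norm_le_abs_re_add_abs_im s).trans ?_
    rw [abs_of_pos (by linarith), abs_of_pos (by linarith)]; linarith
  have hn1 : ‖s - 1‖ ≤ 6 * s.im := (norm_sub_le _ _).trans (by rw [norm_one]; linarith)
  have hge : 1 ≤ ‖s - 1‖ := by
    refine le_trans ?_ (Complex.abs_im_le_norm _)
    simp; rw [abs_of_pos (by linarith)]; exact h3
  have hb : ‖∑' n, emT n s‖ ≤ 30 * s.im^2 * S := by
    refine tsum_of_norm_bounded ((summable_shift (by norm_num : (0:ℝ) < 1/2)).hasSum.mul_left (30 * s.im^2)) fun n => ?_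
    refine (emT_norm_le (by linarith)).trans ?_
    have : ((n:ℝ)+1)^(-s.re-1) ≤ ((n:ℝ)+1)^(-(1/2:ℝ)-1) := Real.rpow_le_rpow_of_exponent_le (by linarith [Nat.cast_nonneg (α := ℝ) n]) (by linarith)
    have h7 : ‖s‖ * ‖s-1‖ ≤ 30 * s.im^2 := by nlinarith [norm_nonneg s, norm_nonneg (s-1)]
    gcongr
  have h8 : ‖zeta1 s‖ ≤ 1 + 30 * s.im^2 * S := by
    rw [hz]; exact (norm_add_le _ _).trans (by rw [norm_one]; linarith)
  rw [zeta1_of_ne hs1, norm_mul] at h8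
  nlinarith [norm_nonneg (riemannZeta s), sq_nonneg s.im]

end Univ

namespace Univ

/-- iterated integrals starting from the logarithmic derivative -/
noncomputable def etaG : ℕ → ℂ → ℂ
  | 0 => fun s => -(deriv riemannZeta s / riemannZeta s)
  | k + 1 => fun s => ∫ α in Set.Ioi s.re, etaG k ((α : ℂ) + s.im * I)

/-- coefficients of the Dirichlet series -/
noncomputable def aC (k n : ℕ) : ℝ := ArithmeticFunction.vonMangoldt n / (Real.log n)^k

lemma aC_nonneg (k n : ℕ) : 0 ≤ aC k n :=
  div_nonneg ArithmeticFunction.vonMangoldt_nonneg (pow_nonneg (Real.log_natCast_nonneg n) k)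

lemma aC_of_lt {n : ℕ} (hn : n < 2) (k : ℕ) : aC k n = 0 := by
  unfold aC
  interval_cases n <;> simp

lemma half_le_log {n : ℕ} (hn : 2 ≤ n) : 1/2 ≤ Real.log n := by
  have h1 : Real.log 2 ≤ Real.log n := Real.log_le_log (by norm_num) (by exact_mod_cast hn)
  linarith [Real.log_two_gt_d9]

lemma aC_succ_le (k n : ℕ) : aC (k+1) n ≤ 2^k := by
  rcases lt_or_ge n 2 with h | h
  · rw [aC_of_lt h]; positivity
  · have hl := half_le_log h
    unfold aC
    rw [div_le_iff₀ (by positivity)]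
    have h1 : ArithmeticFunction.vonMangoldt n ≤ Real.log n := ArithmeticFunction.vonMangoldt_le_log
    have h2 : (1:ℝ) ≤ 2^k * (Real.log n)^k := by
      rw [← mul_pow]; exact one_le_pow₀ (by linarith)
    calc _ ≤ Real.log n := h1
      _ = 1 * Real.log n := (one_mul _).symm
      _ ≤ 2^k * (Real.log n)^k * Real.log n := by gcongr
      _ = _ := by ring

lemma aC_le_log (k n : ℕ) : aC k n ≤ 2^k * Real.log n := by
  rcases lt_or_ge n 2 with h | h
  · rw [aC_of_lt h]; have := Real.log_natCast_nonneg n; positivity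
  · cases k with
    | zero => unfold aC; simpa using ArithmeticFunction.vonMangoldt_le_log
    | succ k =>
      refine (aC_succ_le k n).trans ?_
      have := half_le_log h
      rw [pow_succ, mul_assoc]
      have h3 : (0:ℝ) < 2^k := by positivity
      nlinarith

lemma aC_summable (k : ℕ) {σ : ℝ} (hσ : 1 < σ) : Summable fun n : ℕ => aC k n * (n:ℝ)^(-σ) := by
  refine Summable.of_nonneg_of_le (fun n => mul_nonneg (aC_nonneg k n) (by positivity)) (fun n => ?_) ((summable_log hσ).mul_left (2^k))
  rw [← mul_assoc]
  exact mul_le_mul_of_nonneg_right (aC_le_log k n) (by positivity)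

lemma aC_succ (k n : ℕ) : aC (k+1) n = aC k n / Real.log n := by
  unfold aC; rw [pow_succ, div_div]

lemma cpow_exp {n : ℕ} (hn : 2 ≤ n) (α t : ℝ) :
    (n:ℂ)^(-((α:ℂ) + t * I)) = (n:ℂ)^(-(t*I)) * cexp (-(Real.log n : ℂ) * α) := by
  have h0 : (n:ℂ) ≠ 0 := by exact_mod_cast (by omega : n ≠ 0)
  rw [neg_add, cpow_add _ _ h0, mul_comm, cpow_def_of_ne_zero h0 (-(α:ℂ)), ← Complex.natCast_log]
  congr 2; ring

lemma int_cpow {n : ℕ} (hn : 2 ≤ n) (s : ℂ) :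
    ∫ α in Set.Ioi s.re, (n:ℂ)^(-((α:ℂ) + s.im * I)) = (n:ℂ)^(-s) / Real.log n := by
  have hl := half_le_log hn
  simp_rw [cpow_exp hn]
  rw [integral_const_mul, integral_exp_mul_complex_Ioi (by rw [neg_re, ofReal_re]; linarith)]
  have := cpow_exp hn s.re s.im
  rw [Complex.re_add_im] at this
  rw [this]
  rw [neg_div_neg_eq, mul_div_assoc]

lemma norm_ncpow {n : ℕ} (hn : 2 ≤ n) (α t : ℝ) :
    ‖(n:ℂ)^(-((α:ℂ) + t * I))‖ = Real.exp (-(Real.log n) * α) := by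
  rw [Complex.norm_natCast_cpow_of_pos (by omega)]
  rw [Real.rpow_def_of_pos (by positivity)]
  simp

lemma etaG_hasSum (k : ℕ) : ∀ {s : ℂ}, 1 < s.re → HasSum (fun n : ℕ => (aC k n : ℂ) * (n:ℂ)^(-s)) (etaG k s) := by
  induction k with
  | zero =>
    intro s hs
    have := vM_hasSum hs
    simpa [aC, etaG] using this
  | succ k ih =>
    intro s hs
    have h1 : HasSum (fun n : ℕ => ∫ α in Set.Ioi s.re, (aC k n : ℂ) * (n:ℂ)^(-((α:ℂ) + s.im * I)))
        (∫ α in Set.Ioi s.re, ∑' n : ℕ, (aC k n : ℂ) * (n:ℂ)^(-((α:ℂ) + s.im * I))) := by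
      refine hasSum_integral_of_summable_integral_norm (fun n => ?_) ?_
      · rcases lt_or_ge n 2 with h | h
        · simp [aC_of_lt h]
        · simp_rw [cpow_exp h]
          have hl := half_le_log h
          exact ((integrableOn_exp_mul_complex_Ioi (by rw [neg_re, ofReal_re]; linarith) _).const_mul _).const_mul _
      · refine Summable.congr (aC_summable (k+1) hs) fun n => ?_
        rcases lt_or_ge n 2 with h | h
        · simp [aC_of_lt h]
        · have hl := half_le_log h
          simp_rw [norm_mul, norm_ncpow h, Complex.norm_real, Real.norm_of_nonneg (aC_nonneg _ _)]
          rw [integral_const_mul, integral_exp_mul_Ioi (by linarith), aC_succ, Real.rpow_def_of_pos (by positivity), neg_div_neg_eq]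
          rw [show Real.log n * -s.re = -Real.log n * s.re by ring]
          ring
    have h2 : ∫ α in Set.Ioi s.re, ∑' n : ℕ, (aC k n : ℂ) * (n:ℂ)^(-((α:ℂ) + s.im * I)) = etaG (k+1) s := by
      show _ = ∫ α in Set.Ioi s.re, etaG k ((α : ℂ) + s.im * I)
      refine setIntegral_congr_fun measurableSet_Ioi fun α (hα : s.re < α) => ?_
      exact (ih (by simp; linarith)).tsum_eq
    rw [h2] at h1
    have e : (fun n : ℕ => ∫ α in Set.Ioi s.re, (aC k n : ℂ) * (n:ℂ)^(-((α:ℂ) + s.im * I))) = (fun n : ℕ => (aC (k+1) n : ℂ) * (n:ℂ)^(-s)) := by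
      funext n
      rcases lt_or_ge n 2 with h | h
      · simp [aC_of_lt h]
      · rw [integral_const_mul, int_cpow h, aC_succ]; push_cast; ring
    rwa [e] at h1

lemma etaG_decay (k : ℕ) : ∃ C : ℝ, 0 < C ∧ ∀ s : ℂ, 2 ≤ s.re → ‖etaG k s‖ ≤ C * Real.exp (-(1/2) * s.re) := by
  set S := ∑' n : ℕ, aC k n * (n:ℝ)^(-(2:ℝ))
  have hS : HasSum (fun n : ℕ => aC k n * (n:ℝ)^(-(2:ℝ))) S := (aC_summable k (by norm_num)).hasSum
  have hS0 : 0 ≤ S := tsum_nonneg fun n => mul_nonneg (aC_nonneg k n) (by positivity)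
  refine ⟨S * Real.exp 1 + 1, by positivity, fun s hs => ?_⟩
  have h : ‖etaG k s‖ ≤ Real.exp (-(1/2) * (s.re-2)) * S := by
    rw [← (etaG_hasSum k (by linarith : 1 < s.re)).tsum_eq]
    refine tsum_of_norm_bounded (hS.mul_left _) fun n => ?_
    rcases lt_or_ge n 2 with h | h
    · simp [aC_of_lt h]
    · have hl := half_le_log h
      refine (norm_coef_cpow (aC_nonneg k n) (by omega) le_rfl).trans ?_
      have e : (n:ℝ)^(-s.re) = (n:ℝ)^(-(s.re-2)) * (n:ℝ)^(-(2:ℝ)) := by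
        rw [← Real.rpow_add (by positivity)]; congr 1; ring
      have h2 : (n:ℝ)^(-(s.re-2)) ≤ Real.exp (-(1/2) * (s.re-2)) := by
        rw [Real.rpow_def_of_pos (by positivity)]
        apply Real.exp_le_exp.mpr
        nlinarith
      rw [e]
      have := aC_nonneg k n
      calc _ = (n:ℝ)^(-(s.re-2)) * (aC k n * (n:ℝ)^(-(2:ℝ))) := by ring
        _ ≤ _ := by gcongr
  have e : Real.exp (-(1/2) * (s.re-2)) = Real.exp 1 * Real.exp (-(1/2) * s.re) := by
    rw [← Real.exp_add]; congr 1; ring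
  rw [e] at h
  nlinarith [Real.exp_pos (-(1/2) * s.re)]

end Univ

namespace Univ

/-- quarter plane -/
def Uq : Set ℂ := {z | 1/2 < z.re ∧ 0 < z.im}

lemma Uq_open : IsOpen Uq :=
  (isOpen_lt continuous_const continuous_re).inter (isOpen_lt continuous_const continuous_im)

lemma Uq_convex : Convex ℝ Uq := (convex_halfSpace_re_gt _).inter (convex_halfSpace_im_gt _)

lemma strip_bound {g : ℂ → ℂ} (hg : ContinuousOn g Uq) {C : ℝ} (hC : 0 < C)
    (hd : ∀ s : ℂ, 2 ≤ s.re → ‖g s‖ ≤ C * Real.exp (-(1/2) * s.re)) {σ a b : ℝ} (hσ : 1/2 < σ) (ha : 0 < a) :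
    ∃ M : ℝ, 0 < M ∧ ∀ z : ℂ, σ ≤ z.re → a ≤ z.im → z.im ≤ b → ‖g z‖ ≤ M * Real.exp (-(1/2) * z.re) := by
  have hc : IsCompact (Set.Icc σ 2 ×ℂ Set.Icc a b) := isCompact_Icc.reProdIm isCompact_Icc
  have hsub : (Set.Icc σ 2 ×ℂ Set.Icc a b) ⊆ Uq := by
    intro z hz
    rw [mem_reProdIm] at hz
    exact ⟨by linarith [hz.1.1], by linarith [hz.2.1]⟩
  obtain ⟨M0, hM0⟩ := hc.exists_bound_of_continuousOn (hg.mono hsub)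
  refine ⟨|M0| * Real.exp 1 + C, by positivity, fun z h1 h2 h3 => ?_⟩
  have hp := Real.exp_pos (-(1/2) * z.re)
  rcases le_or_gt z.re 2 with h | h
  · have h4 := (hM0 z (mem_reProdIm.mpr ⟨⟨h1, h⟩, ⟨h2, h3⟩⟩)).trans (le_abs_self M0)
    have h5 : 1 ≤ Real.exp 1 * Real.exp (-(1/2) * z.re) := by
      rw [← Real.exp_add]; apply Real.one_le_exp; linarith
    nlinarith [abs_nonneg M0]
  · have := hd z h.le
    have : 0 ≤ |M0| * Real.exp 1 := by positivity
    nlinarith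

lemma shift_Ioi (h : ℝ → ℂ) (a : ℝ) : ∫ α in Set.Ioi a, h α = ∫ u in Set.Ioi (0:ℝ), h (a + u) := by
  have := (measurePreserving_add_left volume a).setIntegral_preimage_emb (measurableEmbedding_addLeft a) h (Set.Ioi a)
  rw [← this]; simp

lemma hasDerivAt_tail {g : ℂ → ℂ} (hg : DifferentiableOn ℂ g Uq) {C : ℝ} (hC : 0 < C)
    (hd : ∀ s : ℂ, 2 ≤ s.re → ‖g s‖ ≤ C * Real.exp (-(1/2) * s.re)) {s : ℂ} (hs : s ∈ Uq) :
    HasDerivAt (fun s : ℂ => ∫ α in Set.Ioi s.re, g ((α : ℂ) + s.im * I)) (-g s) s := by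
  have e : (fun s : ℂ => ∫ α in Set.Ioi s.re, g ((α : ℂ) + s.im * I)) = fun s : ℂ => ∫ u in Set.Ioi (0:ℝ), g (s + u) := by
    funext s
    rw [shift_Ioi]
    congr 1; funext u; congr 1
    conv_rhs => rw [← Complex.re_add_im s]
    push_cast; ring
  rw [e]
  obtain ⟨hs1, hs2⟩ := hs
  obtain ⟨r, hr0, hr1, hr2⟩ : ∃ r : ℝ, 0 < r ∧ 1/2 < s.re - 2*r ∧ 0 < s.im - 2*r := by
    refine ⟨min (s.re - 1/2) s.im / 4, ?_, ?_, ?_⟩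
    · have : 0 < min (s.re - 1/2) s.im := lt_min (by linarith) hs2
      linarith
    · have := min_le_left (s.re - 1/2) s.im; linarith
    · have := min_le_right (s.re - 1/2) s.im; linarith
  obtain ⟨M, hM0, hM⟩ := strip_bound hg.continuousOn hC hd (σ := s.re - 2*r) (a := s.im - 2*r) (b := s.im + 2*r) hr1 hr2
  have hmem : ∀ x ∈ Metric.closedBall s (2*r), ∀ u : ℝ, 0 ≤ u → x + u ∈ Uq ∧ ‖g (x + u)‖ ≤ M * Real.exp (-(1/2) * (s.re - 2*r)) * Real.exp (-(1/2) * u) := by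
    intro x hx u hu
    have h1 : ‖x - s‖ ≤ 2*r := by simpa [dist_eq_norm] using hx
    have h2 := abs_le.mp ((Complex.abs_re_le_norm _).trans h1)
    have h3 := abs_le.mp ((Complex.abs_im_le_norm _).trans h1)
    rw [sub_re] at h2; rw [sub_im] at h3
    have hre : (x + u).re = x.re + u := by simp
    have him : (x + u).im = x.im := by simp
    refine ⟨⟨by rw [hre]; linarith, by rw [him]; linarith⟩, ?_⟩
    refine (hM _ (by rw [hre]; linarith) (by rw [him]; linarith) (by rw [him]; linarith)).trans ?_
    rw [mul_assoc, ← Real.exp_add]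
    refine mul_le_mul_of_nonneg_left (Real.exp_le_exp.mpr ?_) hM0.le
    rw [hre]; linarith
  have hda : ∀ z ∈ Uq, HasDerivAt g (deriv g z) z := fun z hz => (hg.differentiableAt (Uq_open.mem_nhds hz)).hasDerivAt
  have hcont : ∀ x ∈ Metric.closedBall s (2*r), ContinuousOn (fun u : ℝ => g (x + u)) (Set.Ioi 0) := by
    intro x hx u hu
    have h1 : ContinuousAt g (x + u) := (hda _ (hmem x hx u (le_of_lt hu)).1).continuousAt
    have h2 : ContinuousAt (fun u : ℝ => x + (u:ℂ)) u := by fun_prop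
    exact (ContinuousAt.comp (f := fun u : ℝ => x + (u:ℂ)) h1 h2).continuousWithinAt
  have hgd : DifferentiableOn ℂ (deriv g) Uq := hg.deriv Uq_open
  have hItg : IntegrableOn (fun u : ℝ => Real.exp (-(1/2) * u)) (Set.Ioi 0) := exp_neg_integrableOn_Ioi 0 (by norm_num)
  have hss : s ∈ Metric.closedBall s (2*r) := Metric.mem_closedBall_self (by linarith)
  have key := hasDerivAt_integral_of_dominated_loc_of_deriv_le (μ := volume.restrict (Set.Ioi (0:ℝ)))
    (F := fun (x : ℂ) (u : ℝ) => g (x + u)) (F' := fun x u => deriv g (x + u)) (x₀ := s) (s := Metric.ball s r)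
    (bound := fun u => M * Real.exp (-(1/2) * (s.re - 2*r)) * Real.exp (-(1/2) * u) / r)
    (Metric.ball_mem_nhds s hr0) ?_ ?_ ?_ ?_ ?_ ?_
  · have h2 : ∫ u in Set.Ioi (0:ℝ), deriv g (s + u) = 0 - g (s + (0:ℝ)) := by
      refine integral_Ioi_of_hasDerivAt_of_tendsto' (f := fun u : ℝ => g (s + u)) (fun u (hu : 0 ≤ u) => ?_) key.1 ?_
      · have h5 : HasDerivAt (fun u : ℝ => s + (u:ℂ)) 1 u := HasDerivAt.const_add s (Complex.ofRealCLM.hasDerivAt (x := u))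
        have := HasDerivAt.comp (h := fun u : ℝ => s + (u:ℂ)) u (hda _ (hmem s hss u hu).1) h5
        rw [mul_one] at this
        exact this
      · refine squeeze_zero_norm' (a := fun u => M * Real.exp (-(1/2) * (s.re - 2*r)) * Real.exp (-(1/2) * u)) ?_ ?_
        · filter_upwards [eventually_ge_atTop 0] with u hu using (hmem s hss u hu).2
        · rw [← mul_zero (M * Real.exp (-(1/2) * (s.re - 2*r)))]
          refine Tendsto.const_mul _ (Real.tendsto_exp_atBot.comp ?_)
          exact tendsto_id.const_mul_atTop_of_neg (by norm_num)
    have h3 := key.2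
    rw [h2] at h3
    simpa using h3
  · filter_upwards [Metric.ball_mem_nhds s hr0] with x hx
    exact (hcont x (Metric.ball_subset_closedBall (Metric.ball_subset_ball (by linarith) hx))).aestronglyMeasurable measurableSet_Ioi
  · refine Integrable.mono' (hItg.const_mul (M * Real.exp (-(1/2) * (s.re - 2*r)))) ((hcont s hss).aestronglyMeasurable measurableSet_Ioi) ?_
    filter_upwards [ae_restrict_mem measurableSet_Ioi] with u hu
    exact (hmem s hss u (le_of_lt hu)).2
  · refine ContinuousOn.aestronglyMeasurable ?_ measurableSet_Ioi
    intro u hu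
    have h1 : ContinuousAt (deriv g) (s + u) := (hgd.differentiableAt (Uq_open.mem_nhds (hmem s hss u (le_of_lt hu)).1)).continuousAt
    have h2 : ContinuousAt (fun u : ℝ => s + (u:ℂ)) u := by fun_prop
    exact (ContinuousAt.comp (f := fun u : ℝ => s + (u:ℂ)) h1 h2).continuousWithinAt
  · filter_upwards [ae_restrict_mem measurableSet_Ioi] with u hu x hx
    have hsh : ∀ z ∈ Metric.closedBall (x + u) r, z - u ∈ Metric.closedBall s (2*r) := by
      intro z hz
      rw [Metric.mem_ball, dist_eq_norm] at hx
      rw [Metric.mem_closedBall, dist_eq_norm] at hz ⊢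
      calc ‖z - u - s‖ = ‖(z - (x + u)) + (x - s)‖ := by congr 1; ring
        _ ≤ ‖z - (x+u)‖ + ‖x - s‖ := norm_add_le _ _
        _ ≤ _ := by linarith
    refine Complex.norm_deriv_le_of_forall_mem_sphere_norm_le hr0 ?_ ?_
    · refine DifferentiableOn.diffContOnCl (hg.mono ?_)
      rw [closure_ball _ hr0.ne']
      intro z hz
      simpa using (hmem _ (hsh z hz) u (le_of_lt hu)).1
    · intro z hz
      simpa using (hmem _ (hsh z (Metric.sphere_subset_closedBall hz)) u (le_of_lt hu)).2
  · exact (hItg.const_mul _).div_const _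
  · filter_upwards [ae_restrict_mem measurableSet_Ioi] with u hu x hx
    exact (hda _ (hmem x (Metric.ball_subset_closedBall (Metric.ball_subset_ball (by linarith) hx)) u (le_of_lt hu)).1).comp_add_const x u

lemma etaG_diff (hRH : RiemannHypothesis) (k : ℕ) : DifferentiableOn ℂ (etaG k) Uq := by
  induction k with
  | zero =>
    have hz : DifferentiableOn ℂ riemannZeta Uq := fun s hs =>
      (differentiableAt_riemannZeta (by rintro rfl; exact absurd hs.2 (by simp))).differentiableWithinAt
    exact (DifferentiableOn.fun_div (hz.deriv Uq_open) hz (fun s hs => zeta_ne_zero hRH hs.1)).fun_neg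
  | succ k ih =>
    obtain ⟨C, hC, hd⟩ := etaG_decay k
    intro s hs
    exact (hasDerivAt_tail ih hC hd hs).differentiableAt.differentiableWithinAt

lemma etaG_deriv (hRH : RiemannHypothesis) (k : ℕ) {s : ℂ} (hs : s ∈ Uq) : HasDerivAt (etaG (k+1)) (-etaG k s) s := by
  obtain ⟨C, hC, hd⟩ := etaG_decay k
  exact hasDerivAt_tail (etaG_diff hRH k) hC hd hs

lemma zeta_exp (hRH : RiemannHypothesis) : ∃ c : ℝ, 0 < c ∧ ∀ s ∈ Uq, ‖riemannZeta s‖ = c * Real.exp (etaG 1 s).re := by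
  have hs0 : (2 + 2*I : ℂ) ∈ Uq := by constructor <;> simp <;> norm_num
  set h : ℂ → ℂ := fun s => riemannZeta s * cexp (-etaG 1 s)
  have hh : ∀ s ∈ Uq, HasDerivAt h 0 s := by
    intro s hs
    have h1 : HasDerivAt riemannZeta (deriv riemannZeta s) s :=
      (differentiableAt_riemannZeta (by rintro rfl; exact absurd hs.2 (by simp))).hasDerivAt
    have h2 := h1.fun_mul (etaG_deriv hRH 0 hs).fun_neg.cexp
    have := zeta_ne_zero hRH hs.1
    have e0 : etaG 0 s = -(deriv riemannZeta s / riemannZeta s) := rfl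
    have e1 : deriv riemannZeta s * cexp (-etaG (0 + 1) s) + riemannZeta s * (cexp (-etaG (0 + 1) s) * - -etaG 0 s) = 0 := by
      rw [e0]
      field_simp
      ring
    rw [e1] at h2
    exact h2
  have hconst : ∀ s ∈ Uq, h s = h (2+2*I) := fun s hs =>
    Uq_open.is_const_of_deriv_eq_zero Uq_convex.isPreconnected
      (fun z hz => (hh z hz).differentiableAt.differentiableWithinAt) (fun z hz => (hh z hz).deriv) hs hs0
  refine ⟨‖h (2+2*I)‖, ?_, fun s hs => ?_⟩
  · rw [norm_pos_iff]
    exact mul_ne_zero (zeta_ne_zero hRH hs0.1) (Complex.exp_ne_zero _)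
  · rw [← hconst s hs, norm_mul, Complex.norm_exp, mul_assoc, ← Real.exp_add]
    simp

lemma one_le_log {t : ℝ} (ht : 3 ≤ t) : 1 ≤ Real.log t := by
  rw [Real.le_log_iff_exp_le (by linarith)]
  linarith [Real.exp_one_lt_three]

lemma etaG_growth (hRH : RiemannHypothesis) (k : ℕ) : ∀ δ : ℝ, 0 < δ → ∃ C : ℝ, 0 < C ∧ ∀ s : ℂ, 1/2 + δ ≤ s.re → 3 ≤ s.im →
    ‖etaG (k+1) s‖ ≤ C * Real.log s.im := by
  induction k with
  | zero =>
    intro δ' hδ'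
    obtain ⟨δ, hδ0, hδ1, hδ2⟩ : ∃ δ : ℝ, 0 < δ ∧ δ ≤ 1 ∧ δ ≤ δ' := ⟨min δ' 1, lt_min hδ' one_pos, min_le_right _ _, min_le_left _ _⟩
    obtain ⟨D, hD0, hD⟩ := etaG_decay 1
    obtain ⟨c, hc0, hc⟩ := zeta_exp hRH
    obtain ⟨Z, hZ0, hZ⟩ := zeta_growth
    have hD' : ∀ s : ℂ, 2 ≤ s.re → ‖etaG 1 s‖ ≤ D := by
      intro s hs
      refine (hD s hs).trans ?_
      have : Real.exp (-(1/2) * s.re) ≤ 1 := Real.exp_le_one_iff.mpr (by linarith)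
      nlinarith
    set A := |Real.log Z - Real.log c| + 4
    have hA0 : 0 < A := by positivity
    refine ⟨6 * A / δ + 6 * D / δ + D, by positivity, fun s hs1' ht => ?_⟩
    have hs1 : 1/2 + δ ≤ s.re := by linarith
    have hl := one_le_log ht
    rcases le_or_gt 2 s.re with h2 | h2
    · refine (hD' s h2).trans ?_
      have : 0 < 6 * A / δ + 6 * D / δ := by positivity
      nlinarith
    set s0 : ℂ := 2 + s.im * I
    set R : ℝ := 3/2 - δ/2 with hR
    have hball : ∀ w ∈ Metric.ball (0:ℂ) R, s0 + w ∈ Uq ∧ (etaG 1 (s0 + w)).re ≤ A * Real.log s.im := by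
      intro w hw
      rw [mem_ball_zero_iff] at hw
      have h3 := abs_le.mp ((Complex.abs_re_le_norm w).trans hw.le)
      have h4 := abs_le.mp ((Complex.abs_im_le_norm w).trans hw.le)
      have hre : (s0 + w).re = 2 + w.re := by simp [s0]
      have him : (s0 + w).im = s.im + w.im := by simp [s0]
      have hU : s0 + w ∈ Uq := ⟨by rw [hre]; linarith, by rw [him]; linarith⟩
      refine ⟨hU, ?_⟩
      have h5 := hZ (s0 + w) (by rw [hre]; linarith) (by rw [hre]; linarith) (by rw [him]; linarith)
      rw [hc _ hU] at h5
      have h6 := Real.log_le_log (by positivity) h5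
      have hip : 0 < (s0+w).im := hU.2
      rw [Real.log_mul hc0.ne' (Real.exp_pos _).ne', Real.log_exp, Real.log_mul hZ0.ne' (by positivity), Real.log_pow] at h6
      have h7 : Real.log (s0+w).im ≤ 2 * Real.log s.im := by
        have : Real.log (s.im^2) = 2 * Real.log s.im := by rw [Real.log_pow]; norm_num
        rw [← this]
        apply Real.log_le_log hip
        rw [him]; nlinarith
      have h8 := le_abs_self (Real.log Z - Real.log c)
      have h9 := abs_nonneg (Real.log Z - Real.log c)
      push_cast at h6
      simp only [A]
      nlinarith
    have hw : ((s.re - 2 : ℝ) : ℂ) ∈ Metric.ball (0:ℂ) R := by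
      rw [mem_ball_zero_iff, Complex.norm_real, Real.norm_eq_abs, abs_lt]
      constructor <;> linarith
    have hBC := Complex.borelCaratheodory (f := fun w => etaG 1 (s0 + w)) (R := R) (M := A * Real.log s.im) (by positivity)
      ((etaG_diff hRH 1).comp (by fun_prop) (fun w hw => (hball w hw).1)) (fun w hw => (hball w hw).2) (by linarith) hw
    have e1 : s0 + ((s.re - 2 : ℝ) : ℂ) = s := by
      apply Complex.ext <;> simp [s0]
    have hn : ‖((s.re - 2 : ℝ) : ℂ)‖ = 2 - s.re := by
      rw [Complex.norm_real, Real.norm_eq_abs, abs_of_neg (by linarith)]; ring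
    rw [e1, add_zero, hn] at hBC
    have hd1 : δ/2 ≤ R - (2 - s.re) := by linarith
    have hd2 : ‖etaG 1 s0‖ ≤ D := hD' s0 (by simp [s0])
    refine hBC.trans ?_
    have t1 : 2 * (A * Real.log s.im) * (2 - s.re) / (R - (2 - s.re)) ≤ 6 * A / δ * Real.log s.im := by
      calc _ ≤ 2 * (A * Real.log s.im) * (3/2) / (δ/2) := by
            apply div_le_div₀ (by positivity) _ (by positivity) hd1
            apply mul_le_mul_of_nonneg_left (by linarith) (by positivity)
        _ = _ := by field_simp; ring
    have t2 : ‖etaG 1 s0‖ * (R + (2 - s.re)) / (R - (2 - s.re)) ≤ 6 * D / δ := by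
      calc _ ≤ D * 3 / (δ/2) := by
            apply div_le_div₀ (by positivity) _ (by positivity) hd1
            apply mul_le_mul hd2 (by linarith) (by linarith) hD0.le
        _ = _ := by field_simp; ring
    have : 0 < 6 * D / δ := by positivity
    nlinarith
  | succ k ih =>
    intro δ hδ
    obtain ⟨C, hC0, hC⟩ := ih δ hδ
    obtain ⟨D, hD0, hD⟩ := etaG_decay (k+1)
    refine ⟨2 * (C * Real.exp 1 + D), by positivity, fun s hs ht => ?_⟩
    have hl := one_le_log ht
    have hItg : IntegrableOn (fun u : ℝ => Real.exp (-(1/2) * u)) (Set.Ioi s.re) := exp_neg_integrableOn_Ioi _ (by norm_num)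
    have h1 : ‖etaG (k+2) s‖ ≤ ∫ u in Set.Ioi s.re, (C * Real.exp 1 + D) * Real.log s.im * Real.exp (-(1/2) * u) := by
      refine norm_integral_le_of_norm_le (hItg.const_mul _) ?_
      filter_upwards [ae_restrict_mem measurableSet_Ioi] with u (hu : s.re < u)
      have hre : ((u:ℂ) + s.im * I).re = u := by simp
      have him : ((u:ℂ) + s.im * I).im = s.im := by simp
      have hp := Real.exp_pos (-(1/2) * u)
      rcases le_or_gt u 2 with h | h
      · have h4 := hC ((u:ℂ) + s.im * I) (by rw [hre]; linarith) (by rw [him]; exact ht)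
        rw [him] at h4
        have h5 : 1 ≤ Real.exp 1 * Real.exp (-(1/2) * u) := by
          rw [← Real.exp_add]; apply Real.one_le_exp; linarith
        calc _ ≤ C * Real.log s.im * 1 + 0 := by linarith
          _ ≤ C * Real.log s.im * (Real.exp 1 * Real.exp (-(1/2) * u)) + D * Real.log s.im * Real.exp (-(1/2) * u) := by gcongr; positivity
          _ = _ := by ring
      · have h4 := hD ((u:ℂ) + s.im * I) (by rw [hre]; linarith)
        rw [hre] at h4
        calc _ ≤ 0 + D * 1 * Real.exp (-(1/2) * u) := by linarith
          _ ≤ C * Real.exp 1 * Real.log s.im * Real.exp (-(1/2) * u) + D * Real.log s.im * Real.exp (-(1/2) * u) := by gcongr; positivity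
          _ = _ := by ring
    rw [integral_const_mul, integral_exp_mul_Ioi (by norm_num)] at h1
    have h2 : Real.exp (-(1/2) * s.re) ≤ 1 := Real.exp_le_one_iff.mpr (by linarith)
    refine h1.trans ?_
    have h3 : -Real.exp (-(1/2) * s.re) / (-(1/2)) ≤ 2 := by
      rw [neg_div_neg_eq]; linarith
    calc _ ≤ (C * Real.exp 1 + D) * Real.log s.im * 2 := by gcongr
      _ = _ := by ring

end Univ

namespace Univ

lemma int_exp_le {l : ℝ} (hl : l ≠ 0) (U V : ℝ) : ‖∫ τ in U..V, cexp (l * I * τ)‖ ≤ 2 / |l| := by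
  have hc : (l * I : ℂ) ≠ 0 := mul_ne_zero (by exact_mod_cast hl) I_ne_zero
  rw [integral_exp_mul_complex hc, norm_div]
  have h1 : ‖(l * I : ℂ)‖ = |l| := by simp
  have h2 : ∀ x : ℝ, ‖cexp (l * I * x)‖ = 1 := by
    intro x
    have : (l * I * x : ℂ) = ((l * x : ℝ) : ℂ) * I := by push_cast; ring
    rw [this, Complex.norm_exp_ofReal_mul_I]
  rw [h1]
  refine div_le_div_of_nonneg_right ((norm_sub_le _ _).trans ?_) (abs_nonneg _)
  rw [h2, h2]; norm_num

lemma mv_general (S : Finset ℕ) (c : ℕ → ℂ) (l : ℕ → ℝ) {κ : ℝ} (hκ : 0 < κ)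
    (hsep : ∀ n ∈ S, ∀ m ∈ S, n ≠ m → κ ≤ |l n - l m|) {U V : ℝ} (hUV : U ≤ V) :
    ∫ τ in U..V, ‖∑ n ∈ S, c n * cexp (l n * I * τ)‖^2 ≤ (V - U) * ∑ n ∈ S, ‖c n‖^2 + 2/κ * (∑ n ∈ S, ‖c n‖)^2 := by
  have e1 : ∀ τ : ℝ, ((‖∑ n ∈ S, c n * cexp (l n * I * τ)‖^2 : ℝ) : ℂ) =
      ∑ n ∈ S, ∑ m ∈ S, c n * (starRingEnd ℂ (c m)) * cexp ((l n - l m : ℝ) * I * τ) := by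
    intro τ
    push_cast
    rw [← Complex.mul_conj', map_sum, Finset.sum_mul_sum]
    refine Finset.sum_congr rfl fun n _ => Finset.sum_congr rfl fun m _ => ?_
    rw [map_mul, ← Complex.exp_conj]
    simp only [map_mul, conj_ofReal, conj_I]
    rw [mul_mul_mul_comm, ← Complex.exp_add]
    congr 2; push_cast; ring
  have hcont : ∀ n m, Continuous fun τ : ℝ => c n * (starRingEnd ℂ (c m)) * cexp ((l n - l m : ℝ) * I * τ) := by
    intro n m; fun_prop
  have e2 : ((∫ τ in U..V, ‖∑ n ∈ S, c n * cexp (l n * I * τ)‖^2 : ℝ) : ℂ) =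
      ∑ n ∈ S, ∑ m ∈ S, c n * (starRingEnd ℂ (c m)) * ∫ τ in U..V, cexp ((l n - l m : ℝ) * I * τ) := by
    rw [← intervalIntegral.integral_ofReal]
    simp_rw [e1]
    rw [intervalIntegral.integral_finsetSum (fun n _ => (continuous_finset_sum _ fun m _ => hcont n m).intervalIntegrable _ _)]
    refine Finset.sum_congr rfl fun n _ => ?_
    rw [intervalIntegral.integral_finsetSum (fun m _ => (hcont n m).intervalIntegrable _ _)]
    refine Finset.sum_congr rfl fun m _ => ?_
    rw [intervalIntegral.integral_const_mul]
  have h0 : ∀ n ∈ S, ∀ m ∈ S, ‖c n * (starRingEnd ℂ (c m)) * ∫ τ in U..V, cexp ((l n - l m : ℝ) * I * τ)‖ ≤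
      (if n = m then (V-U) * ‖c n‖^2 else 0) + 2/κ * (‖c n‖ * ‖c m‖) := by
    intro n hn m hm
    rw [norm_mul, norm_mul, RCLike.norm_conj]
    split_ifs with h
    · subst h
      have : ‖∫ τ in U..V, cexp ((l n - l n : ℝ) * I * τ)‖ = V - U := by
        simp [abs_of_nonneg (sub_nonneg.mpr hUV), ← Complex.ofReal_sub]
      rw [this]
      have : 0 ≤ 2/κ * (‖c n‖ * ‖c n‖) := by positivity
      nlinarith
    · have hs := hsep n hn m hm h
      have h3 := int_exp_le (l := l n - l m) (by intro h0; rw [h0, abs_zero] at hs; linarith) U V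
      have h4 : 2 / |l n - l m| ≤ 2/κ := by gcongr
      rw [zero_add, mul_comm]
      exact mul_le_mul_of_nonneg_right (h3.trans h4) (by positivity)
  calc ∫ τ in U..V, ‖∑ n ∈ S, c n * cexp (l n * I * τ)‖^2
      ≤ ‖((∫ τ in U..V, ‖∑ n ∈ S, c n * cexp (l n * I * τ)‖^2 : ℝ) : ℂ)‖ := by
        rw [Complex.norm_real]; exact le_abs_self _
    _ ≤ ∑ n ∈ S, ∑ m ∈ S, ((if n = m then (V-U) * ‖c n‖^2 else 0) + 2/κ * (‖c n‖ * ‖c m‖)) := by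
        rw [e2]
        exact (norm_sum_le _ _).trans (Finset.sum_le_sum fun n hn => (norm_sum_le _ _).trans (Finset.sum_le_sum fun m hm => h0 n hn m hm))
    _ = _ := by
        simp_rw [Finset.sum_add_distrib, Finset.sum_ite_eq]
        rw [sq (∑ n ∈ S, ‖c n‖), Finset.sum_mul_sum, Finset.mul_sum, Finset.mul_sum]
        congr 1
        · exact Finset.sum_congr rfl fun n hn => by rw [if_pos hn]
        · exact Finset.sum_congr rfl fun n hn => by rw [Finset.mul_sum]

lemma hol_param {O : Set ℂ} (hO : IsOpen O) {F : ℂ → ℂ} (hF : DifferentiableOn ℂ F O) {a b : ℝ} (hab : a ≤ b)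
    {φ : ℝ → ℂ} (hφ : ContinuousOn φ (Set.Icc a b)) {z : ℂ} (hz : ∀ τ ∈ Set.Icc a b, z + τ * I ∈ O) :
    DifferentiableAt ℂ (fun z => ∫ τ in a..b, F (z + τ * I) * φ τ) z := by
  -- a tube around the segment
  have hKc : IsCompact ((fun τ : ℝ => z + τ * I) '' Set.Icc a b) := isCompact_Icc.image (by fun_prop)
  obtain ⟨r, hr0, hr⟩ := hKc.exists_cthickening_subset_open hO (by rintro _ ⟨τ, hτ, rfl⟩; exact hz τ hτ)
  have hmem : ∀ x ∈ Metric.closedBall z r, ∀ τ ∈ Set.Icc a b, x + τ * I ∈ O := by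
    intro x hx τ hτ
    apply hr
    refine Metric.mem_cthickening_of_dist_le _ (z + τ * I) _ _ ⟨τ, hτ, rfl⟩ ?_
    simpa [dist_eq_norm] using hx
  have hdc : ContinuousOn (deriv F) O := (hF.deriv hO).continuousOn
  have hK2 : IsCompact (Metric.closedBall z r ×ˢ Set.Icc a b) := (isCompact_closedBall z r).prod isCompact_Icc
  have hc2 : ContinuousOn (fun p : ℂ × ℝ => deriv F (p.1 + p.2 * I) * φ p.2) (Metric.closedBall z r ×ˢ Set.Icc a b) := by
    refine ContinuousOn.mul (hdc.comp (by fun_prop) fun p hp => hmem _ hp.1 _ hp.2) (hφ.comp (by fun_prop) fun p hp => hp.2)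
  obtain ⟨M, hM⟩ := hK2.exists_bound_of_continuousOn hc2
  have hc1 : ∀ x ∈ Metric.closedBall z r, ContinuousOn (fun τ : ℝ => F (x + τ * I) * φ τ) (Set.Icc a b) := by
    intro x hx
    exact (hF.continuousOn.comp (by fun_prop) fun τ hτ => hmem _ hx _ hτ).mul hφ
  have hzz : z ∈ Metric.closedBall z r := Metric.mem_closedBall_self hr0.le
  have hsub : Set.uIoc a b ⊆ Set.Icc a b := by rw [Set.uIoc_of_le hab]; exact Set.Ioc_subset_Icc_self
  have hui : Set.uIcc a b = Set.Icc a b := Set.uIcc_of_le hab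
  refine (intervalIntegral.hasDerivAt_integral_of_dominated_loc_of_deriv_le (F := fun x (τ:ℝ) => F (x + τ * I) * φ τ)
    (F' := fun x (τ:ℝ) => deriv F (x + τ * I) * φ τ) (bound := fun _ => M)
    (s := Metric.ball z r) (Metric.ball_mem_nhds z hr0) ?_ ?_ ?_ ?_ ?_ ?_).2.differentiableAt
  · filter_upwards [Metric.ball_mem_nhds z hr0] with x hx
    exact ((hc1 x (Metric.ball_subset_closedBall hx)).mono hsub).aestronglyMeasurable measurableSet_uIoc
  · exact ((hc1 z hzz).mono hui.le).intervalIntegrable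
  · refine (ContinuousOn.mono ?_ hsub).aestronglyMeasurable measurableSet_uIoc
    exact hc2.comp (f := fun τ : ℝ => (z, τ)) (by fun_prop) fun τ hτ => ⟨hzz, hτ⟩
  · exact Eventually.of_forall fun τ hτ x hx => hM (x, τ) ⟨Metric.ball_subset_closedBall hx, hsub hτ⟩
  · exact intervalIntegrable_const
  · refine Eventually.of_forall fun τ hτ x hx => ?_
    have := (hF.differentiableAt (hO.mem_nhds (hmem x (Metric.ball_subset_closedBall hx) τ (hsub hτ)))).hasDerivAt
    exact (this.comp_add_const x (τ * I)).mul_const _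

lemma convexity {O U : Set ℂ} (hO : IsOpen O) {F : ℂ → ℂ} (hF : DifferentiableOn ℂ F O) {a b : ℝ} (hab : a ≤ b)
    (hU : Bornology.IsBounded U) (hUO : ∀ z ∈ closure U, ∀ τ ∈ Set.Icc a b, z + τ * I ∈ O)
    {z₀ : ℂ} (hz₀ : z₀ ∈ U) {ω : ℂ → ℂ} (hω : Differentiable ℂ ω) (hω1 : ω z₀ = 1) {E : ℝ}
    (hE : ∀ z ∈ frontier U, ‖ω z‖^2 * ∫ τ in a..b, ‖F (z + τ * I)‖^2 ≤ E) :
    ∫ τ in a..b, ‖F (z₀ + τ * I)‖^2 ≤ E := by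
  have hFc : ∀ z ∈ closure U, ContinuousOn (fun τ : ℝ => F (z + τ * I)) (Set.Icc a b) := fun z hz =>
    hF.continuousOn.comp (by fun_prop) fun τ hτ => hUO z hz τ hτ
  have hz₀c := subset_closure hz₀
  set J := ∫ τ in a..b, ‖F (z₀ + τ * I)‖^2
  set φ : ℝ → ℂ := fun τ => starRingEnd ℂ (F (z₀ + τ * I))
  have hφ : ContinuousOn φ (Set.Icc a b) := Complex.continuous_conj.comp_continuousOn (hFc z₀ hz₀c)
  set f : ℂ → ℂ := fun z => ω z * ∫ τ in a..b, F (z + τ * I) * φ τ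
  have hd : ∀ z ∈ closure U, DifferentiableAt ℂ f z := fun z hz =>
    (hω z).fun_mul (hol_param hO hF hab hφ (hUO z hz))
  have hdc : DiffContOnCl ℂ f U := DifferentiableOn.diffContOnCl fun z hz => (hd z hz).differentiableWithinAt
  have hui : Set.uIcc a b = Set.Icc a b := Set.uIcc_of_le hab
  have hItg : ∀ z ∈ closure U, IntervalIntegrable (fun τ : ℝ => ‖F (z + τ * I)‖^2) volume a b := fun z hz =>
    ContinuousOn.intervalIntegrable (by rw [hui]; exact (hFc z hz).norm.pow 2)
  have hb : ∀ z ∈ frontier U, ‖f z‖ ≤ E/2 + J/2 := by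
    intro z hz
    have hzc := frontier_subset_closure hz
    have h1 : ‖f z‖ ≤ ∫ τ in a..b, (‖ω z‖^2/2 * ‖F (z + τ * I)‖^2 + ‖F (z₀ + τ * I)‖^2/2) := by
      simp only [f]
      rw [← intervalIntegral.integral_const_mul]
      refine intervalIntegral.norm_integral_le_of_norm_le hab ?_ (((hItg z hzc).const_mul _).add ((hItg z₀ hz₀c).div_const _))
      refine Eventually.of_forall fun τ _ => ?_
      rw [norm_mul, norm_mul, RCLike.norm_conj]
      nlinarith [sq_nonneg (‖ω z‖ * ‖F (z + τ * I)‖ - ‖F (z₀ + τ * I)‖)]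
    rw [intervalIntegral.integral_add ((hItg z hzc).const_mul _) ((hItg z₀ hz₀c).div_const _),
      intervalIntegral.integral_const_mul, intervalIntegral.integral_div] at h1
    have := hE z hz
    linarith
  have hm := Complex.norm_le_of_forall_mem_frontier_norm_le hU hdc hb hz₀c
  have hf0 : f z₀ = (J : ℂ) := by
    simp only [f, hω1, one_mul, J, φ]
    rw [← intervalIntegral.integral_ofReal]
    congr 1; funext τ
    rw [Complex.mul_conj']; push_cast; rfl
  rw [hf0, Complex.norm_real] at hm
  have := le_abs_self J
  rw [Real.norm_eq_abs] at hm
  linarith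

end Univ

namespace Univ

/-- partial sums of the Dirichlet series -/
noncomputable def Dp (k N : ℕ) (s : ℂ) : ℂ := ∑ n ∈ Finset.range N, (aC k n : ℂ) * (n:ℂ)^(-s)

lemma aC_cpow_diff (k n : ℕ) : Differentiable ℂ fun s : ℂ => (aC k n : ℂ) * (n:ℂ)^(-s) := by
  rcases lt_or_ge n 2 with h | h
  · simp [aC_of_lt h]
  · have h0 : (n:ℂ) ≠ 0 := by exact_mod_cast (by omega : n ≠ 0)
    intro s
    exact (DifferentiableAt.const_cpow (by fun_prop) (Or.inl h0)).const_mul _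

lemma Dp_diff (k N : ℕ) : Differentiable ℂ (Dp k N) := by
  unfold Dp
  exact Differentiable.fun_sum fun n _ => aC_cpow_diff k n

lemma log_sep {n m : ℕ} {X : ℝ} (hn : 1 ≤ n) (hm : 1 ≤ m) (hnX : (n:ℝ) ≤ X) (hmX : (m:ℝ) ≤ X) (h : n ≠ m) :
    1/X ≤ |-Real.log n - -Real.log m| := by
  have key : ∀ n m : ℕ, 1 ≤ n → 1 ≤ m → (n:ℝ) ≤ X → m < n → 1/X ≤ Real.log n - Real.log m := by
    intro n m hn hm hnX h
    have hn0 : (0:ℝ) < n := by exact_mod_cast hn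
    have hm0 : (0:ℝ) < m := by exact_mod_cast hm
    have h1 := Real.one_sub_inv_le_log_of_pos (x := (n:ℝ)/m) (by positivity)
    rw [Real.log_div hn0.ne' hm0.ne', inv_div] at h1
    refine le_trans ?_ h1
    have h2 : (m:ℝ) + 1 ≤ n := by exact_mod_cast h
    calc 1/X ≤ 1/(n:ℝ) := by gcongr
      _ ≤ _ := by rw [div_le_iff₀ hn0]; field_simp; linarith
  rcases lt_or_gt_of_ne h with h | h
  · refine (key m n hm hn hmX h).trans ?_
    exact le_trans (by linarith) (le_abs_self _)
  · refine (key n m hn hm hnX h).trans ?_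
    rw [abs_sub_comm]
    exact le_trans (by linarith) (le_abs_self _)

lemma cpow_split {n : ℕ} (hn : 1 ≤ n) (z : ℂ) (τ : ℝ) :
    (n:ℂ)^(-(z + τ * I)) = (n:ℂ)^(-z) * cexp ((-Real.log n : ℝ) * I * τ) := by
  have h0 : (n:ℂ) ≠ 0 := by exact_mod_cast (by omega : n ≠ 0)
  rw [neg_add, cpow_add _ _ h0, cpow_def_of_ne_zero h0 (-(τ * I)), ← Complex.natCast_log]
  congr 2; push_cast; ring

lemma dir_mv (S : Finset ℕ) {X : ℝ} (hX : 0 < X) (hS : ∀ n ∈ S, 1 ≤ n ∧ (n:ℝ) ≤ X) {b : ℕ → ℝ} (hb : ∀ n, 0 ≤ b n)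
    {σ : ℝ} (hσ : 0 ≤ σ) {z : ℂ} (hz : σ ≤ z.re) {U V : ℝ} (hUV : U ≤ V) :
    ∫ τ in U..V, ‖∑ n ∈ S, (b n : ℂ) * (n:ℂ)^(-(z + τ * I))‖^2 ≤
      (V - U) * ∑ n ∈ S, (b n)^2 * (n:ℝ)^(-(2*σ)) + 2 * X * (∑ n ∈ S, b n)^2 := by
  have e : ∀ τ : ℝ, ∑ n ∈ S, (b n : ℂ) * (n:ℂ)^(-(z + τ * I)) = ∑ n ∈ S, ((b n : ℂ) * (n:ℂ)^(-z)) * cexp ((-Real.log n : ℝ) * I * τ) := by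
    intro τ
    refine Finset.sum_congr rfl fun n hn => ?_
    rw [cpow_split (hS n hn).1]; ring
  simp_rw [e]
  refine (mv_general S _ (fun n => -Real.log n) (κ := 1/X) (by positivity)
    (fun n hn m hm h => log_sep (hS n hn).1 (hS m hm).1 (hS n hn).2 (hS m hm).2 h) hUV).trans ?_
  have hnorm : ∀ n ∈ S, ‖(b n : ℂ) * (n:ℂ)^(-z)‖ ≤ b n * (n:ℝ)^(-σ) := fun n hn =>
    norm_coef_cpow (hb n) (fun h => by have := (hS n hn).1; omega) hz
  have hle1 : ∀ n ∈ S, (n:ℝ)^(-σ) ≤ 1 := fun n hn =>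
    Real.rpow_le_one_of_one_le_of_nonpos (by exact_mod_cast (hS n hn).1) (by linarith)
  have h1 : ∑ n ∈ S, ‖(b n : ℂ) * (n:ℂ)^(-z)‖^2 ≤ ∑ n ∈ S, (b n)^2 * (n:ℝ)^(-(2*σ)) := by
    refine Finset.sum_le_sum fun n hn => ?_
    refine (pow_le_pow_left₀ (norm_nonneg _) (hnorm n hn) 2).trans (le_of_eq ?_)
    rw [mul_pow, ← Real.rpow_natCast ((n:ℝ)^(-σ)), ← Real.rpow_mul (by positivity)]
    congr 2; push_cast; ring
  have h2 : ∑ n ∈ S, ‖(b n : ℂ) * (n:ℂ)^(-z)‖ ≤ ∑ n ∈ S, b n := by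
    refine Finset.sum_le_sum fun n hn => (hnorm n hn).trans ?_
    have := hle1 n hn; have := hb n; nlinarith
  have e2 : 2 / (1/X) = 2 * X := by field_simp
  rw [e2]
  have h3 : 0 ≤ V - U := by linarith
  gcongr

lemma Dp_eq (k N : ℕ) (s : ℂ) : Dp k N s = ∑ n ∈ Finset.Ico 2 N, (aC k n : ℂ) * (n:ℂ)^(-s) := by
  unfold Dp
  symm
  refine Finset.sum_subset (fun n hn => ?_) (fun n hn h => ?_)
  · rw [Finset.mem_Ico] at hn; exact Finset.mem_range.mpr hn.2
  · rw [Finset.mem_range] at hn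
    rw [Finset.mem_Ico] at h
    rw [aC_of_lt (by omega)]; simp

lemma Dp_sub {k N X : ℕ} (h : N ≤ X) (s : ℂ) : Dp k X s - Dp k N s = ∑ n ∈ Finset.Ico N X, (aC k n : ℂ) * (n:ℂ)^(-s) := by
  unfold Dp
  rw [Finset.sum_Ico_eq_sub _ h]

lemma sumsq_summable {σ : ℝ} (hσ : 1/2 < σ) : Summable fun n : ℕ => (n:ℝ)^(-(2*σ)) :=
  Real.summable_nat_rpow.mpr (by linarith)

/-- mean square of a block of the Dirichlet polynomial -/
lemma block_mv (k : ℕ) {N X : ℕ} (hN : 1 ≤ N) (hNX : N ≤ X) {σ : ℝ} (hσ : 1/2 < σ) {z : ℂ} (hz : σ ≤ z.re) {U V : ℝ} (hUV : U ≤ V) :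
    ∫ τ in U..V, ‖∑ n ∈ Finset.Ico N X, (aC (k+1) n : ℂ) * (n:ℂ)^(-(z + τ * I))‖^2 ≤
      (V - U) * ((2^k)^2 * ∑' n : ℕ, ((n + N : ℕ):ℝ)^(-(2*σ))) + 2 * (2^k)^2 * (X:ℝ)^3 := by
  have hX0 : (0:ℝ) < X := by exact_mod_cast (by omega : 0 < X)
  refine (dir_mv (Finset.Ico N X) (X := X) hX0 (fun n hn => ?_) (fun n => aC_nonneg (k+1) n) (by linarith) hz hUV).trans ?_
  · rw [Finset.mem_Ico] at hn
    exact ⟨by omega, by exact_mod_cast hn.2.le⟩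
  have hA : ∀ n, aC (k+1) n ≤ 2^k := aC_succ_le k
  have h1 : ∑ n ∈ Finset.Ico N X, (aC (k+1) n)^2 * (n:ℝ)^(-(2*σ)) ≤ (2^k)^2 * ∑' n : ℕ, ((n + N : ℕ):ℝ)^(-(2*σ)) := by
    calc _ ≤ ∑ n ∈ Finset.Ico N X, (2^k)^2 * (n:ℝ)^(-(2*σ)) := by
          refine Finset.sum_le_sum fun n _ => ?_
          have := aC_nonneg (k+1) n
          have := hA n
          gcongr
      _ = (2^k)^2 * ∑ n ∈ Finset.range (X - N), ((n + N : ℕ):ℝ)^(-(2*σ)) := by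
          rw [← Finset.mul_sum, Finset.sum_Ico_eq_sum_range]
          simp_rw [add_comm N]
      _ ≤ _ := by
          have hs := (summable_nat_add_iff (f := fun n : ℕ => (n:ℝ)^(-(2*σ))) N).mpr (sumsq_summable hσ)
          refine mul_le_mul_of_nonneg_left ?_ (by positivity)
          exact hs.sum_le_tsum _ fun n _ => by positivity
  have h2 : ∑ n ∈ Finset.Ico N X, aC (k+1) n ≤ 2^k * X := by
    calc _ ≤ ∑ n ∈ Finset.Ico N X, (2^k : ℝ) := Finset.sum_le_sum fun n _ => hA n
      _ = (X - N : ℕ) * 2^k := by simp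
      _ ≤ X * 2^k := by gcongr; omega
      _ = _ := by ring
  have h3 : 0 ≤ V - U := by linarith
  have h4 : 0 ≤ ∑ n ∈ Finset.Ico N X, aC (k+1) n := Finset.sum_nonneg fun n _ => aC_nonneg _ n
  calc _ ≤ (V - U) * ((2^k)^2 * ∑' n : ℕ, ((n + N : ℕ):ℝ)^(-(2*σ))) + 2 * X * (2^k * X)^2 := by gcongr
    _ = _ := by ring

/-- trivial bound -/
lemma Dp_norm_le (k X : ℕ) {z : ℂ} (hz : 0 ≤ z.re) : ‖Dp (k+1) X z‖ ≤ 2^k * X := by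
  unfold Dp
  refine (norm_sum_le _ _).trans ?_
  calc _ ≤ ∑ n ∈ Finset.range X, (2^k : ℝ) := by
        refine Finset.sum_le_sum fun n _ => ?_
        rcases lt_or_ge n 2 with h | h
        · rw [aC_of_lt h]; simp
        · refine (norm_coef_cpow (aC_nonneg _ n) (by omega) hz).trans ?_
          simp [aC_succ_le]
    _ = _ := by simp; ring

/-- far to the right -/
lemma tail_right (k X : ℕ) (hX : 1 ≤ X) {z : ℂ} (hz : z.re = 3) :
    ‖etaG (k+1) z - Dp (k+1) X z‖ ≤ 2^k * (X:ℝ)^(-(3/2:ℝ)) * ∑' n : ℕ, (n:ℝ)^(-(3/2:ℝ)) := by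
  have h := etaG_hasSum (k+1) (s := z) (by rw [hz]; norm_num)
  have hX0 : (0:ℝ) < X := by exact_mod_cast hX
  have h1 := (hasSum_nat_add_iff' X).mpr h
  have e : etaG (k+1) z - Dp (k+1) X z = ∑' n : ℕ, (aC (k+1) (n+X) : ℂ) * ((n+X:ℕ):ℂ)^(-z) := h1.tsum_eq.symm
  rw [e]
  have hs : Summable fun n : ℕ => (n:ℝ)^(-(3/2:ℝ)) := Real.summable_nat_rpow.mpr (by norm_num)
  have hs' := (summable_nat_add_iff X).mpr hs
  have h2 : ‖∑' n : ℕ, (aC (k+1) (n+X) : ℂ) * ((n+X:ℕ):ℂ)^(-z)‖ ≤ 2^k * (X:ℝ)^(-(3/2:ℝ)) * ∑' n : ℕ, ((n+X:ℕ):ℝ)^(-(3/2:ℝ)) := by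
    refine tsum_of_norm_bounded (hs'.hasSum.mul_left _) fun n => ?_
    refine (norm_coef_cpow (σ := 3) (aC_nonneg _ _) (by omega) hz.ge).trans ?_
    have hp : (0:ℝ) < ((n+X:ℕ):ℝ) := by exact_mod_cast (by omega : 0 < n + X)
    have e3 : ((n+X:ℕ):ℝ)^(-(3:ℝ)) = ((n+X:ℕ):ℝ)^(-(3/2:ℝ)) * ((n+X:ℕ):ℝ)^(-(3/2:ℝ)) := by
      rw [← Real.rpow_add hp]; norm_num
    have h4 : ((n+X:ℕ):ℝ)^(-(3/2:ℝ)) ≤ (X:ℝ)^(-(3/2:ℝ)) :=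
      Real.rpow_le_rpow_of_nonpos hX0 (by exact_mod_cast (by omega : X ≤ n + X)) (by norm_num)
    have h5 := aC_succ_le k (n+X)
    rw [e3, ← mul_assoc]
    gcongr
  refine h2.trans (mul_le_mul_of_nonneg_left ?_ (by positivity))
  have := hs.sum_add_tsum_nat_add X
  have h0 : 0 ≤ ∑ n ∈ Finset.range X, (n:ℝ)^(-(3/2:ℝ)) := Finset.sum_nonneg fun n _ => by positivity
  linarith

end Univ

namespace Univ

/-- length of the Dirichlet polynomial -/
noncomputable def XT (T : ℝ) : ℕ := ⌈Real.exp (Real.log T / 8)⌉₊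

lemma XT_ge (T : ℝ) : Real.exp (Real.log T / 8) ≤ XT T := Nat.le_ceil _

lemma XT_le {T : ℝ} (hT : 1 ≤ T) : (XT T : ℝ) ≤ 2 * Real.exp (Real.log T / 8) := by
  have h1 : 1 ≤ Real.exp (Real.log T / 8) := Real.one_le_exp (by have := Real.log_nonneg hT; linarith)
  have := Nat.ceil_lt_add_one (Real.exp_pos (Real.log T / 8)).le
  unfold XT; linarith

lemma XT_cube {T : ℝ} (hT : 1 ≤ T) : (XT T : ℝ)^3 ≤ 8 * Real.exp (3 * (Real.log T / 8)) := by
  have h := pow_le_pow_left₀ (Nat.cast_nonneg _) (XT_le hT) 3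
  refine h.trans (le_of_eq ?_)
  rw [mul_pow, ← Real.exp_nat_mul]; norm_num

lemma norm_omega (z s : ℂ) (L : ℝ) : ‖cexp ((z - s)^2 + (L/2 : ℝ) * (z - s))‖^2 =
    Real.exp (2 * (z.re - s.re)^2 - 2 * (z.im - s.im)^2 + L * (z.re - s.re)) := by
  rw [Complex.norm_exp, ← Real.exp_nat_mul]
  congr 1
  simp [sq]; ring

lemma integral_sq_le {f : ℝ → ℂ} {a b M : ℝ} (hab : a ≤ b) (h : ∀ τ ∈ Set.Icc a b, ‖f τ‖ ≤ M) :
    ∫ τ in a..b, ‖f τ‖^2 ≤ (b - a) * M^2 := by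
  have := intervalIntegral.norm_integral_le_of_norm_le_const (f := fun τ => ‖f τ‖^2) (a := a) (b := b) (C := M^2) ?_
  · rw [abs_of_nonneg (by linarith)] at this
    refine (le_abs_self _).trans (this.trans (le_of_eq (mul_comm _ _)))
  · intro τ hτ
    rw [Set.uIoc_of_le hab] at hτ
    rw [Real.norm_of_nonneg (by positivity)]
    exact pow_le_pow_left₀ (norm_nonneg _) (h τ ⟨hτ.1.le, hτ.2⟩) 2

lemma aux_c {c l : ℝ} (hc : c ≤ 8) (hl : 0 ≤ l) : c * (l / 8) ≤ l := by nlinarith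
lemma aux_T {T : ℝ} (hT : 40 ≤ T) : 3 * T ≤ T^2 := by nlinarith
lemma aux_T2 {T : ℝ} (hT : 40 ≤ T) : 40 * T ≤ T^2 := by nlinarith
lemma aux_nine {x : ℝ} (h : -3 ≤ x) (h' : x ≤ 3) : x^2 ≤ 9 := by nlinarith
lemma aux_one {x : ℝ} (h : -1 ≤ x) (h' : x ≤ 1) : x^2 ≤ 1 := by nlinarith
lemma aux_L {l x T : ℝ} (hl : 0 < l) (h : l ≤ T) (h' : x ≤ 3) : l * x ≤ 3 * T := by nlinarith
lemma aux_sq {a b c : ℝ} (hc : 0 ≤ c) (h : c ≤ a + b) : c^2 ≤ 2 * a^2 + 2 * b^2 := by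
  nlinarith [sq_nonneg (a - b)]
lemma aux_A {a x T : ℝ} (ha : 0 ≤ a) (h : x ≤ 8 * T) : 2 * a * x ≤ 16 * a * T := by nlinarith
lemma aux_sq4 {a b : ℝ} (ha : 0 ≤ a) (h : a ≤ 2 * b) : a^2 ≤ 4 * b^2 := by nlinarith

set_option maxHeartbeats 4000000 in
lemma eta_DX (hRH : RiemannHypothesis) (k : ℕ) {σ₀ B : ℝ} (hσ : 1/2 < σ₀) (hσ1 : σ₀ ≤ 1) (hB : 0 ≤ B) :
    ∃ c₁ c₂ c₃ T₁ : ℝ, ∀ T ≥ T₁, ∀ s : ℂ, σ₀ ≤ s.re → s.re ≤ 1 → |s.im| ≤ B →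
      ∫ τ in T..(2*T), ‖etaG (k+1) (s + τ * I) - Dp (k+1) (XT T) (s + τ * I)‖^2 ≤
        T * (c₁ * ((Real.log T)^2 * Real.exp (-((σ₀ - 1/2)/16 * Real.log T))) + c₂ * Real.exp (-(Real.log T / 16)) + c₃ * (T^2 * Real.exp (-T))) := by
  set δ := (σ₀ - 1/2)/2 with hδ
  have hδ0 : 0 < δ := by linarith
  obtain ⟨C, hC0, hC⟩ := etaG_growth hRH k δ hδ0
  set σ₁ := 1/2 + δ with hσ₁
  set A : ℝ := 2^k with hA
  have hA0 : 0 < A := by positivity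
  set S₁ : ℝ := ∑' n : ℕ, ((n + 1 : ℕ):ℝ)^(-(2*σ₁)) with hS₁
  have hS₁0 : 0 ≤ S₁ := tsum_nonneg fun n => by positivity
  set S₂ : ℝ := ∑' n : ℕ, (n:ℝ)^(-(3/2:ℝ)) with hS₂
  have hS₂0 : 0 ≤ S₂ := tsum_nonneg fun n => by positivity
  set Q := 2*C^2 + 2*A^2*S₁ + 32*A^2 with hQ
  have hQ0 : 0 < Q := by positivity
  refine ⟨4 * Real.exp 2 * Q, Real.exp 18 * (A*S₂)^2, Real.exp 18 * (3*C+2*A)^2, 40 + 8 * B, fun T hT s hs1 hs2 hs3 => ?_⟩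
  have hT40 : 40 ≤ T := by linarith
  have hTB : 8 * B ≤ T := by linarith
  obtain ⟨hs4, hs5⟩ := abs_le.mp hs3
  set X := XT T
  set L := Real.log T / 8 with hL
  have hlT : 1 ≤ Real.log T := one_le_log (by linarith)
  have hL0 : 0 < L := by linarith
  have hlogT : Real.log T ≤ T := (Real.log_le_sub_one_of_pos (by linarith)).trans (by linarith)
  have hXge : Real.exp L ≤ X := XT_ge T
  have hX1 : 1 ≤ X := by
    have : (1:ℝ) ≤ X := (Real.one_le_exp hL0.le).trans hXge
    exact_mod_cast this
  have hXle : (X:ℝ) ≤ 2 * Real.exp L := XT_le (by linarith)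
  have hexpT : ∀ c ≤ 8, 0 ≤ c → Real.exp (c * L) ≤ T := by
    intro c hc hc0
    calc Real.exp (c * L) ≤ Real.exp (Real.log T) := by
          apply Real.exp_le_exp.mpr; rw [hL]; exact aux_c hc (by linarith)
      _ = T := Real.exp_log (by linarith)
  have hX3 : (X:ℝ)^3 ≤ 8 * T := (XT_cube (by linarith)).trans (by have := hexpT 3 (by norm_num) (by norm_num); linarith)
  have hXT : (X:ℝ) ≤ 2 * T := by have := hexpT 1 (by norm_num) (by norm_num); rw [one_mul] at this; linarith
  set ℓ := Real.log (3*T) with hℓ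
  have hℓ1 : 1 ≤ ℓ := one_le_log (by linarith)
  have hℓ2 : ℓ ≤ 2 * Real.log T := by
    have : Real.log (T^2) = 2 * Real.log T := by rw [Real.log_pow]; norm_num
    rw [← this]; apply Real.log_le_log (by linarith); exact aux_T hT40
  set F : ℂ → ℂ := fun z => etaG (k+1) z - Dp (k+1) X z with hF
  have hFd : DifferentiableOn ℂ F Uq := (etaG_diff hRH (k+1)).fun_sub (Dp_diff _ _).differentiableOn
  set U : Set ℂ := Set.Ioo σ₁ 3 ×ℂ Set.Ioo (s.im - T/4) (s.im + T/4) with hU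
  have hclos : closure U = Set.Icc σ₁ 3 ×ℂ Set.Icc (s.im - T/4) (s.im + T/4) := by
    rw [hU, closure_reProdIm, closure_Ioo (by linarith), closure_Ioo (by linarith)]
  have hfront : frontier U = (Set.Icc σ₁ 3 ×ℂ {s.im - T/4, s.im + T/4}) ∪ ({σ₁, 3} ×ℂ Set.Icc (s.im - T/4) (s.im + T/4)) := by
    rw [hU, frontier_reProdIm, closure_Ioo (by linarith), closure_Ioo (by linarith), frontier_Ioo (by linarith), frontier_Ioo (by linarith)]
  have hre : ∀ (z : ℂ) (τ : ℝ), (z + τ * I).re = z.re := by intro z τ; simp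
  have him : ∀ (z : ℂ) (τ : ℝ), (z + τ * I).im = z.im + τ := by intro z τ; simp
  have hpt : ∀ z : ℂ, σ₁ ≤ z.re → s.im - T/4 ≤ z.im → z.im ≤ s.im + T/4 → ∀ τ ∈ Set.Icc T (2*T),
      z + τ * I ∈ Uq ∧ ‖etaG (k+1) (z + τ * I)‖ ≤ C * ℓ := by
    intro z h1 h2 h3 τ hτ
    have hτ1 := hτ.1
    have hτ2 := hτ.2
    refine ⟨⟨by rw [hre]; linarith, by rw [him]; linarith⟩, ?_⟩
    refine (hC _ (by rw [hre]; exact h1) (by rw [him]; linarith)).trans ?_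
    refine mul_le_mul_of_nonneg_left ?_ hC0.le
    apply Real.log_le_log (by rw [him]; linarith)
    rw [him]; linarith
  refine convexity Uq_open hFd (by linarith : T ≤ 2*T) (U := U) ?_ ?_ (z₀ := s) ?_
    (ω := fun z => cexp ((z - s)^2 + (L/2 : ℝ) * (z - s))) (by fun_prop) (by simp) ?_
  · exact (Metric.isBounded_Ioo _ _).reProdIm (Metric.isBounded_Ioo _ _)
  · intro z hz τ hτ
    rw [hclos, mem_reProdIm] at hz
    exact (hpt z hz.1.1 hz.2.1 hz.2.2 τ hτ).1
  · rw [hU, mem_reProdIm]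
    exact ⟨⟨by linarith, by linarith⟩, ⟨by linarith, by linarith⟩⟩
  · intro z hz
    rw [norm_omega]
    have E1 : 0 ≤ 4 * Real.exp 2 * Q * ((Real.log T)^2 * Real.exp (-((σ₀ - 1/2)/16 * Real.log T))) := by positivity
    have E2 : 0 ≤ Real.exp 18 * (A*S₂)^2 * Real.exp (-(Real.log T / 16)) := by positivity
    have E3 : 0 ≤ Real.exp 18 * (3*C+2*A)^2 * (T^2 * Real.exp (-T)) := by positivity
    have h2TT : 2 * T - T = T := by ring
    rw [hfront] at hz
    rcases hz with hz | hz
    · -- horizontal sides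
      rw [mem_reProdIm] at hz
      obtain ⟨⟨hz1, hz2⟩, hz3⟩ := hz
      have hy2 : (z.im - s.im)^2 = T^2/16 := by
        rcases hz3 with h | h
        · rw [h]; ring
        · rw [Set.mem_singleton_iff.mp h]; ring
      have hzi : s.im - T/4 ≤ z.im ∧ z.im ≤ s.im + T/4 := by
        rcases hz3 with h | h
        · rw [h]; constructor <;> linarith
        · rw [Set.mem_singleton_iff.mp h]; constructor <;> linarith
      have hI : ∫ τ in T..(2*T), ‖F (z + τ * I)‖^2 ≤ (2*T - T) * ((3*C+2*A)*T)^2 := by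
        refine integral_sq_le (by linarith) fun τ hτ => ?_
        have h1 := (hpt z hz1 hzi.1 hzi.2 τ hτ).2
        have h2 := Dp_norm_le k X (z := z + τ * I) (by rw [hre]; linarith)
        refine (norm_sub_le _ _).trans ?_
        have h3 : ℓ ≤ 3 * T := (Real.log_le_sub_one_of_pos (by linarith)).trans (by linarith)
        have h4 := mul_le_mul_of_nonneg_left h3 hC0.le
        have h5 := mul_le_mul_of_nonneg_left hXT hA0.le
        rw [← hA] at h2
        linarith
      rw [h2TT] at hI
      have hw : Real.exp (2 * (z.re - s.re)^2 - 2 * (z.im - s.im)^2 + L * (z.re - s.re)) ≤ Real.exp 18 * Real.exp (-T) := by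
        rw [← Real.exp_add]
        apply Real.exp_le_exp.mpr
        rw [hy2]
        have h1 : (z.re - s.re)^2 ≤ 9 := by exact aux_nine (by linarith) (by linarith)
        have h2 : L * (z.re - s.re) ≤ 3 * T := by exact aux_L hL0 (by linarith) (by linarith)
        have h3 := aux_T2 hT40
        linarith
      calc _ ≤ Real.exp 18 * Real.exp (-T) * (T * ((3*C+2*A)*T)^2) := by
            apply mul_le_mul hw hI _ (by positivity)
            exact intervalIntegral.integral_nonneg (by linarith) fun _ _ => by positivity
        _ = T * (Real.exp 18 * (3*C+2*A)^2 * (T^2 * Real.exp (-T))) := by ring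
        _ ≤ _ := by apply mul_le_mul_of_nonneg_left _ (by linarith); linarith
    · rw [mem_reProdIm] at hz
      obtain ⟨hz1, hz2, hz3⟩ := hz
      rcases hz1 with hz1 | hz1
      · -- left side
        have hI : ∫ τ in T..(2*T), ‖F (z + τ * I)‖^2 ≤ T * (Q * ℓ^2) := by
          have hmem : ∀ τ ∈ Set.Icc T (2*T), z + τ * I ∈ Uq := fun τ hτ => (hpt z hz1.ge hz2 hz3 τ hτ).1
          have huc : Set.uIcc T (2*T) = Set.Icc T (2*T) := Set.uIcc_of_le (by linarith)
          have i1 : IntervalIntegrable (fun τ : ℝ => ‖F (z + τ * I)‖^2) volume T (2*T) :=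
            ContinuousOn.intervalIntegrable (by rw [huc]; exact (hFd.continuousOn.comp (by fun_prop) hmem).norm.pow 2)
          have i2 : IntervalIntegrable (fun τ : ℝ => ‖etaG (k+1) (z + τ * I)‖^2) volume T (2*T) :=
            ContinuousOn.intervalIntegrable (by rw [huc]; exact ((etaG_diff hRH (k+1)).continuousOn.comp (by fun_prop) hmem).norm.pow 2)
          have i3 : IntervalIntegrable (fun τ : ℝ => ‖Dp (k+1) X (z + τ * I)‖^2) volume T (2*T) :=
            Continuous.intervalIntegrable (((Dp_diff (k+1) X).continuous.comp (by fun_prop)).norm.pow 2) _ _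
          have h1 : ∫ τ in T..(2*T), ‖F (z + τ * I)‖^2 ≤ ∫ τ in T..(2*T), (2 * ‖etaG (k+1) (z + τ * I)‖^2 + 2 * ‖Dp (k+1) X (z + τ * I)‖^2) := by
            refine intervalIntegral.integral_mono_on (by linarith) i1 ((i2.const_mul 2).add (i3.const_mul 2)) fun τ hτ => ?_
            have := norm_sub_le (etaG (k+1) (z + τ * I)) (Dp (k+1) X (z + τ * I))
            have h0 := norm_nonneg (F (z + τ * I))
            simp only [hF] at h0 ⊢
            exact aux_sq h0 this
          rw [intervalIntegral.integral_add (i2.const_mul 2) (i3.const_mul 2), intervalIntegral.integral_const_mul, intervalIntegral.integral_const_mul] at h1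
          have h2 : ∫ τ in T..(2*T), ‖etaG (k+1) (z + τ * I)‖^2 ≤ (2*T - T) * (C*ℓ)^2 :=
            integral_sq_le (by linarith) fun τ hτ => (hpt z hz1.ge hz2 hz3 τ hτ).2
          have h3 := block_mv k (N := 1) le_rfl hX1 (σ := σ₁) (by linarith) (z := z) hz1.ge (by linarith : T ≤ 2*T)
          have e : ∀ w : ℂ, Dp (k+1) X w = ∑ n ∈ Finset.Ico 1 X, (aC (k+1) n : ℂ) * (n:ℂ)^(-w) := by
            intro w
            rw [← Dp_sub hX1]; simp [Dp, aC_of_lt]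
          simp_rw [← e] at h3
          rw [h2TT] at h2 h3
          have h4 : 2 * (2^k)^2 * (X:ℝ)^3 ≤ 16 * A^2 * T := by
            rw [← hA]; exact aux_A (sq_nonneg A) hX3
          have h5 : (1:ℝ) ≤ ℓ^2 := one_le_pow₀ hℓ1
          calc _ ≤ 2 * (T * (C*ℓ)^2) + 2 * (T * (A^2 * S₁) + 16 * A^2 * T) := by linarith
            _ = T * (2 * C^2 * ℓ^2 + (2 * A^2 * S₁ + 32 * A^2) * 1) := by ring
            _ ≤ T * (2 * C^2 * ℓ^2 + (2 * A^2 * S₁ + 32 * A^2) * ℓ^2) := by gcongr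
            _ = _ := by rw [hQ]; ring
        have hw : Real.exp (2 * (z.re - s.re)^2 - 2 * (z.im - s.im)^2 + L * (z.re - s.re)) ≤ Real.exp 2 * Real.exp (-((σ₀ - 1/2)/16 * Real.log T)) := by
          rw [← Real.exp_add]
          apply Real.exp_le_exp.mpr
          rw [hz1]
          have h1 : (σ₁ - s.re)^2 ≤ 1 := by exact aux_one (by linarith) (by linarith)
          have h2 : L * (σ₁ - s.re) ≤ L * (-δ) := by
            apply mul_le_mul_of_nonneg_left _ hL0.le; linarith
          have h3 : L * (-δ) = -((σ₀ - 1/2)/16 * Real.log T) := by rw [hL, hδ]; ring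
          linarith [sq_nonneg (z.im - s.im)]
        have hℓ3 : ℓ^2 ≤ 4 * (Real.log T)^2 := by exact aux_sq4 (by linarith) hℓ2
        calc _ ≤ Real.exp 2 * Real.exp (-((σ₀ - 1/2)/16 * Real.log T)) * (T * (Q * ℓ^2)) := by
              apply mul_le_mul hw hI _ (by positivity)
              exact intervalIntegral.integral_nonneg (by linarith) fun _ _ => by positivity
          _ ≤ Real.exp 2 * Real.exp (-((σ₀ - 1/2)/16 * Real.log T)) * (T * (Q * (4 * (Real.log T)^2))) := by gcongr
          _ = T * (4 * Real.exp 2 * Q * ((Real.log T)^2 * Real.exp (-((σ₀ - 1/2)/16 * Real.log T)))) := by ring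
          _ ≤ _ := by apply mul_le_mul_of_nonneg_left _ (by linarith); linarith
      · -- right side
        have hz1 : z.re = 3 := hz1
        have hXr : (X:ℝ)^(-(3/2:ℝ)) ≤ Real.exp (-(3/2) * L) := by
          calc (X:ℝ)^(-(3/2:ℝ)) ≤ (Real.exp L)^(-(3/2:ℝ)) := Real.rpow_le_rpow_of_nonpos (Real.exp_pos _) hXge (by norm_num)
            _ = _ := by rw [← Real.exp_mul]; congr 1; ring
        have hI : ∫ τ in T..(2*T), ‖F (z + τ * I)‖^2 ≤ (2*T - T) * (A * Real.exp (-(3/2) * L) * S₂)^2 := by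
          refine integral_sq_le (by linarith) fun τ hτ => ?_
          refine (tail_right k X hX1 (z := z + τ * I) (by rw [hre]; exact hz1)).trans ?_
          gcongr
        rw [h2TT] at hI
        have hw : Real.exp (2 * (z.re - s.re)^2 - 2 * (z.im - s.im)^2 + L * (z.re - s.re)) ≤ Real.exp 18 * Real.exp (5/2 * L) := by
          rw [← Real.exp_add]
          apply Real.exp_le_exp.mpr
          rw [hz1]
          have h1 : (3 - s.re)^2 ≤ 9 := by exact aux_nine (by linarith) (by linarith)
          have h2 : L * (3 - s.re) ≤ L * (5/2) := by
            apply mul_le_mul_of_nonneg_left _ hL0.le; linarith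
          linarith [sq_nonneg (z.im - s.im)]
        have e5 : Real.exp (5/2 * L) * (Real.exp (-(3/2) * L))^2 = Real.exp (-(Real.log T / 16)) := by
          rw [← Real.exp_nat_mul, ← Real.exp_add]; congr 1; rw [hL]; push_cast; ring
        calc _ ≤ Real.exp 18 * Real.exp (5/2 * L) * (T * (A * Real.exp (-(3/2) * L) * S₂)^2) := by
              apply mul_le_mul hw hI _ (by positivity)
              exact intervalIntegral.integral_nonneg (by linarith) fun _ _ => by positivity
          _ = T * (Real.exp 18 * (A*S₂)^2 * (Real.exp (5/2 * L) * (Real.exp (-(3/2) * L))^2)) := by ring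
          _ = T * (Real.exp 18 * (A*S₂)^2 * Real.exp (-(Real.log T / 16))) := by rw [e5]
          _ ≤ _ := by apply mul_le_mul_of_nonneg_left _ (by linarith); linarith

lemma small_tendsto (c₁ c₂ c₃ : ℝ) {a : ℝ} (ha : 0 < a) :
    Tendsto (fun T : ℝ => c₁ * ((Real.log T)^2 * Real.exp (-(a * Real.log T))) + c₂ * Real.exp (-(Real.log T / 16)) + c₃ * (T^2 * Real.exp (-T))) atTop (nhds 0) := by
  have h1 : Tendsto (fun T : ℝ => (Real.log T)^2 * Real.exp (-(a * Real.log T))) atTop (nhds 0) := by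
    have h := ((Real.tendsto_pow_mul_exp_neg_atTop_nhds_zero 2).comp (Real.tendsto_log_atTop.const_mul_atTop ha)).const_mul ((a^2)⁻¹)
    rw [mul_zero] at h
    refine h.congr fun T => ?_
    simp only [Function.comp]
    field_simp
  have h2 : Tendsto (fun T : ℝ => Real.exp (-(Real.log T / 16))) atTop (nhds 0) :=
    Real.tendsto_exp_neg_atTop_nhds_zero.comp (Real.tendsto_log_atTop.atTop_div_const (by norm_num))
  have h3 := Real.tendsto_pow_mul_exp_neg_atTop_nhds_zero 2
  have := ((h1.const_mul c₁).add (h2.const_mul c₂)).add (h3.const_mul c₃)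
  simpa using this

set_option maxHeartbeats 4000000 in
lemma mean_tail (hRH : RiemannHypothesis) (k : ℕ) {σ₀ B ε : ℝ} (hσ : 1/2 < σ₀) (hσ1 : σ₀ ≤ 1) (hB : 0 ≤ B) (hε : 0 < ε) :
    ∃ N₀ : ℕ, ∀ N ≥ N₀, ∃ T₀ : ℝ, ∀ T ≥ T₀, ∀ s : ℂ, σ₀ ≤ s.re → s.re ≤ 1 → |s.im| ≤ B →
      ∫ τ in T..(2*T), ‖etaG (k+1) (s + τ * I) - Dp (k+1) N (s + τ * I)‖^2 ≤ ε * T := by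
  set A : ℝ := 2^k with hA
  have hA0 : 0 < A := by positivity
  obtain ⟨c₁, c₂, c₃, T₁, hT₁⟩ := eta_DX hRH k hσ hσ1 hB
  have hsm := small_tendsto c₁ c₂ c₃ (a := (σ₀ - 1/2)/16) (by linarith)
  have htail : Tendsto (fun N : ℕ => A^2 * ∑' n : ℕ, ((n + N : ℕ):ℝ)^(-(2*σ₀))) atTop (nhds 0) := by
    have := (tendsto_sum_nat_add (fun n : ℕ => (n:ℝ)^(-(2*σ₀)))).const_mul (A^2)
    simpa using this
  obtain ⟨N₀, hN₀⟩ := eventually_atTop.mp (htail.eventually_lt_const (show (0:ℝ) < ε/8 by positivity))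
  refine ⟨max N₀ 1, fun N hN => ?_⟩
  have hN1 : 1 ≤ N := le_trans (le_max_right _ _) hN
  have hNt := hN₀ N (le_trans (le_max_left _ _) hN)
  have hX : Tendsto (fun T : ℝ => (XT T : ℝ)) atTop atTop := by
    refine tendsto_atTop_mono XT_ge ?_
    exact Real.tendsto_exp_atTop.comp (Real.tendsto_log_atTop.atTop_div_const (by norm_num))
  have hsm2 : Tendsto (fun T : ℝ => 16 * A^2 * Real.exp (-(5/8 * Real.log T))) atTop (nhds 0) := by
    have h := (Real.tendsto_exp_neg_atTop_nhds_zero.comp (Real.tendsto_log_atTop.const_mul_atTop (show (0:ℝ) < 5/8 by norm_num))).const_mul (16 * A^2)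
    simpa using h
  have hev : ∀ᶠ T : ℝ in atTop, ∀ s : ℂ, σ₀ ≤ s.re → s.re ≤ 1 → |s.im| ≤ B →
      ∫ τ in T..(2*T), ‖etaG (k+1) (s + τ * I) - Dp (k+1) N (s + τ * I)‖^2 ≤ ε * T := by
    filter_upwards [hsm.eventually_lt_const (show (0:ℝ) < ε/4 by positivity), hsm2.eventually_lt_const (show (0:ℝ) < ε/8 by positivity),
      hX.eventually_ge_atTop (N:ℝ), eventually_ge_atTop T₁, eventually_ge_atTop (1 + B)] with T h1 h2 h3 h4 h5 s hs1 hs2 hs3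
    have hT1 : 1 ≤ T := by linarith
    obtain ⟨hs4, hs5⟩ := abs_le.mp hs3
    have hNX : N ≤ XT T := by exact_mod_cast h3
    have b1 := hT₁ T h4 s hs1 hs2 hs3
    have b2 := block_mv k hN1 hNX (σ := σ₀) hσ (z := s) hs1 (by linarith : T ≤ 2*T)
    simp_rw [← Dp_sub hNX] at b2
    have b3 : 2 * (2^k)^2 * (XT T:ℝ)^3 ≤ ε/8 * T := by
      have e1 := XT_cube hT1
      have e2 : Real.exp (3 * (Real.log T / 8)) = T * Real.exp (-(5/8 * Real.log T)) := by
        conv_rhs => rw [← Real.exp_log (show 0 < T by linarith), ← Real.exp_add, Real.log_exp]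
        congr 1; ring
      rw [e2] at e1
      calc _ ≤ 2 * A^2 * (8 * (T * Real.exp (-(5/8 * Real.log T)))) := by rw [← hA]; gcongr
        _ = (16 * A^2 * Real.exp (-(5/8 * Real.log T))) * T := by ring
        _ ≤ _ := by gcongr
    have hmem : ∀ τ ∈ Set.Icc T (2*T), s + τ * I ∈ Uq := by
      intro τ hτ
      have := hτ.1
      constructor
      · simp; linarith
      · simp; linarith
    have huc : Set.uIcc T (2*T) = Set.Icc T (2*T) := Set.uIcc_of_le (by linarith)
    have ceta : ContinuousOn (fun τ : ℝ => etaG (k+1) (s + τ * I)) (Set.Icc T (2*T)) :=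
      (etaG_diff hRH (k+1)).continuousOn.comp (by fun_prop) hmem
    have cD : ∀ M, Continuous (fun τ : ℝ => Dp (k+1) M (s + τ * I)) := fun M => (Dp_diff (k+1) M).continuous.comp (by fun_prop)
    have i1 : ∀ M, IntervalIntegrable (fun τ : ℝ => ‖etaG (k+1) (s + τ * I) - Dp (k+1) M (s + τ * I)‖^2) volume T (2*T) := fun M =>
      ContinuousOn.intervalIntegrable (by rw [huc]; exact (ceta.sub (cD M).continuousOn).norm.pow 2)
    have i3 : IntervalIntegrable (fun τ : ℝ => ‖Dp (k+1) (XT T) (s + τ * I) - Dp (k+1) N (s + τ * I)‖^2) volume T (2*T) :=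
      Continuous.intervalIntegrable (((cD _).sub (cD N)).norm.pow 2) _ _
    have hle : ∫ τ in T..(2*T), ‖etaG (k+1) (s + τ * I) - Dp (k+1) N (s + τ * I)‖^2 ≤
        ∫ τ in T..(2*T), (2 * ‖etaG (k+1) (s + τ * I) - Dp (k+1) (XT T) (s + τ * I)‖^2 + 2 * ‖Dp (k+1) (XT T) (s + τ * I) - Dp (k+1) N (s + τ * I)‖^2) := by
      refine intervalIntegral.integral_mono_on (by linarith) (i1 N) (((i1 _).const_mul 2).add (i3.const_mul 2)) fun τ hτ => ?_
      have h6 : ‖etaG (k+1) (s + τ * I) - Dp (k+1) N (s + τ * I)‖ ≤ ‖etaG (k+1) (s + τ * I) - Dp (k+1) (XT T) (s + τ * I)‖ + ‖Dp (k+1) (XT T) (s + τ * I) - Dp (k+1) N (s + τ * I)‖ := by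
        refine le_trans (le_of_eq ?_) (norm_add_le _ _)
        congr 1; ring
      exact aux_sq (norm_nonneg _) h6
    rw [intervalIntegral.integral_add ((i1 _).const_mul 2) (i3.const_mul 2), intervalIntegral.integral_const_mul, intervalIntegral.integral_const_mul] at hle
    have h2TT : 2 * T - T = T := by ring
    rw [h2TT] at b2
    have b4 : T * ((2^k)^2 * ∑' n : ℕ, ((n + N : ℕ):ℝ)^(-(2*σ₀))) ≤ T * (ε/8) := by gcongr
    have b5 := mul_le_mul_of_nonneg_left h1.le (show 0 ≤ T by linarith)
    linarith
  obtain ⟨T₀, hT₀⟩ := eventually_atTop.mp hev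
  exact ⟨T₀, hT₀⟩

end Univ

namespace Univ

lemma log_indep (S : Finset ℕ) (hS : ∀ p ∈ S, p.Prime) (v : S → ℤ) (h : ∑ p : S, (v p : ℝ) * Real.log (p:ℕ) = 0) : v = 0 := by
  have hpos : ∀ (e : S → ℕ), (∏ p : S, ((p:ℕ))^(e p)) ≠ 0 := fun e =>
    Finset.prod_ne_zero_iff.mpr fun p _ => pow_ne_zero _ (hS p p.2).ne_zero
  have hlog : ∀ (e : S → ℕ), Real.log ((∏ p : S, ((p:ℕ))^(e p) : ℕ)) = ∑ p : S, (e p : ℝ) * Real.log (p:ℕ) := by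
    intro e
    push_cast
    rw [Real.log_prod (fun p _ => pow_ne_zero _ (by exact_mod_cast (hS p p.2).ne_zero))]
    exact Finset.sum_congr rfl fun p _ => Real.log_pow _ _
  have hfac : ∀ (e : S → ℕ) (q : S), (∏ p : S, ((p:ℕ))^(e p)).factorization q = e q := by
    intro e q
    rw [Nat.factorization_prod (S := Finset.univ) (g := fun p : S => (p:ℕ)^(e p)) (fun p _ => pow_ne_zero _ (hS p p.2).ne_zero), Finset.sum_apply']
    rw [Finset.sum_eq_single q]
    · rw [(hS q q.2).factorization_pow]; simp
    · intro p _ hpq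
      rw [(hS p p.2).factorization_pow]
      have : (p:ℕ) ≠ q := fun h => hpq (Subtype.ext h)
      simp [this]
    · simp
  have h1 : ∑ p : S, ((v p).toNat : ℝ) * Real.log (p:ℕ) = ∑ p : S, ((-v p).toNat : ℝ) * Real.log (p:ℕ) := by
    rw [← sub_eq_zero, ← Finset.sum_sub_distrib, ← h]
    refine Finset.sum_congr rfl fun p _ => ?_
    rw [← sub_mul]; congr 1
    have : ((v p).toNat : ℤ) - ((-v p).toNat : ℤ) = v p := by omega
    exact_mod_cast this
  rw [← hlog, ← hlog] at h1
  have h2 : (∏ p : S, ((p:ℕ))^((v p).toNat)) = ∏ p : S, ((p:ℕ))^((-v p).toNat) := by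
    have := Real.log_injOn_pos (Set.mem_Ioi.mpr (by exact_mod_cast Nat.pos_of_ne_zero (hpos _))) (Set.mem_Ioi.mpr (by exact_mod_cast Nat.pos_of_ne_zero (hpos _))) h1
    exact_mod_cast this
  funext q
  have h3 := hfac (fun p => (v p).toNat) q
  rw [h2, hfac (fun p => (-v p).toNat) q] at h3
  simp only [Pi.zero_apply]; omega

/-- Haar average over the unit circle -/
noncomputable def avg (g : ℂ → ℂ) : ℂ := ∫ x : UnitAddCircle, g (fourier 1 x) ∂AddCircle.haarAddCircle

lemma int_fourier (n : ℤ) : ∫ x : UnitAddCircle, fourier n x ∂AddCircle.haarAddCircle = if n = 0 then 1 else 0 := by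
  split_ifs with h
  · subst h; simp
  · exact integral_eq_zero_of_add_right_eq_neg (fourier_add_half_inv_index h one_pos)

noncomputable def curve (S : Finset ℕ) (τ : ℝ) : S → UnitAddCircle := fun p => ((-(Real.log (p:ℕ)) * τ / (2 * Real.pi) : ℝ) : UnitAddCircle)

lemma curve_cont (S : Finset ℕ) : Continuous (curve S) := by
  refine continuous_pi fun p => ?_
  exact (AddCircle.continuous_mk' 1).comp (by fun_prop)

lemma fourier_curve (S : Finset ℕ) (τ : ℝ) (p : S) (n : ℤ) : fourier n (curve S τ p) = cexp (((n * -(Real.log (p:ℕ)) : ℝ) : ℂ) * I * τ) := by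
  unfold curve
  rw [fourier_coe_apply]
  congr 1
  have : (Real.pi:ℂ) ≠ 0 := by exact_mod_cast Real.pi_ne_zero
  push_cast; field_simp

lemma exp_mean {l : ℝ} (hl : l ≠ 0) : Tendsto (fun T : ℝ => (∫ τ in T..(2*T), cexp (l * I * τ)) / T) atTop (nhds 0) := by
  rw [tendsto_zero_iff_norm_tendsto_zero]
  have h : Tendsto (fun T : ℝ => (2/|l|) / T) atTop (nhds 0) := tendsto_const_nhds.div_atTop tendsto_id
  refine squeeze_zero' (Eventually.of_forall fun _ => norm_nonneg _) ?_ h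
  filter_upwards [eventually_gt_atTop 0] with T hT
  rw [norm_div, Complex.norm_real, Real.norm_of_nonneg hT.le]
  gcongr
  exact int_exp_le hl _ _

lemma kw_char (S : Finset ℕ) (hS : ∀ p ∈ S, p.Prime) (n : S → ℤ) :
    Tendsto (fun T : ℝ => (∫ τ in T..(2*T), UnitAddTorus.mFourier n (curve S τ)) / T) atTop
      (nhds (∫ x, UnitAddTorus.mFourier n x ∂(Measure.pi fun _ : S => (AddCircle.haarAddCircle (T := (1:ℝ)))))) := by
  have e1 : ∀ τ, UnitAddTorus.mFourier n (curve S τ) = cexp (((∑ p : S, (n p : ℝ) * -(Real.log (p:ℕ)) : ℝ) : ℂ) * I * τ) := by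
    intro τ
    simp only [UnitAddTorus.mFourier, ContinuousMap.coe_mk, fourier_curve]
    rw [← Complex.exp_sum]
    congr 1
    push_cast
    rw [Finset.sum_mul, Finset.sum_mul]
  have e2 : (∫ x, UnitAddTorus.mFourier n x ∂(Measure.pi fun _ : S => (AddCircle.haarAddCircle (T := (1:ℝ))))) = ∏ p : S, if n p = 0 then (1:ℂ) else 0 := by
    simp only [UnitAddTorus.mFourier, ContinuousMap.coe_mk]
    rw [integral_fintype_prod_eq_prod (f := fun (p : S) (x : UnitAddCircle) => (fourier (n p) x : ℂ))]
    exact Finset.prod_congr rfl fun p _ => int_fourier _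
  rw [e2]
  simp_rw [e1]
  by_cases h : n = 0
  · subst h
    simp only [Pi.zero_apply, if_true, Finset.prod_const_one]
    refine tendsto_const_nhds.congr' ?_
    filter_upwards [eventually_gt_atTop 0] with T hT
    have : (T:ℂ) ≠ 0 := by exact_mod_cast hT.ne'
    simp
    field_simp; ring
  · have hz : (∏ p : S, if n p = 0 then (1:ℂ) else 0) = 0 := by
      obtain ⟨p, hp⟩ := Function.ne_iff.mp h
      exact Finset.prod_eq_zero (Finset.mem_univ p) (if_neg hp)
    rw [hz]
    apply exp_mean
    intro h0
    apply h
    apply log_indep S hS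
    have : ∑ p : S, (n p : ℝ) * -(Real.log (p:ℕ)) = - ∑ p : S, (n p : ℝ) * (Real.log (p:ℕ)) := by
      rw [← Finset.sum_neg_distrib]; exact Finset.sum_congr rfl fun p _ => by ring
    rw [this] at h0; linarith

lemma kw (S : Finset ℕ) (hS : ∀ p ∈ S, p.Prime) (g : C(S → UnitAddCircle, ℂ)) :
    Tendsto (fun T : ℝ => (∫ τ in T..(2*T), g (curve S τ)) / T) atTop
      (nhds (∫ x, g x ∂(Measure.pi fun _ : S => (AddCircle.haarAddCircle (T := (1:ℝ)))))) := by
  set μ := (Measure.pi fun _ : S => (AddCircle.haarAddCircle (T := (1:ℝ)))) with hμ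
  have hItg : ∀ g : C(S → UnitAddCircle, ℂ), Integrable (fun x => g x) μ := fun g =>
    (g.continuous.integrable_of_hasCompactSupport (HasCompactSupport.of_compactSpace _))
  have hii : ∀ (g : C(S → UnitAddCircle, ℂ)) (a b : ℝ), IntervalIntegrable (fun τ => g (curve S τ)) volume a b := fun g a b =>
    (g.continuous.comp (curve_cont S)).intervalIntegrable _ _
  have hspan : ∀ P ∈ Submodule.span ℂ (Set.range (UnitAddTorus.mFourier (d := S))),
      Tendsto (fun T : ℝ => (∫ τ in T..(2*T), P (curve S τ)) / T) atTop (nhds (∫ x, P x ∂μ)) := by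
    intro P hP
    induction hP using Submodule.span_induction with
    | mem x hx => obtain ⟨n, rfl⟩ := hx; exact kw_char S hS n
    | zero => simp
    | add x y _ _ hx hy =>
      simp only [ContinuousMap.add_apply]
      rw [integral_add (hItg x) (hItg y)]
      refine (hx.add hy).congr fun T => ?_
      rw [intervalIntegral.integral_add (hii x _ _) (hii y _ _), add_div]
    | smul a x _ hx =>
      simp only [ContinuousMap.smul_apply, smul_eq_mul]
      rw [integral_const_mul]
      refine (hx.const_mul a).congr fun T => ?_
      rw [intervalIntegral.integral_const_mul, mul_div_assoc]
  rw [Metric.tendsto_atTop]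
  intro ε hε
  have hmem : g ∈ closure (Submodule.span ℂ (Set.range (UnitAddTorus.mFourier (d := S))) : Set C(S → UnitAddCircle, ℂ)) := by
    rw [← Submodule.topologicalClosure_coe, UnitAddTorus.span_mFourier_closure_eq_top]; trivial
  obtain ⟨P, hP, hgP⟩ := Metric.mem_closure_iff.mp hmem (ε/3) (by positivity)
  obtain ⟨T₀, hT₀⟩ := Metric.tendsto_atTop.mp (hspan P hP) (ε/3) (by positivity)
  refine ⟨max T₀ 1, fun T hT => ?_⟩
  have hT1 : 1 ≤ T := le_trans (le_max_right _ _) hT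
  have h1 := hT₀ T (le_trans (le_max_left _ _) hT)
  have hpt : ∀ x, ‖g x - P x‖ ≤ ε/3 := fun x => by
    rw [← dist_eq_norm]; exact (ContinuousMap.dist_apply_le_dist x).trans hgP.le
  have h2 : dist ((∫ τ in T..(2*T), g (curve S τ)) / T) ((∫ τ in T..(2*T), P (curve S τ)) / T) ≤ ε/3 := by
    rw [dist_eq_norm, ← sub_div, ← intervalIntegral.integral_sub (hii _ _ _) (hii _ _ _), norm_div, Complex.norm_real, Real.norm_of_nonneg (by linarith), div_le_iff₀ (by linarith)]
    refine (intervalIntegral.norm_integral_le_of_norm_le_const (C := ε/3) fun τ _ => hpt _).trans ?_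
    rw [abs_of_nonneg (by linarith)]
    apply le_of_eq; ring
  have h3 : dist (∫ x, P x ∂μ) (∫ x, g x ∂μ) ≤ ε/3 := by
    rw [dist_comm, dist_eq_norm, ← integral_sub (hItg g) (hItg P)]
    refine (norm_integral_le_of_norm_le_const (Eventually.of_forall fun x => hpt x)).trans ?_
    simp
  calc _ ≤ _ + _ := dist_triangle _ ((∫ τ in T..(2*T), P (curve S τ)) / T) _
    _ ≤ _ + (_ + _) := by gcongr; exact dist_triangle _ (∫ x, P x ∂μ) _
    _ < ε := by linarith

/-- independence of the `p ^ (-iτ)` in the mean -/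
lemma indep_mean (S : Finset ℕ) (hS : ∀ p ∈ S, p.Prime) (g : ℕ → ℂ → ℂ) (hg : ∀ p, Continuous (g p)) :
    Tendsto (fun T : ℝ => (∫ τ in T..(2*T), ∏ p ∈ S, g p (cexp (((-Real.log p : ℝ) : ℂ) * I * τ))) / T) atTop
      (nhds (∏ p ∈ S, avg (g p))) := by
  have h := kw S hS ⟨fun x => ∏ p : S, g p (fourier 1 (x p)), by
    refine continuous_finsetProd _ fun p _ => (hg p).comp ((fourier 1).continuous.comp (continuous_apply p))⟩
  simp only [ContinuousMap.coe_mk] at h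
  rw [integral_fintype_prod_eq_prod (f := fun (p : S) (x : UnitAddCircle) => g p (fourier 1 x : ℂ))] at h
  simp only [fourier_curve] at h
  have e1 : ∏ p ∈ S, avg (g p) = ∏ p : S, avg (g p) := (Finset.prod_coe_sort S (fun p => avg (g p))).symm
  rw [e1]
  refine h.congr fun T => ?_
  congr 1
  refine intervalIntegral.integral_congr fun τ _ => ?_
  rw [← Finset.prod_coe_sort S (fun p => g p (cexp (((-Real.log p : ℝ) : ℂ) * I * τ)))]
  refine Finset.prod_congr rfl fun p _ => ?_
  simp

end Univ

namespace Univ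

/-- `p ^ (-iτ)` -/
noncomputable def xp (p : ℕ) (τ : ℝ) : ℂ := cexp (((-Real.log p : ℝ) : ℂ) * I * τ)

lemma xp_norm (p : ℕ) (τ : ℝ) : ‖xp p τ‖ = 1 := by
  unfold xp
  have : (((-Real.log p : ℝ) : ℂ) * I * τ) = ((-Real.log p * τ : ℝ) : ℂ) * I := by push_cast; ring
  rw [this, Complex.norm_exp_ofReal_mul_I]

lemma xp_cont (p : ℕ) : Continuous (xp p) := by unfold xp; fun_prop

lemma fourier_norm1 (x : UnitAddCircle) : ‖(fourier 1 x : ℂ)‖ = 1 := by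
  rw [fourier_one]; exact Circle.norm_coe _

lemma circ_int {g : ℂ → ℂ} (hg : Continuous g) : Integrable (fun x : UnitAddCircle => g (fourier 1 x)) AddCircle.haarAddCircle :=
  (hg.comp (fourier 1).continuous).integrable_of_hasCompactSupport (HasCompactSupport.of_compactSpace _)

lemma circ_int_real {g : ℂ → ℝ} (hg : Continuous g) : Integrable (fun x : UnitAddCircle => g (fourier 1 x)) AddCircle.haarAddCircle :=
  (hg.comp (fourier 1).continuous).integrable_of_hasCompactSupport (HasCompactSupport.of_compactSpace _)

lemma avg_diag {w : ℂ → ℝ} (hw : Continuous w) (hw0 : ∀ z, ‖z‖ = 1 → 0 ≤ w z) (hw1 : avg (fun z => (w z : ℂ)) = 1) {c : ℂ} (hc : ‖c‖ ≤ 1/2) :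
    ‖avg (fun z => (w z : ℂ) * (z - c) * (starRingEnd ℂ (z - c)))‖ ≤ 9/4 := by
  have h1 : ∫ x : UnitAddCircle, w (fourier 1 x) ∂AddCircle.haarAddCircle = 1 := by
    unfold avg at hw1
    beta_reduce at hw1
    rw [integral_complex_ofReal] at hw1
    exact_mod_cast hw1
  calc _ ≤ ∫ x : UnitAddCircle, 9/4 * w (fourier 1 x) ∂AddCircle.haarAddCircle := by
        unfold avg
        refine norm_integral_le_of_norm_le ((circ_int_real hw).const_mul _) (Eventually.of_forall fun x => ?_)
        have h2 := fourier_norm1 x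
        have h3 : ‖(fourier 1 x : ℂ) - c‖ ≤ 3/2 := (norm_sub_le _ _).trans (by rw [h2]; linarith)
        rw [norm_mul, norm_mul, RCLike.norm_conj, Complex.norm_real, Real.norm_of_nonneg (hw0 _ h2)]
        have h4 := hw0 _ h2
        have h5 := norm_nonneg ((fourier 1 x : ℂ) - c)
        have h6 : ‖(fourier 1 x : ℂ) - c‖ * ‖(fourier 1 x : ℂ) - c‖ ≤ 9/4 := by nlinarith
        rw [mul_assoc, mul_comm (9/4:ℝ)]
        exact mul_le_mul_of_nonneg_left h6 h4
    _ = 9/4 := by rw [integral_const_mul, h1, mul_one]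

lemma orth (S Q : Finset ℕ) (hS : ∀ p ∈ S, p.Prime) (hQS : Q ⊆ S) (w : ℕ → ℂ → ℝ) (hw : ∀ p, Continuous (w p))
    (hw0 : ∀ p z, ‖z‖ = 1 → 0 ≤ w p z) (hw1 : ∀ p, avg (fun z => (w p z : ℂ)) = 1) (c : ℕ → ℂ) (hc : ∀ p, ‖c p‖ ≤ 1/2)
    (horth : ∀ p ∈ Q, avg (fun z => (w p z : ℂ) * (z - c p)) = 0) {M ε : ℝ} (hM : 0 ≤ M) (hε : 0 < ε) :
    ∃ T₀ : ℝ, ∀ T ≥ T₀, ∀ b : ℕ → ℂ, (∀ p ∈ Q, ‖b p‖ ≤ M) →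
      ∫ τ in T..(2*T), (∏ p ∈ S, w p (xp p τ)) * ‖∑ p ∈ Q, b p * (xp p τ - c p)‖^2 ≤ T * (9/4 * ∑ p ∈ Q, ‖b p‖^2 + ε) := by
  set G : ℕ → ℕ → ℝ → ℂ := fun p q τ => ((∏ r ∈ S, w r (xp r τ) : ℝ) : ℂ) * ((xp p τ - c p) * (starRingEnd ℂ (xp q τ - c q))) with hG
  have hWc : Continuous fun τ => ((∏ r ∈ S, w r (xp r τ) : ℝ) : ℂ) :=
    continuous_ofReal.comp (continuous_finsetProd _ fun r _ => (hw r).comp (xp_cont r))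
  have hGc : ∀ p q, Continuous (G p q) := fun p q =>
    hWc.mul (((xp_cont p).sub continuous_const).mul (continuous_conj.comp ((xp_cont q).sub continuous_const)))
  set g : ℕ → ℕ → ℕ → ℂ → ℂ := fun p q r z => (w r z : ℂ) * (if r = p then z - c p else 1) * (if r = q then starRingEnd ℂ (z - c q) else 1) with hg
  have hgc : ∀ p q r, Continuous (g p q r) := by
    intro p q r
    refine ((continuous_ofReal.comp (hw r)).mul ?_).mul ?_
    · split_ifs <;> fun_prop
    · split_ifs
      · exact continuous_conj.comp (by fun_prop)
      · fun_prop
  have hGg : ∀ p ∈ Q, ∀ q ∈ Q, ∀ τ, G p q τ = ∏ r ∈ S, g p q r (xp r τ) := by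
    intro p hp q hq τ
    simp only [hG, hg]
    rw [Finset.prod_mul_distrib, Finset.prod_mul_distrib, Finset.prod_ite_eq', Finset.prod_ite_eq', if_pos (hQS hp), if_pos (hQS hq)]
    push_cast; ring
  set E : ℕ → ℕ → ℂ := fun p q => ∏ r ∈ S, avg (g p q r) with hE
  have hEb : ∀ p ∈ Q, ∀ q ∈ Q, ‖E p q‖ ≤ if p = q then 9/4 else 0 := by
    intro p hp q hq
    split_ifs with h
    · subst h
      simp only [hE]
      rw [Finset.prod_eq_single p]
      · simp only [hg, if_true]
        exact avg_diag (hw p) (hw0 p) (hw1 p) (hc p)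
      · intro r _ hr
        simp only [hg, if_neg hr, mul_one]
        exact hw1 r
      · intro h; exact absurd (hQS hp) h
    · have : E p q = 0 := by
        refine Finset.prod_eq_zero (hQS hp) ?_
        simp only [hg, if_true, if_neg h, mul_one]
        exact horth p hp
      rw [this, norm_zero]
  have hlim : ∀ p ∈ Q, ∀ q ∈ Q, Tendsto (fun T : ℝ => (∫ τ in T..(2*T), G p q τ) / T) atTop (nhds (E p q)) := by
    intro p hp q hq
    simp_rw [hGg p hp q hq]
    exact indep_mean S hS (g p q) (hgc p q)
  set δ := ε / (M^2 * (Q.card:ℝ)^2 + 1) with hδ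
  have hδ0 : 0 < δ := by positivity
  have hev : ∀ᶠ T : ℝ in atTop, ∀ p ∈ Q, ∀ q ∈ Q, ‖(∫ τ in T..(2*T), G p q τ) / T - E p q‖ < δ := by
    rw [Filter.eventually_all_finset]
    intro p hp
    rw [Filter.eventually_all_finset]
    intro q hq
    have := (Metric.tendsto_nhds.mp (hlim p hp q hq)) δ hδ0
    simpa only [dist_eq_norm] using this
  obtain ⟨T₀, hT₀⟩ := eventually_atTop.mp hev
  refine ⟨max T₀ 1, fun T hT b hb => ?_⟩
  have hT1 : 1 ≤ T := le_trans (le_max_right _ _) hT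
  have hI := hT₀ T (le_trans (le_max_left _ _) hT)
  have hTc : (T:ℂ) ≠ 0 := by exact_mod_cast (by linarith : T ≠ 0)
  have hI2 : ∀ p ∈ Q, ∀ q ∈ Q, ‖∫ τ in T..(2*T), G p q τ‖ ≤ T * ((if p = q then 9/4 else 0) + δ) := by
    intro p hp q hq
    have e : (∫ τ in T..(2*T), G p q τ) = T * ((∫ τ in T..(2*T), G p q τ) / T - E p q + E p q) := by field_simp; ring
    rw [e, norm_mul, Complex.norm_real, Real.norm_of_nonneg (by linarith)]
    refine mul_le_mul_of_nonneg_left ((norm_add_le _ _).trans ?_) (by linarith)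
    linarith [hI p hp q hq, hEb p hp q hq]
  have e1 : ∀ τ : ℝ, (((∏ p ∈ S, w p (xp p τ)) * ‖∑ p ∈ Q, b p * (xp p τ - c p)‖^2 : ℝ) : ℂ) =
      ∑ p ∈ Q, ∑ q ∈ Q, b p * (starRingEnd ℂ (b q)) * G p q τ := by
    intro τ
    rw [ofReal_mul, ofReal_pow, ← Complex.mul_conj', map_sum, Finset.sum_mul_sum, Finset.mul_sum]
    refine Finset.sum_congr rfl fun n _ => ?_
    rw [Finset.mul_sum]
    refine Finset.sum_congr rfl fun m _ => ?_
    simp only [hG]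
    rw [map_mul]; ring
  have hbG : ∀ p q, Continuous fun τ => b p * (starRingEnd ℂ (b q)) * G p q τ := fun p q => continuous_const.mul (hGc p q)
  have e2 : ((∫ τ in T..(2*T), (∏ p ∈ S, w p (xp p τ)) * ‖∑ p ∈ Q, b p * (xp p τ - c p)‖^2 : ℝ) : ℂ) =
      ∑ p ∈ Q, ∑ q ∈ Q, b p * (starRingEnd ℂ (b q)) * ∫ τ in T..(2*T), G p q τ := by
    rw [← intervalIntegral.integral_ofReal]
    simp_rw [e1]
    rw [intervalIntegral.integral_finsetSum (fun n _ => (continuous_finsetSum _ fun m _ => hbG n m).intervalIntegrable _ _)]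
    refine Finset.sum_congr rfl fun n _ => ?_
    rw [intervalIntegral.integral_finsetSum (fun m _ => (hbG n m).intervalIntegrable _ _)]
    refine Finset.sum_congr rfl fun m _ => ?_
    rw [intervalIntegral.integral_const_mul]
  have h0 : ∀ p ∈ Q, ∀ q ∈ Q, ‖b p * (starRingEnd ℂ (b q)) * ∫ τ in T..(2*T), G p q τ‖ ≤
      T * ((if p = q then 9/4 * ‖b p‖^2 else 0) + M^2 * δ) := by
    intro p hp q hq
    rw [norm_mul, norm_mul, RCLike.norm_conj]
    have h1 := mul_le_mul_of_nonneg_left (hI2 p hp q hq) (show 0 ≤ ‖b p‖ * ‖b q‖ by positivity)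
    refine h1.trans ?_
    have h2 : ‖b p‖ * ‖b q‖ ≤ M^2 := by rw [sq]; exact mul_le_mul (hb p hp) (hb q hq) (norm_nonneg _) hM
    have h3 := mul_le_mul_of_nonneg_right h2 hδ0.le
    have h4 : ‖b p‖ * ‖b q‖ * (T * ((if p = q then (9/4:ℝ) else 0) + δ)) = T * (‖b p‖ * ‖b q‖ * (if p = q then (9/4:ℝ) else 0) + ‖b p‖ * ‖b q‖ * δ) := by ring
    rw [h4]
    refine mul_le_mul_of_nonneg_left (add_le_add (le_of_eq ?_) h3) (by linarith)
    split_ifs with h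
    · subst h; ring
    · ring
  calc _ ≤ ‖((∫ τ in T..(2*T), (∏ p ∈ S, w p (xp p τ)) * ‖∑ p ∈ Q, b p * (xp p τ - c p)‖^2 : ℝ) : ℂ)‖ := by
        rw [Complex.norm_real]; exact le_abs_self _
    _ ≤ ∑ p ∈ Q, ∑ q ∈ Q, T * ((if p = q then 9/4 * ‖b p‖^2 else 0) + M^2 * δ) := by
        rw [e2]
        exact (norm_sum_le _ _).trans (Finset.sum_le_sum fun n hn => (norm_sum_le _ _).trans (Finset.sum_le_sum fun m hm => h0 n hn m hm))
    _ = T * (9/4 * ∑ p ∈ Q, ‖b p‖^2 + (M^2 * (Q.card:ℝ)^2) * δ) := by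
        simp_rw [← Finset.mul_sum, Finset.sum_add_distrib, Finset.sum_ite_eq]
        rw [Finset.sum_congr rfl (fun p hp => if_pos hp), ← Finset.mul_sum]
        simp only [Finset.sum_const, nsmul_eq_mul]
        ring
    _ ≤ _ := by
        have : (M^2 * (Q.card:ℝ)^2) * δ ≤ ε := by
          rw [hδ, mul_div_assoc', div_le_iff₀ (by positivity)]
          nlinarith
        gcongr

end Univ

namespace Univ

noncomputable def bump (η : ℝ) (z : ℂ) : ℝ := max 0 (η - ‖z - 1‖)

noncomputable def kapB (η : ℝ) : ℝ := ∫ x : UnitAddCircle, bump η (fourier 1 x) ∂AddCircle.haarAddCircle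

lemma bump_cont (η : ℝ) : Continuous (bump η) := by unfold bump; fun_prop

lemma kapB_pos {η : ℝ} (hη : 0 < η) : 0 < kapB η := by
  unfold kapB
  refine Continuous.integral_pos_of_hasCompactSupport_nonneg_nonzero (x := 0) ((bump_cont η).comp (fourier 1).continuous) (HasCompactSupport.of_compactSpace _)
    (fun x => le_max_left _ _) ?_
  simp [bump, hη]

noncomputable def wt (y : ℕ) (η : ℝ) (c : ℕ → ℂ) (p : ℕ) (z : ℂ) : ℝ :=
  if p ≤ y then bump η z / kapB η else 1 + 2 * (starRingEnd ℂ (c p) * z).re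

lemma wt_cont (y : ℕ) (η : ℝ) (c : ℕ → ℂ) (p : ℕ) : Continuous (wt y η c p) := by
  unfold wt
  split_ifs
  · exact (bump_cont η).div_const _
  · fun_prop

lemma wt_nonneg (y : ℕ) {η : ℝ} (hη : 0 < η) {c : ℕ → ℂ} (hc : ∀ p, ‖c p‖ ≤ 1/2) (p : ℕ) (z : ℂ) (hz : ‖z‖ = 1) : 0 ≤ wt y η c p z := by
  unfold wt
  split_ifs
  · exact div_nonneg (le_max_left _ _) (kapB_pos hη).le
  · have h1 := Complex.abs_re_le_norm (starRingEnd ℂ (c p) * z)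
    rw [norm_mul, RCLike.norm_conj, hz, mul_one] at h1
    have := (abs_le.mp h1).1
    linarith [hc p]

lemma wt_le (y : ℕ) {η : ℝ} (hη : 0 < η) {c : ℕ → ℂ} (hc : ∀ p, ‖c p‖ ≤ 1/2) (p : ℕ) (z : ℂ) (hz : ‖z‖ = 1) : wt y η c p z ≤ 2 + η / kapB η := by
  have hk := kapB_pos hη
  unfold wt
  split_ifs
  · have : bump η z ≤ η := max_le hη.le (by linarith [norm_nonneg (z - 1)])
    have : bump η z / kapB η ≤ η / kapB η := by gcongr
    linarith
  · have h1 := Complex.abs_re_le_norm (starRingEnd ℂ (c p) * z)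
    rw [norm_mul, RCLike.norm_conj, hz, mul_one] at h1
    have := (abs_le.mp h1).2
    have h3 : 0 ≤ η / kapB η := by positivity
    linarith [hc p]

lemma int_comb (a b d e : ℂ) : ∫ x : UnitAddCircle, (a + b * fourier 1 x + d * fourier (-1) x + e * fourier 2 x) ∂AddCircle.haarAddCircle = a := by
  have hf : ∀ n : ℤ, Integrable (fun x : UnitAddCircle => (fourier n x : ℂ)) AddCircle.haarAddCircle := fun n =>
    (fourier n).continuous.integrable_of_hasCompactSupport (HasCompactSupport.of_compactSpace _)
  have hc : Integrable (fun _ : UnitAddCircle => a) AddCircle.haarAddCircle := integrable_const a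
  have i1 : Integrable (fun x : UnitAddCircle => a + b * fourier 1 x) AddCircle.haarAddCircle := hc.add ((hf 1).const_mul b)
  have i2 : Integrable (fun x : UnitAddCircle => a + b * fourier 1 x + d * fourier (-1) x) AddCircle.haarAddCircle := i1.add ((hf (-1)).const_mul d)
  rw [integral_add i2 ((hf 2).const_mul e),
    integral_add i1 ((hf (-1)).const_mul d), integral_add hc ((hf 1).const_mul b),
    integral_const_mul, integral_const_mul, integral_const_mul, int_fourier, int_fourier, int_fourier]
  simp

lemma re_expand (c z : ℂ) : ((1 + 2 * (starRingEnd ℂ c * z).re : ℝ) : ℂ) = 1 + starRingEnd ℂ c * z + c * starRingEnd ℂ z := by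
  have := Complex.add_conj (starRingEnd ℂ c * z)
  rw [map_mul, conj_conj] at this
  push_cast at this ⊢
  rw [← this]; ring

lemma wt_avg (y : ℕ) {η : ℝ} (hη : 0 < η) (c : ℕ → ℂ) (p : ℕ) : avg (fun z => (wt y η c p z : ℂ)) = 1 := by
  unfold avg wt
  by_cases h : p ≤ y
  · simp only [if_pos h]
    rw [integral_complex_ofReal, integral_div]
    have : kapB η / kapB η = 1 := div_self (kapB_pos hη).ne'
    exact_mod_cast this
  · simp only [if_neg h]
    rw [← int_comb 1 (starRingEnd ℂ (c p)) (c p) 0]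
    refine integral_congr_ae (Eventually.of_forall fun x => ?_)
    beta_reduce
    rw [re_expand, fourier_neg]; ring

lemma wt_orth {y : ℕ} (η : ℝ) (c : ℕ → ℂ) {p : ℕ} (hp : y < p) : avg (fun z => (wt y η c p z : ℂ) * (z - c p)) = 0 := by
  unfold avg wt
  simp only [if_neg hp.not_ge]
  rw [← int_comb 0 (1 - c p * starRingEnd ℂ (c p)) (-(c p)^2) (starRingEnd ℂ (c p))]
  refine integral_congr_ae (Eventually.of_forall fun x => ?_)
  beta_reduce
  have h2 : (fourier 2 x : ℂ) = fourier 1 x * fourier 1 x := by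
    rw [← fourier_add]; norm_num
  have h1 : (fourier 1 x : ℂ) * starRingEnd ℂ (fourier 1 x : ℂ) = 1 := by
    rw [Complex.mul_conj', fourier_norm1]; norm_num
  rw [re_expand, fourier_neg, h2]
  linear_combination (c p) * h1

lemma pow_sub_one_le {x : ℂ} (hx : ‖x‖ = 1) (j : ℕ) : ‖x^j - 1‖ ≤ j * ‖x - 1‖ := by
  induction j with
  | zero => simp
  | succ j ih =>
    have : x^(j+1) - 1 = x * (x^j - 1) + (x - 1) := by ring
    rw [this]
    refine (norm_add_le _ _).trans ?_
    rw [norm_mul, hx]; push_cast; linarith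

lemma xp_pow (p j : ℕ) (τ : ℝ) : xp (p^j) τ = (xp p τ)^j := by
  unfold xp
  rw [← Complex.exp_nat_mul]
  congr 1
  rw [Nat.cast_pow, Real.log_pow]
  push_cast; ring

lemma sum_Ico_le {f : ℕ → ℝ} (hf : ∀ n, 0 ≤ f n) (hs : Summable f) (a b : ℕ) : ∑ n ∈ Finset.Ico a b, f n ≤ ∑' n, f (n + a) := by
  rw [Finset.sum_Ico_eq_sum_range]
  have := ((summable_nat_add_iff a).mpr hs).sum_le_tsum (Finset.range (b - a)) (fun n _ => hf _)
  simpa only [add_comm] using this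

lemma aC_nonprime_le (k n : ℕ) (hn : ¬ n.Prime) : aC (k+1) n ≤ 2^(k+1) * Lnp n := by
  rcases lt_or_ge n 2 with h | h
  · rw [aC_of_lt h]
    have : 0 ≤ Lnp n := by unfold Lnp; rw [if_neg hn]; exact ArithmeticFunction.vonMangoldt_nonneg
    positivity
  · unfold aC Lnp
    rw [if_neg hn]
    have h1 := half_le_log h
    have h2 : (1/2:ℝ)^(k+1) ≤ (Real.log n)^(k+1) := by gcongr
    have h0 : 0 < Real.log n := by linarith
    rw [div_le_iff₀ (by positivity)]
    have h3 : (1:ℝ) ≤ 2^(k+1) * (Real.log n)^(k+1) := by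
      calc (1:ℝ) = 2^(k+1) * (1/2)^(k+1) := by rw [← mul_pow]; norm_num
        _ ≤ _ := by gcongr
    have h4 : 0 ≤ ArithmeticFunction.vonMangoldt n := ArithmeticFunction.vonMangoldt_nonneg
    calc ArithmeticFunction.vonMangoldt n = ArithmeticFunction.vonMangoldt n * 1 := by ring
      _ ≤ ArithmeticFunction.vonMangoldt n * (2^(k+1) * (Real.log n)^(k+1)) := by gcongr
      _ = _ := by ring

lemma Dp_xp (k N : ℕ) (s : ℂ) (τ : ℝ) : Dp (k+1) N (s + τ * I) = ∑ n ∈ Finset.range N, (aC (k+1) n : ℂ) * (n:ℂ)^(-s) * xp n τ := by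
  unfold Dp
  refine Finset.sum_congr rfl fun n _ => ?_
  rcases Nat.eq_zero_or_pos n with h | h
  · subst h; simp [aC_of_lt]
  · rw [cpow_split h, xp]; ring

lemma A_bound (k y : ℕ) {η : ℝ} (s : ℂ) (hs : 0 ≤ s.re) (τ : ℝ) (hτ : ∀ p : ℕ, p.Prime → p ≤ y → ‖xp p τ - 1‖ ≤ η) (hη : 0 ≤ η) :
    ‖∑ n ∈ Finset.range (y+1), (aC (k+1) n : ℂ) * (n:ℂ)^(-s) * (xp n τ - 1)‖ ≤ (y+1) * (2^k * (y * η)) := by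
  refine (norm_sum_le _ _).trans ?_
  have : ∀ n ∈ Finset.range (y+1), ‖(aC (k+1) n : ℂ) * (n:ℂ)^(-s) * (xp n τ - 1)‖ ≤ 2^k * (y * η) := by
    intro n hn
    rw [Finset.mem_range] at hn
    have h0 : 0 ≤ 2^k * (y * η) := by positivity
    by_cases hpp : IsPrimePow n
    · obtain ⟨p, j, hp, hj, rfl⟩ := hpp
      have hp' : p.Prime := hp.nat_prime
      have hpn : p ≤ p^j := Nat.le_self_pow hj.ne' p
      have hjn : j < p^j := Nat.lt_pow_self hp'.one_lt
      have h1 := norm_coef_cpow (n := p^j) (aC_nonneg (k+1) (p^j)) (fun h => by rw [aC_of_lt (by omega)]) hs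
      rw [neg_zero, Real.rpow_zero, mul_one] at h1
      have h2 : ‖xp (p^j) τ - 1‖ ≤ y * η := by
        rw [xp_pow]
        refine (pow_sub_one_le (xp_norm p τ) j).trans ?_
        have : (j:ℝ) ≤ y := by exact_mod_cast (by omega : j ≤ y)
        exact mul_le_mul this (hτ p hp' (by omega)) (norm_nonneg _) (by positivity)
      rw [norm_mul]
      exact mul_le_mul (h1.trans (aC_succ_le k _)) h2 (norm_nonneg _) (by positivity)
    · have : aC (k+1) n = 0 := by
        unfold aC; rw [ArithmeticFunction.vonMangoldt_eq_zero_iff.mpr hpp, zero_div]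
      rw [this]; simpa using h0
  refine (Finset.sum_le_card_nsmul _ _ _ this).trans (le_of_eq ?_)
  rw [Finset.card_range, nsmul_eq_mul]; push_cast; ring

lemma decomp (k y N : ℕ) (hN : y + 1 ≤ N) (s : ℂ) (τ : ℝ) (P : Finset ℕ) (c : ℕ → ℂ) (hP : ∀ p ∈ P, p.Prime ∧ y < p ∧ p < N) (hc0 : ∀ p, p ∉ P → c p = 0) :
    Dp (k+1) N (s + τ * I) - (∑ n ∈ Finset.range (y+1), (aC (k+1) n : ℂ) * (n:ℂ)^(-s) + ∑ p ∈ P, c p * (aC (k+1) p : ℂ) * (p:ℂ)^(-s)) =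
    ∑ n ∈ Finset.range (y+1), (aC (k+1) n : ℂ) * (n:ℂ)^(-s) * (xp n τ - 1)
    + ∑ p ∈ (Finset.Ico (y+1) N).filter Nat.Prime, (aC (k+1) p : ℂ) * (p:ℂ)^(-s) * (xp p τ - c p)
    + ∑ n ∈ (Finset.Ico (y+1) N).filter (fun n => ¬ n.Prime), (aC (k+1) n : ℂ) * (n:ℂ)^(-s) * xp n τ := by
  have h1 : ∑ p ∈ P, c p * (aC (k+1) p : ℂ) * (p:ℂ)^(-s) = ∑ p ∈ (Finset.Ico (y+1) N).filter Nat.Prime, c p * (aC (k+1) p : ℂ) * (p:ℂ)^(-s) := by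
    refine Finset.sum_subset (fun p hp => ?_) (fun p _ hp => by rw [hc0 p hp]; ring)
    obtain ⟨a, b, d⟩ := hP p hp
    rw [Finset.mem_filter, Finset.mem_Ico]; exact ⟨⟨by omega, d⟩, a⟩
  rw [h1, Dp_xp, ← Finset.sum_range_add_sum_Ico _ hN, ← Finset.sum_filter_add_sum_filter_not (Finset.Ico (y+1) N) Nat.Prime]
  simp_rw [mul_sub, Finset.sum_sub_distrib]
  have h2 : ∀ p : ℕ, c p * (aC (k+1) p : ℂ) * (p:ℂ)^(-s) = (aC (k+1) p : ℂ) * (p:ℂ)^(-s) * c p := fun p => by ring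
  simp_rw [h2, mul_one]
  ring

lemma aux_sq3 {a b c : ℝ} {x y z : ℂ} (hx : ‖x‖ ≤ a) (hy : ‖y‖ ≤ b) (hz : ‖z‖ ≤ c) : ‖x + y + z‖^2 ≤ 3 * (a^2 + b^2 + c^2) := by
  have h : ‖x + y + z‖ ≤ a + b + c := (norm_add₃_le).trans (by linarith)
  have := pow_le_pow_left₀ (norm_nonneg _) h 2
  nlinarith [sq_nonneg (a - b), sq_nonneg (b - c), sq_nonneg (a - c)]

set_option maxHeartbeats 1000000 in
/-- the resonator weight -/
lemma weight (k : ℕ) {σ₀ ε : ℝ} (hσ : 1/2 < σ₀) (hε : 0 < ε) : ∃ y₀ : ℕ, ∀ y ≥ y₀, ∀ (P : Finset ℕ) (c : ℕ → ℂ),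
    (∀ p ∈ P, p.Prime ∧ y < p) → (∀ p, ‖c p‖ ≤ 1/2) → ∃ W : ℝ → ℝ, Continuous W ∧ (∀ τ, 0 ≤ W τ) ∧ (∃ M, ∀ τ, W τ ≤ M) ∧
      Tendsto (fun T : ℝ => (∫ τ in T..(2*T), W τ) / T) atTop (nhds 1) ∧ ∃ N₁ : ℕ, ∀ N ≥ N₁, ∃ T₀ : ℝ, ∀ T ≥ T₀, ∀ s : ℂ, σ₀ ≤ s.re →
        ∫ τ in T..(2*T), W τ * ‖Dp (k+1) N (s + τ * I) - (∑ n ∈ Finset.range (y+1), (aC (k+1) n : ℂ) * (n:ℂ)^(-s) + ∑ p ∈ P, c p * (aC (k+1) p : ℂ) * (p:ℂ)^(-s))‖^2 ≤ ε * T := by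
  set e := min 1 (ε/36) with he
  have he0 : 0 < e := by positivity
  have he1 : e^2 ≤ ε/36 := by
    have h1 : e ≤ 1 := min_le_left _ _
    have h2 : e ≤ ε/36 := min_le_right _ _
    nlinarith
  have hsp : Summable fun n : ℕ => (2^k)^2 * (n:ℝ)^(-(2*σ₀)) := (sumsq_summable hσ).mul_left _
  have hsn : Summable fun n : ℕ => 2^(k+1) * (Lnp n * (n:ℝ)^(-σ₀)) := (summable_nonprime hσ).mul_left _
  have hLnp : ∀ n, 0 ≤ Lnp n := fun n => by
    unfold Lnp; split_ifs
    · exact le_rfl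
    · exact ArithmeticFunction.vonMangoldt_nonneg
  have t1 := (tendsto_sum_nat_add (fun n : ℕ => (2^k)^2 * (n:ℝ)^(-(2*σ₀)))).eventually_lt_const (show (0:ℝ) < ε/81 by positivity)
  have t2 := (tendsto_sum_nat_add (fun n : ℕ => 2^(k+1) * (Lnp n * (n:ℝ)^(-σ₀)))).eventually_lt_const he0
  obtain ⟨y₀, hy₀⟩ := eventually_atTop.mp (t1.and t2)
  refine ⟨y₀, fun y hy P c₀ hP hc₀ => ?_⟩
  obtain ⟨hy1, hy2⟩ := hy₀ (y+1) (by omega)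
  classical
  set c : ℕ → ℂ := fun p => if p ∈ P then c₀ p else 0 with hcdef
  have hc : ∀ p, ‖c p‖ ≤ 1/2 := by
    intro p; simp only [hcdef]; split_ifs
    · exact hc₀ p
    · simp
  have hc0 : ∀ p, p ∉ P → c p = 0 := fun p hp => by simp only [hcdef, if_neg hp]
  have hcc : ∀ s : ℂ, ∑ p ∈ P, c₀ p * (aC (k+1) p : ℂ) * (p:ℂ)^(-s) = ∑ p ∈ P, c p * (aC (k+1) p : ℂ) * (p:ℂ)^(-s) := fun s =>
    Finset.sum_congr rfl fun p hp => by simp only [hcdef, if_pos hp]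
  simp_rw [hcc]
  set η : ℝ := e / ((y+1) * (2^k * (y+1))) with hη
  have hη0 : 0 < η := by positivity
  have hηe : (y+1) * (2^k * (y * η)) ≤ e := by
    have : (y+1) * (2^k * ((y+1:ℝ) * η)) = e := by rw [hη]; field_simp
    rw [← this]; gcongr; linarith
  set w := wt y η c with hw
  have hw0 : ∀ p τ, 0 ≤ w p (xp p τ) := fun p τ => wt_nonneg y hη0 hc p _ (xp_norm p τ)
  obtain ⟨N₁, hN₁⟩ : ∃ N₁ : ℕ, y + 1 ≤ N₁ ∧ ∀ p ∈ P, p < N₁ := by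
    refine ⟨max (y+1) (P.sup id + 1), le_max_left _ _, fun p hp => lt_max_of_lt_right ?_⟩
    exact Nat.lt_succ_of_le (Finset.le_sup (f := id) hp)
  have hSp : ∀ N, ∀ p ∈ (Finset.range N).filter Nat.Prime, p.Prime := fun N p hp => (Finset.mem_filter.mp hp).2
  set W : ℝ → ℝ := fun τ => ∏ p ∈ (Finset.range N₁).filter Nat.Prime, w p (xp p τ) with hW
  have hWN : ∀ N ≥ N₁, ∀ τ, W τ = ∏ p ∈ (Finset.range N).filter Nat.Prime, w p (xp p τ) := by
    intro N hN τ
    refine Finset.prod_subset (Finset.filter_subset_filter _ (Finset.range_mono hN)) fun p hp hp' => ?_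
    rw [Finset.mem_filter, Finset.mem_range] at hp hp'
    have hpN : N₁ ≤ p := by by_contra h; exact hp' ⟨by omega, hp.2⟩
    have hpP : p ∉ P := fun h => by have := hN₁.2 p h; omega
    have : ¬ p ≤ y := by have := hN₁.1; omega
    simp [hw, wt, this, hc0 p hpP]
  have hWc : Continuous W := continuous_finsetProd _ fun p _ => (wt_cont y η c p).comp (xp_cont p)
  have hW0 : ∀ τ, 0 ≤ W τ := fun τ => Finset.prod_nonneg fun p _ => hw0 p τ
  have hWlim : Tendsto (fun T : ℝ => (∫ τ in T..(2*T), W τ) / T) atTop (nhds 1) := by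
    have h := indep_mean ((Finset.range N₁).filter Nat.Prime) (hSp N₁) (fun p z => (w p z : ℂ)) (fun p => continuous_ofReal.comp (wt_cont y η c p))
    simp only [hw, wt_avg y hη0, Finset.prod_const_one] at h
    have h2 := (continuous_re.tendsto _).comp h
    rw [one_re] at h2
    refine h2.congr fun T => ?_
    simp only [Function.comp]
    have e1 : ∀ τ : ℝ, (∏ p ∈ (Finset.range N₁).filter Nat.Prime, ((wt y η c p (cexp (((-Real.log p : ℝ) : ℂ) * I * τ)) : ℝ) : ℂ)) = ((W τ : ℝ) : ℂ) := by
      intro τ; simp only [hW, ofReal_prod]; rfl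
    simp_rw [e1]
    rw [intervalIntegral.integral_ofReal, ← ofReal_div, ofReal_re]
  refine ⟨W, hWc, hW0, ⟨∏ p ∈ (Finset.range N₁).filter Nat.Prime, (2 + η / kapB η), fun τ => ?_⟩, hWlim, N₁, fun N hN => ?_⟩
  · exact Finset.prod_le_prod (fun p _ => hw0 p τ) fun p _ => wt_le y hη0 hc p _ (xp_norm p τ)
  set Q := (Finset.Ico (y+1) N).filter Nat.Prime with hQ
  obtain ⟨T₁, hT₁⟩ := orth ((Finset.range N).filter Nat.Prime) Q (hSp N)
    (Finset.filter_subset_filter _ (fun n hn => by rw [Finset.mem_Ico] at hn; exact Finset.mem_range.mpr hn.2)) w (wt_cont y η c) (wt_nonneg y hη0 hc) (wt_avg y hη0 c) c hc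
    (fun p hp => wt_orth η c (by rw [hQ, Finset.mem_filter, Finset.mem_Ico] at hp; omega)) (M := 2^k) (ε := ε/36) (by positivity) (by positivity)
  obtain ⟨T₂, hT₂⟩ := eventually_atTop.mp (hWlim.eventually_lt_const (show (1:ℝ) < 2 by norm_num))
  refine ⟨max (max T₁ T₂) 1, fun T hT s hs => ?_⟩
  have hTT := max_le_iff.mp hT
  have hT1 : 1 ≤ T := hTT.2
  have hWT := hT₂ T (max_le_iff.mp hTT.1).2
  rw [div_lt_iff₀ (by linarith)] at hWT
  set b : ℕ → ℂ := fun p => (aC (k+1) p : ℂ) * (p:ℂ)^(-s) with hb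
  have hbn : ∀ n : ℕ, ‖b n‖ ≤ aC (k+1) n * (n:ℝ)^(-σ₀) := fun n =>
    norm_coef_cpow (aC_nonneg (k+1) n) (fun h => by rw [h, aC_of_lt (by norm_num)]) hs
  have hb2 : ∀ n : ℕ, ‖b n‖ ≤ 2^k * (n:ℝ)^(-σ₀) := fun n => (hbn n).trans (mul_le_mul_of_nonneg_right (aC_succ_le k n) (by positivity))
  have hBI := hT₁ T (max_le_iff.mp hTT.1).1 b (fun p hp => by
    have hp1 : 1 ≤ p := (Finset.mem_filter.mp hp).2.one_lt.le
    refine (hb2 p).trans ?_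
    have : (p:ℝ)^(-σ₀) ≤ 1 := Real.rpow_le_one_of_one_le_of_nonpos (by exact_mod_cast hp1) (by linarith)
    have h2 : (0:ℝ) < 2^k := by positivity
    exact mul_le_of_le_one_right h2.le this)
  simp_rw [← hWN N hN] at hBI
  have hsumB : ∑ p ∈ Q, ‖b p‖^2 ≤ ε/81 := by
    calc ∑ p ∈ Q, ‖b p‖^2 ≤ ∑ p ∈ Q, (2^k)^2 * (p:ℝ)^(-(2*σ₀)) := by
          refine Finset.sum_le_sum fun p hp => ?_
          refine (pow_le_pow_left₀ (norm_nonneg _) (hb2 p) 2).trans (le_of_eq ?_)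
          rw [mul_pow, ← Real.rpow_natCast ((p:ℝ)^(-σ₀)), ← Real.rpow_mul (Nat.cast_nonneg p)]
          congr 2; push_cast; ring
      _ ≤ ∑ p ∈ Finset.Ico (y+1) N, (2^k)^2 * (p:ℝ)^(-(2*σ₀)) :=
          Finset.sum_le_sum_of_subset_of_nonneg (Finset.filter_subset _ _) fun _ _ _ => by positivity
      _ ≤ _ := (sum_Ico_le (fun n => by positivity) hsp _ _).trans hy1.le
  have hC : ∀ τ : ℝ, ‖∑ n ∈ (Finset.Ico (y+1) N).filter (fun n => ¬ n.Prime), b n * xp n τ‖ ≤ e := by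
    intro τ
    calc _ ≤ ∑ n ∈ (Finset.Ico (y+1) N).filter (fun n => ¬ n.Prime), 2^(k+1) * (Lnp n * (n:ℝ)^(-σ₀)) := by
          refine (norm_sum_le _ _).trans (Finset.sum_le_sum fun n hn => ?_)
          rw [norm_mul, xp_norm, mul_one, ← mul_assoc]
          exact (hbn n).trans (mul_le_mul_of_nonneg_right (aC_nonprime_le k n (Finset.mem_filter.mp hn).2) (by positivity))
      _ ≤ ∑ n ∈ Finset.Ico (y+1) N, 2^(k+1) * (Lnp n * (n:ℝ)^(-σ₀)) :=
          Finset.sum_le_sum_of_subset_of_nonneg (Finset.filter_subset _ _) fun n _ _ => by have := hLnp n; positivity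
      _ ≤ _ := (sum_Ico_le (fun n => by have := hLnp n; positivity) hsn _ _).trans hy2.le
  have hpt : ∀ τ : ℝ, W τ * ‖Dp (k+1) N (s + τ * I) - (∑ n ∈ Finset.range (y+1), (aC (k+1) n : ℂ) * (n:ℂ)^(-s) + ∑ p ∈ P, c p * (aC (k+1) p : ℂ) * (p:ℂ)^(-s))‖^2
      ≤ 6 * e^2 * W τ + 3 * (W τ * ‖∑ p ∈ Q, b p * (xp p τ - c p)‖^2) := by
    intro τ
    by_cases hWz : W τ = 0
    · rw [hWz]; simp
    have hA := A_bound k y s (by linarith) τ (η := η) (fun p hp hpy => by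
      have h1 : w p (xp p τ) ≠ 0 := Finset.prod_ne_zero_iff.mp hWz p (by
        rw [Finset.mem_filter, Finset.mem_range]; exact ⟨by have := hN₁.1; omega, hp⟩)
      by_contra hcon
      push Not at hcon
      apply h1
      simp only [hw, wt, if_pos hpy, bump]
      rw [max_eq_left (by linarith), zero_div]) hη0.le
    rw [decomp k y N (le_trans hN₁.1 hN) s τ P c (fun p hp => ⟨(hP p hp).1, (hP p hp).2, lt_of_lt_of_le (hN₁.2 p hp) hN⟩) hc0]
    have h3 := aux_sq3 (hA.trans hηe) (le_refl ‖∑ p ∈ Q, b p * (xp p τ - c p)‖) (hC τ)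
    have h4 := mul_le_mul_of_nonneg_left h3 (hW0 τ)
    refine h4.trans (le_of_eq ?_)
    ring
  have hWi : ∀ a b : ℝ, IntervalIntegrable W volume a b := fun a b => hWc.intervalIntegrable a b
  have hBc : Continuous fun τ => W τ * ‖∑ p ∈ Q, b p * (xp p τ - c p)‖^2 :=
    hWc.mul ((continuous_finsetSum _ fun p _ => continuous_const.mul ((xp_cont p).sub continuous_const)).norm.pow 2)
  have hLc : Continuous fun τ : ℝ => W τ * ‖Dp (k+1) N (s + τ * I) - (∑ n ∈ Finset.range (y+1), (aC (k+1) n : ℂ) * (n:ℂ)^(-s) + ∑ p ∈ P, c p * (aC (k+1) p : ℂ) * (p:ℂ)^(-s))‖^2 :=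
    hWc.mul ((((Dp_diff (k+1) N).continuous.comp (by fun_prop)).sub continuous_const).norm.pow 2)
  have hmono := intervalIntegral.integral_mono_on (by linarith : T ≤ 2*T) (hLc.intervalIntegrable _ _)
    (((hWi T (2*T)).const_mul (6*e^2)).add ((hBc.intervalIntegrable T (2*T)).const_mul 3)) (fun τ _ => hpt τ)
  refine hmono.trans ?_
  rw [intervalIntegral.integral_add ((hWi T (2*T)).const_mul (6*e^2)) ((hBc.intervalIntegrable T (2*T)).const_mul 3), intervalIntegral.integral_const_mul, intervalIntegral.integral_const_mul]
  have h5 : 6 * e^2 * ∫ τ in T..(2*T), W τ ≤ 6 * (ε/36) * (2 * T) :=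
    mul_le_mul (by linarith) hWT.le (intervalIntegral.integral_nonneg (by linarith) fun τ _ => hW0 τ) (by positivity)
  have h6 : T * (9/4 * ∑ p ∈ Q, ‖b p‖^2 + ε/36) ≤ T * (ε/18) :=
    mul_le_mul_of_nonneg_left (by linarith) (by linarith)
  have h7 : 0 < ε * T := by positivity
  linarith

end Univ

namespace Univ

lemma cauchy_sq {F : ℂ → ℂ} {z w : ℂ} {R : ℝ} (hR : 0 < R) (hF : DifferentiableOn ℂ F (Metric.closedBall z R))
    (hw : w ∈ Metric.ball z (R/2)) :
    ‖F w‖^2 ≤ ∫ θ in (0:ℝ)..(2*Real.pi), ‖F (circleMap z R θ)‖^2 := by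
  have hwR : w ∈ Metric.ball z R := Metric.ball_subset_ball (by linarith) hw
  have h := (hF.fun_pow 2).circleIntegral_sub_inv_smul hwR
  have hpi := Real.pi_gt_three
  have hcF : Continuous fun θ : ℝ => F (circleMap z R θ) := by
    refine hF.continuousOn.comp_continuous (continuous_circleMap z R) fun θ => ?_
    exact Metric.sphere_subset_closedBall (circleMap_mem_sphere z hR.le θ)
  have h1 : ‖∮ ζ in C(z, R), (ζ - w)⁻¹ • F ζ ^ 2‖ ≤ 2 * ∫ θ in (0:ℝ)..(2*Real.pi), ‖F (circleMap z R θ)‖^2 := by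
    rw [circleIntegral, ← intervalIntegral.integral_const_mul]
    refine intervalIntegral.norm_integral_le_of_norm_le (by positivity) ?_ ?_
    · refine Eventually.of_forall fun θ _ => ?_
      have hd : R/2 ≤ ‖circleMap z R θ - w‖ := by
        have a1 : ‖circleMap z R θ - z‖ = R := by
          have := circleMap_mem_sphere z hR.le θ
          rwa [mem_sphere_iff_norm] at this
        have a2 : ‖w - z‖ < R/2 := by rwa [mem_ball_iff_norm] at hw
        have a3 : ‖circleMap z R θ - z‖ ≤ ‖circleMap z R θ - w‖ + ‖w - z‖ := norm_sub_le_norm_sub_add_norm_sub _ _ _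
        linarith
      rw [deriv_circleMap, smul_eq_mul, smul_eq_mul, norm_mul, norm_mul, norm_mul, norm_inv, norm_pow, norm_circleMap_zero, abs_of_pos hR, norm_I, mul_one,
        ← mul_assoc]
      gcongr
      rw [← div_eq_mul_inv, div_le_iff₀ (by linarith)]
      linarith
    · exact ((hcF.norm.pow 2).const_mul 2).intervalIntegrable _ _
  rw [h, norm_smul, norm_pow] at h1
  have h2 : ‖(2 * Real.pi * I : ℂ)‖ = 2 * Real.pi := by simp [abs_of_pos Real.pi_pos]
  rw [h2] at h1
  have h3 : 0 ≤ ‖F w‖^2 := by positivity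
  nlinarith

lemma fubini_bound {a b d : ℝ} (hab : a ≤ b) (hd : 0 ≤ d) {G : ℝ → ℝ → ℝ} (hG : ContinuousOn (Function.uncurry G) (Set.Icc a b ×ˢ Set.Icc 0 d))
    {E : ℝ} (hE : ∀ θ ∈ Set.Icc 0 d, ∫ τ in a..b, G τ θ ≤ E) :
    IntervalIntegrable (fun τ => ∫ θ in (0:ℝ)..d, G τ θ) volume a b ∧ ∫ τ in a..b, ∫ θ in (0:ℝ)..d, G τ θ ≤ d * E := by
  have hi : Integrable (Function.uncurry G) ((volume.restrict (Set.uIoc a b)).prod (volume.restrict (Set.uIoc 0 d))) := by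
    rw [Measure.prod_restrict, Set.uIoc_of_le hab, Set.uIoc_of_le hd]
    exact (hG.integrableOn_compact (isCompact_Icc.prod isCompact_Icc)).mono_set (Set.prod_mono Set.Ioc_subset_Icc_self Set.Ioc_subset_Icc_self)
  constructor
  · rw [intervalIntegrable_iff]
    have := hi.integral_prod_left
    refine this.congr (Eventually.of_forall fun τ => ?_)
    simp [intervalIntegral.integral_of_le hd, Set.uIoc_of_le hd, Function.uncurry]
  · rw [intervalIntegral_intervalIntegral_swap (by rwa [IntegrableOn, Measure.volume_eq_prod, ← Measure.prod_restrict])]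
    have h1 : IntervalIntegrable (fun θ => ∫ τ in a..b, G τ θ) volume 0 d := by
      rw [intervalIntegrable_iff]
      refine hi.integral_prod_right.congr (Eventually.of_forall fun τ => ?_)
      simp [intervalIntegral.integral_of_le hab, Set.uIoc_of_le hab, Function.uncurry]
    calc _ ≤ ∫ θ in (0:ℝ)..d, E := intervalIntegral.integral_mono_on hd h1 intervalIntegrable_const hE
      _ = d * E := by simp

lemma chebyshev {a b M δ : ℝ} (hab : a ≤ b) (hδ : 0 < δ) {W Q : ℝ → ℝ} (hW0 : ∀ τ, 0 ≤ W τ) (hWM : ∀ τ, W τ ≤ M) (hQ : ∀ τ ∈ Set.Icc a b, 0 ≤ Q τ)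
    (hWi : IntervalIntegrable W volume a b) (hWQ : IntervalIntegrable (fun τ => W τ * Q τ) volume a b) {S : Set ℝ} (hS : S ⊆ Set.Icc a b)
    (h : ∀ τ ∈ Set.Icc a b, τ ∉ S → δ ≤ Q τ) :
    ∫ τ in a..b, W τ ≤ M * (volume S).toReal + δ⁻¹ * ∫ τ in a..b, W τ * Q τ := by
  have hM : 0 ≤ M := (hW0 0).trans (hWM 0)
  set S' := toMeasurable volume S with hS'
  have hm : MeasurableSet S' := measurableSet_toMeasurable _ _
  have hv : volume S' = volume S := measure_toMeasurable S
  have hfin : volume S' ≠ ⊤ := by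
    rw [hv]
    exact ((measure_mono hS).trans_lt (by simp)).ne
  have hi1 : Integrable (S'.indicator fun _ => M) volume := (integrable_indicator_iff hm).2 (integrableOn_const hfin)
  rw [intervalIntegral.integral_of_le hab, intervalIntegral.integral_of_le hab, ← integral_const_mul]
  rw [intervalIntegrable_iff_integrableOn_Ioc_of_le hab] at hWi hWQ
  have h1 : ∫ τ in Set.Ioc a b, S'.indicator (fun _ => M) τ ≤ M * (volume S).toReal := by
    calc _ ≤ ∫ τ, S'.indicator (fun _ => M) τ := setIntegral_le_integral hi1 (Eventually.of_forall fun τ => Set.indicator_nonneg (fun _ _ => hM) τ)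
      _ = _ := by rw [integral_indicator hm, setIntegral_const, smul_eq_mul, measureReal_def, hv, mul_comm]
  have h2 : ∫ τ in Set.Ioc a b, W τ ≤ ∫ τ in Set.Ioc a b, (S'.indicator (fun _ => M) τ + δ⁻¹ * (W τ * Q τ)) := by
    refine setIntegral_mono_on hWi (hi1.integrableOn.add (hWQ.const_mul _)) measurableSet_Ioc fun τ hτ => ?_
    have hτ' := Set.Ioc_subset_Icc_self hτ
    have q0 := hQ τ hτ'
    have w0 := hW0 τ
    by_cases hs : τ ∈ S'
    · rw [Set.indicator_of_mem hs]
      have : 0 ≤ δ⁻¹ * (W τ * Q τ) := by positivity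
      linarith [hWM τ]
    · rw [Set.indicator_of_notMem hs, zero_add]
      have := h τ hτ' (fun h' => hs (subset_toMeasurable _ _ h'))
      rw [inv_mul_eq_div, le_div_iff₀ hδ]
      gcongr
  rw [integral_add hi1.integrableOn (hWQ.const_mul _)] at h2
  linarith

end Univ

namespace Univ

lemma good_measure {K : Set ℂ} {t : Finset ℂ} {R σ B M E δ T : ℝ} {η h : ℂ → ℂ} {W : ℝ → ℝ} (hR : 0 < R)
    (hcov : ∀ s ∈ K, ∃ z ∈ t, s ∈ Metric.ball z (R/2)) (hσ : 1/2 < σ)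
    (ht : ∀ z ∈ t, ∀ s ∈ Metric.closedBall z R, σ ≤ s.re ∧ s.re ≤ 1 ∧ |s.im| ≤ B)
    (hη : DifferentiableOn ℂ η Uq) (hh : Differentiable ℂ h) (hW : Continuous W) (hW0 : ∀ τ, 0 ≤ W τ) (hWM : ∀ τ, W τ ≤ M)
    (hT : B < T) (hT0 : 0 ≤ T) (hδ : 0 < δ)
    (hE : ∀ s : ℂ, σ ≤ s.re → s.re ≤ 1 → |s.im| ≤ B → ∫ τ in T..(2*T), W τ * ‖η (s + τ*I) - h s‖^2 ≤ E) :
    ∫ τ in T..(2*T), W τ ≤ M * (volume {τ : ℝ | τ ∈ Set.Icc T (2*T) ∧ ∀ s ∈ K, ‖η (s + τ*I) - h s‖^2 < δ}).toReal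
      + δ⁻¹ * (t.card * (2*Real.pi*E)) := by
  have hab : T ≤ 2*T := by linarith
  have hpi := Real.pi_pos
  have hU : ∀ z ∈ t, ∀ s ∈ Metric.closedBall z R, ∀ τ ∈ Set.Icc T (2*T), s + τ*I ∈ Uq := by
    intro z hz s hs τ hτ
    obtain ⟨h1, h2, h3⟩ := ht z hz s hs
    constructor
    · simp; norm_num at hσ; linarith
    · have := neg_abs_le s.im
      have := hτ.1
      simp; linarith
  have hcm : ∀ z θ, circleMap z R θ ∈ Metric.closedBall z R := fun z θ =>
    Metric.sphere_subset_closedBall (circleMap_mem_sphere z hR.le θ)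
  have hfub : ∀ z ∈ t, IntervalIntegrable (fun τ => ∫ θ in (0:ℝ)..(2*Real.pi), W τ * ‖η (circleMap z R θ + τ*I) - h (circleMap z R θ)‖^2) volume T (2*T) ∧
      ∫ τ in T..(2*T), ∫ θ in (0:ℝ)..(2*Real.pi), W τ * ‖η (circleMap z R θ + τ*I) - h (circleMap z R θ)‖^2 ≤ 2*Real.pi*E := by
    intro z hz
    refine fubini_bound hab (by positivity) ?_ ?_
    · have c1 : ContinuousOn (fun p : ℝ × ℝ => η (circleMap z R p.2 + p.1*I)) (Set.Icc T (2*T) ×ˢ Set.Icc 0 (2*Real.pi)) := by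
        refine hη.continuousOn.comp ?_ fun p hp => hU z hz _ (hcm z p.2) _ hp.1
        have := continuous_circleMap z R
        exact (by fun_prop : Continuous fun p : ℝ × ℝ => circleMap z R p.2 + p.1*I).continuousOn
      have c2 : Continuous (fun p : ℝ × ℝ => h (circleMap z R p.2)) := hh.continuous.comp ((continuous_circleMap z R).comp continuous_snd)
      have c3 : Continuous (fun p : ℝ × ℝ => W p.1) := hW.comp continuous_fst
      exact c3.continuousOn.mul ((c1.sub c2.continuousOn).norm.pow 2)
    · intro θ _
      obtain ⟨h1, h2, h3⟩ := ht z hz _ (hcm z θ)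
      exact hE _ h1 h2 h3
  set Q : ℝ → ℝ := fun τ => ∑ z ∈ t, ∫ θ in (0:ℝ)..(2*Real.pi), ‖η (circleMap z R θ + τ*I) - h (circleMap z R θ)‖^2 with hQ
  have hQ0 : ∀ τ, ∀ z, 0 ≤ ∫ θ in (0:ℝ)..(2*Real.pi), ‖η (circleMap z R θ + τ*I) - h (circleMap z R θ)‖^2 := fun τ z =>
    intervalIntegral.integral_nonneg (by positivity) fun θ _ => by positivity
  have hWQ : (fun τ => W τ * Q τ) = fun τ => ∑ z ∈ t, ∫ θ in (0:ℝ)..(2*Real.pi), W τ * ‖η (circleMap z R θ + τ*I) - h (circleMap z R θ)‖^2 := by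
    funext τ
    rw [hQ, Finset.mul_sum]
    exact Finset.sum_congr rfl fun z _ => (intervalIntegral.integral_const_mul _ _).symm
  have hWQi : IntervalIntegrable (fun τ => W τ * Q τ) volume T (2*T) := by
    rw [hWQ]
    have := IntervalIntegrable.sum (μ := volume) (a := T) (b := 2*T) t (fun z hz => (hfub z hz).1)
    have e : (∑ z ∈ t, fun τ : ℝ => ∫ θ in (0:ℝ)..(2*Real.pi), W τ * ‖η (circleMap z R θ + τ*I) - h (circleMap z R θ)‖^2) =
        fun τ : ℝ => ∑ z ∈ t, ∫ θ in (0:ℝ)..(2*Real.pi), W τ * ‖η (circleMap z R θ + τ*I) - h (circleMap z R θ)‖^2 := by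
      funext τ
      simp
    rw [e] at this
    exact this
  have hWQe : ∫ τ in T..(2*T), W τ * Q τ ≤ t.card * (2*Real.pi*E) := by
    rw [hWQ, intervalIntegral.integral_finsetSum fun z hz => (hfub z hz).1, ← nsmul_eq_mul]
    exact Finset.sum_le_card_nsmul _ _ _ fun z hz => (hfub z hz).2
  have hch := chebyshev (S := {τ : ℝ | τ ∈ Set.Icc T (2*T) ∧ ∀ s ∈ K, ‖η (s + τ*I) - h s‖^2 < δ}) hab hδ hW0 hWM (Q := Q)
    (fun τ _ => Finset.sum_nonneg fun z _ => hQ0 τ z) (hW.intervalIntegrable _ _) hWQi (fun τ hτ => hτ.1) ?_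
  · refine hch.trans ?_
    gcongr
  · intro τ hτ hn
    by_contra hlt
    push Not at hlt
    apply hn
    refine ⟨hτ, fun s hs => lt_of_le_of_lt ?_ hlt⟩
    obtain ⟨z, hz, hsz⟩ := hcov s hs
    have hd : DifferentiableOn ℂ (fun s => η (s + τ*I) - h s) (Metric.closedBall z R) := by
      refine DifferentiableOn.fun_sub ?_ hh.differentiableOn
      exact hη.comp (by fun_prop) fun s hs => hU z hz s hs τ hτ
    refine (cauchy_sq hR hd hsz).trans ?_
    exact Finset.single_le_sum (f := fun z => ∫ θ in (0:ℝ)..(2*Real.pi), ‖η (circleMap z R θ + τ*I) - h (circleMap z R θ)‖^2) (fun z _ => hQ0 τ z) hz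

lemma aC_prime {p : ℕ} (hp : p.Prime) (m : ℕ) : (aC (m+1) p : ℂ) = ((Real.log p : ℂ)^m)⁻¹ := by
  have h0 : Real.log p ≠ 0 := (Real.log_pos (by exact_mod_cast hp.one_lt)).ne'
  have h1 : aC (m+1) p = ((Real.log p)^m)⁻¹ := by
    unfold aC
    rw [ArithmeticFunction.vonMangoldt_apply_prime hp, pow_succ]
    field_simp
  rw [h1]
  push_cast
  rfl

lemma appr_h (m y : ℕ) : Differentiable ℂ fun s : ℂ => ∑ n ∈ Finset.range (y+1), (aC (m+1) n : ℂ)*(n:ℂ)^(-s) :=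
  Differentiable.fun_sum fun n _ => aC_cpow_diff (m+1) n

lemma wsq_bound {a b : ℝ} (hab : a ≤ b) {W : ℝ → ℝ} (hW : Continuous W) (hW0 : ∀ τ, 0 ≤ W τ) {M : ℝ} (hWM : ∀ τ, W τ ≤ M)
    {u v : ℝ → ℂ} {w : ℂ} (hu : ContinuousOn u (Set.Icc a b)) (hv : ContinuousOn v (Set.Icc a b)) {E₁ E₂ : ℝ}
    (h1 : ∫ τ in a..b, ‖u τ - v τ‖^2 ≤ E₁) (h2 : ∫ τ in a..b, W τ * ‖v τ - w‖^2 ≤ E₂) :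
    ∫ τ in a..b, W τ * ‖u τ - w‖^2 ≤ 2*M*E₁ + 2*E₂ := by
  have hM : 0 ≤ M := (hW0 0).trans (hWM 0)
  have hui : Set.uIcc a b = Set.Icc a b := Set.uIcc_of_le hab
  have i1 : IntervalIntegrable (fun τ => 2*M*‖u τ - v τ‖^2) volume a b :=
    (ContinuousOn.mul continuousOn_const ((hui ▸ hu.sub hv).norm.pow 2)).intervalIntegrable
  have i2 : IntervalIntegrable (fun τ => 2*(W τ * ‖v τ - w‖^2)) volume a b :=
    (ContinuousOn.mul continuousOn_const (hW.continuousOn.mul ((hui ▸ hv.sub continuousOn_const).norm.pow 2))).intervalIntegrable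
  have i3 : IntervalIntegrable (fun τ => W τ * ‖u τ - w‖^2) volume a b :=
    (hW.continuousOn.mul ((hui ▸ hu.sub continuousOn_const).norm.pow 2)).intervalIntegrable
  have h3 : ∫ τ in a..b, W τ * ‖u τ - w‖^2 ≤ ∫ τ in a..b, (2*M*‖u τ - v τ‖^2 + 2*(W τ * ‖v τ - w‖^2)) := by
    refine intervalIntegral.integral_mono_on hab i3 (i1.add i2) fun τ _ => ?_
    have q := aux_sq (norm_nonneg (u τ - w)) (norm_sub_le_norm_sub_add_norm_sub (u τ) (v τ) w)
    have q1 := mul_le_mul_of_nonneg_left q (hW0 τ)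
    have q2 := mul_le_mul_of_nonneg_right (hWM τ) (by positivity : 0 ≤ ‖u τ - v τ‖^2)
    linarith
  rw [intervalIntegral.integral_add i1 i2, intervalIntegral.integral_const_mul, intervalIntegral.integral_const_mul] at h3
  have q1 := mul_le_mul_of_nonneg_left h1 (by positivity : 0 ≤ 2*M)
  linarith

theorem main_count (hRH : RiemannHypothesis) (m : ℕ) {K : Set ℂ} (hK : IsCompact K)
    (hKsub : K ⊆ {s : ℂ | 1 / 2 < s.re ∧ s.re < 1}) (hKc : IsConnected Kᶜ)
    {f : ℂ → ℂ} (hf : ContinuousOn f K) (hf' : DifferentiableOn ℂ f (interior K)) {ε : ℝ} (hε : 0 < ε) :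
    ∃ c : ℝ, 0 < c ∧ ∀ᶠ T : ℝ in atTop, c ≤ (volume {τ : ℝ | τ ∈ Set.Icc T (2 * T) ∧
            ∀ s ∈ K, ‖etaG (m+1) (s + τ * I) - f s‖ < ε}).toReal / T := by
  have : CompactSpace K := isCompact_iff_compactSpace.1 hK
  obtain ⟨σ₀, σ₁, B, hσ₀, hσ₀1, hσ₁, hB, hbox⟩ := box hK hKsub
  set R := min ((σ₀ - 1/2)/2) (1 - σ₁) with hRdef
  have hR : 0 < R := lt_min (by linarith) (by linarith)
  have hR1 : R ≤ (σ₀ - 1/2)/2 := min_le_left _ _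
  have hR2 : R ≤ 1 - σ₁ := min_le_right _ _
  obtain ⟨t', htK, htf, hcov'⟩ := hK.finite_cover_balls (half_pos hR)
  set t := htf.toFinset with ht
  have hcov : ∀ s ∈ K, ∃ z ∈ t, s ∈ Metric.ball z (R/2) := by
    intro s hs
    have := hcov' hs
    simp only [Set.mem_iUnion] at this
    obtain ⟨z, hz, hsz⟩ := this
    exact ⟨z, by simpa [ht] using hz, hsz⟩
  have htb : ∀ z ∈ t, ∀ s ∈ Metric.closedBall z R, σ₀ - R ≤ s.re ∧ s.re ≤ 1 ∧ |s.im| ≤ B + R := by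
    intro z hz s hs
    have hzK : z ∈ K := htK (by simpa [ht] using hz)
    obtain ⟨b1, b2, b3⟩ := hbox z hzK
    rw [mem_closedBall_iff_norm] at hs
    have r1 := (abs_le.1 ((abs_re_le_norm (s - z)).trans hs))
    have r2 := (abs_le.1 ((abs_im_le_norm (s - z)).trans hs))
    rw [sub_re] at r1
    rw [sub_im] at r2
    obtain ⟨b4, b5⟩ := abs_le.1 b3
    exact ⟨by linarith, by linarith, abs_le.2 ⟨by linarith, by linarith⟩⟩
  have hσ' : 1/2 < σ₀ - R := by linarith
  have hpi := Real.pi_pos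
  set δ : ℝ := (ε/2)^2 with hδd
  have hδ : 0 < δ := by positivity
  set d : ℝ := δ / (8 * Real.pi * (t.card + 1)) with hdd
  have hd : 0 < d := by positivity
  obtain ⟨y, hy⟩ := weight m hσ' (show 0 < d/4 by positivity)
  have hw := hy y le_rfl
  have hfa : Appr K (fun s => f s - ∑ n ∈ Finset.range (y+1), (aC (m+1) n : ℂ)*(n:ℂ)^(-s)) :=
    mergelyan hK hKc (hf.sub (appr_h m y).continuous.continuousOn) (hf'.fun_sub (appr_h m y).differentiableOn)
  obtain ⟨P, c, hP, hc, hPf⟩ := density hRH hK hKsub hfa m y (half_pos hε)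
  obtain ⟨W, hWc, hW0, ⟨M', hM'⟩, hWlim, N₁, hN₁⟩ := hw P c hP hc
  set M := max M' 1 with hM
  have hM1 : 1 ≤ M := le_max_right _ _
  have hM0 : 0 < M := by linarith
  have hWM : ∀ τ, W τ ≤ M := fun τ => (hM' τ).trans (le_max_left _ _)
  obtain ⟨N₀, hN₀⟩ := mean_tail hRH m hσ' (by linarith : σ₀ - R ≤ 1) (by linarith : 0 ≤ B + R) (show 0 < d/(4*M) by positivity)
  obtain ⟨T₁, hT₁⟩ := hN₁ (max N₀ N₁) (le_max_right _ _)
  obtain ⟨T₀, hT₀⟩ := hN₀ (max N₀ N₁) (le_max_left _ _)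
  set N := max N₀ N₁ with hN
  set h : ℂ → ℂ := fun s => ∑ n ∈ Finset.range (y+1), (aC (m+1) n : ℂ)*(n:ℂ)^(-s) + ∑ p ∈ P, c p * (aC (m+1) p : ℂ) * (p:ℂ)^(-s) with hh
  have hhd : Differentiable ℂ h := by
    refine (appr_h m y).fun_add (Differentiable.fun_sum fun p _ => ?_)
    simp_rw [mul_assoc]
    exact (aC_cpow_diff (m+1) p).const_mul _
  have hhf : ∀ s ∈ K, ‖h s - f s‖ < ε/2 := by
    intro s hs
    refine lt_of_eq_of_lt ?_ (hPf s hs)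
    congr 1
    have : ∑ p ∈ P, c p * (aC (m+1) p : ℂ) * (p:ℂ)^(-s) = ∑ p ∈ P, c p * ((Real.log p : ℂ)^m)⁻¹ * (p:ℂ)^(-s) :=
      Finset.sum_congr rfl fun p hp => by rw [aC_prime (hP p hp).1]
    simp only [hh, this]
    ring
  refine ⟨1/(4*M), by positivity, ?_⟩
  filter_upwards [eventually_ge_atTop T₀, eventually_ge_atTop T₁, eventually_gt_atTop (B+R), eventually_gt_atTop 0,
    hWlim.eventually (lt_mem_nhds (by norm_num : (1/2:ℝ) < 1))] with T a0 a1 a2 a3 a4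
  have hab : T ≤ 2*T := by linarith
  have hE : ∀ s : ℂ, σ₀ - R ≤ s.re → s.re ≤ 1 → |s.im| ≤ B + R → ∫ τ in T..(2*T), W τ * ‖etaG (m+1) (s + τ*I) - h s‖^2 ≤ d*T := by
    intro s s1 s2 s3
    have e := wsq_bound (u := fun τ : ℝ => etaG (m+1) (s + τ*I)) (v := fun τ : ℝ => Dp (m+1) N (s + τ*I)) (w := h s) hab hWc hW0 hWM ?_ ?_ (hT₀ T a0 s s1 s2 s3) (hT₁ T a1 s s1)
    · refine e.trans (le_of_eq ?_)
      field_simp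
      ring
    · refine (etaG_diff hRH (m+1)).continuousOn.comp (by fun_prop) fun τ hτ => ?_
      have := neg_abs_le s.im
      have := hτ.1
      constructor
      · simp; norm_num at hσ'; linarith
      · simp; linarith
    · have := (Dp_diff (m+1) N).continuous
      exact (by fun_prop : Continuous fun τ : ℝ => Dp (m+1) N (s + τ*I)).continuousOn
  have hg := good_measure hR hcov hσ' htb (etaG_diff hRH (m+1)) hhd hWc hW0 hWM a2 a3.le hδ hE
  have hmono : (volume {τ : ℝ | τ ∈ Set.Icc T (2*T) ∧ ∀ s ∈ K, ‖etaG (m+1) (s + τ*I) - h s‖^2 < δ}).toReal ≤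
      (volume {τ : ℝ | τ ∈ Set.Icc T (2 * T) ∧ ∀ s ∈ K, ‖etaG (m+1) (s + τ * I) - f s‖ < ε}).toReal := by
    refine ENNReal.toReal_mono ?_ (measure_mono ?_)
    · exact ((measure_mono (fun τ hτ => hτ.1 : _ ⊆ Set.Icc T (2*T))).trans_lt (by simp)).ne
    · intro τ hτ
      refine ⟨hτ.1, fun s hs => ?_⟩
      have e1 := lt_of_pow_lt_pow_left₀ 2 (by positivity) (hτ.2 s hs)
      have e2 := hhf s hs
      have e3 := norm_sub_le_norm_sub_add_norm_sub (etaG (m+1) (s + τ * I)) (h s) (f s)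
      linarith
  have hlast : δ⁻¹ * (t.card * (2*Real.pi*(d*T))) ≤ T/4 := by
    have : δ⁻¹ * (t.card * (2*Real.pi*(d*T))) = (t.card / (t.card + 1)) * (T/4) := by
      rw [hdd]
      field_simp
      ring
    rw [this]
    have h1 : (t.card : ℝ) / (t.card + 1) ≤ 1 := by
      rw [div_le_one (by positivity)]
      linarith
    exact mul_le_of_le_one_left (by linarith) h1
  rw [lt_div_iff₀ a3] at a4
  rw [le_div_iff₀ a3, div_mul_eq_mul_div, one_mul, div_le_iff₀ (by positivity)]
  have := mul_le_mul_of_nonneg_left hmono hM0.le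
  linarith

end Univ

namespace Univ

lemma etaIter_eq (m : ℕ) : etaIter m = etaG (m+1) := by
  induction m with
  | zero =>
    funext s
    simp only [etaIter, etaG]
    rw [← integral_neg]
  | succ k ih =>
    funext s
    rw [etaIter, ih]
    rfl

end Univ

theorem universality_of_etaIter (hRH : RiemannHypothesis)
    (m : ℕ) (K : Set ℂ) (hK : IsCompact K)
    (hKsub : K ⊆ {s : ℂ | 1 / 2 < s.re ∧ s.re < 1})
    (hKc : IsConnected Kᶜ)
    (f : ℂ → ℂ) (hf : ContinuousOn f K) (hf' : DifferentiableOn ℂ f (interior K))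
    (ε : ℝ) (hε : 0 < ε) :
    0 < liminf (fun T : ℝ =>
        (volume {τ : ℝ | τ ∈ Set.Icc T (2 * T) ∧
            ∀ s ∈ K, ‖etaIter m (s + τ * I) - f s‖ < ε}).toReal / T)
      atTop := by
  rw [Univ.etaIter_eq]
  obtain ⟨c, hc, h⟩ := Univ.main_count hRH m hK hKsub hKc hf hf' hε
  refine lt_of_lt_of_le hc (le_liminf_of_le ?_ h)
  refine Filter.isCoboundedUnder_ge_of_eventually_le (x := 1) atTop ?_
  filter_upwards [eventually_gt_atTop 0] with T hT
  rw [div_le_one hT]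
  refine (ENNReal.toReal_mono (b := volume (Set.Icc T (2*T))) (by simp) (measure_mono fun τ hτ => hτ.1)).trans ?_
  rw [Real.volume_Icc, ENNReal.toReal_ofReal (by linarith)]
  linarith
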